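/- Let k ≥ 1 and n ∈ ℕ with 2n ≥ k² + 3, let N ∈ ℕ and v_0 ∈ ℤ^{2n} with gcd(v_0, N) = 1. Let E ⊆ (ℝ^{2n})^k be a Jordan measurable set admitting projection bounds (E_r)_{1≤r≤k}. Then there exists a constant C > 0, depending only on n and k, such that 0 ≤ ∫_{SL_{2n}(ℝ)/Γ_{2n}(N)} ( S_{(v_0,N)}(χ_E) )² dμ_N − ( ∫_{SL_{2n}(ℝ)/Γ_{2n}(N)} S_{(v_0,N)}(χ_E) dμ_N )² ≤ C · max{ vol_{r_1}(E_{r_1}) · vol_{r_2}(E_{r_2}) : 0 ≤ r_1, r_2 ≤ k, 1 ≤ r_1 + r_2 ≤ 2k−1 }, where S_{(v_0,N)}(χ_E) is the rank-k congruence Siegel transform of the characteristic function of E. -/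

import Mathlib

open Matrix MeasureTheory

noncomputable section

instance (m : ℕ) : MeasurableSpace (Matrix (Fin m) (Fin m) ℝ) := MeasurableSpace.pi

noncomputable instance (m : ℕ) : TopologicalSpace (Matrix.SpecialLinearGroup (Fin m) ℝ) :=
  instTopologicalSpaceSubtype

instance (m : ℕ) : MeasurableSpace (Matrix.SpecialLinearGroup (Fin m) ℝ) :=
  Subtype.instMeasurableSpace

abbrev SLR (m : ℕ) := Matrix.SpecialLinearGroup (Fin m) ℝ

/-- `SL_m(ℤ)`, viewed as a subgroup of `SL_m(ℝ)`. -/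
def SLZ (m : ℕ) : Subgroup (SLR m) :=
  (Matrix.SpecialLinearGroup.map (n := Fin m) (Int.castRingHom ℝ)).range

/-- The space `X_m = SL_m(ℝ)/SL_m(ℤ)`. -/
abbrev Xspace (m : ℕ) := SLR m ⧸ SLZ m

/-- Jordan measurability: bounded with null topological boundary. -/
def JordanMeasurable {k d : ℕ} (S : Set (Fin k → Fin d → ℝ)) : Prop :=
  Bornology.IsBounded S ∧ volume (frontier S) = 0

/-- `vol_r`, with the convention `vol_0 = 1`. -/
def jvol (d r : ℕ) (S : Set (Fin r → Fin d → ℝ)) : ℝ :=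
  if r = 0 then 1 else (volume S).toReal

/-- The principal congruence subgroup `Γ_m(N) = {γ ∈ SL_m(ℤ) : γ ≡ I mod N}`, viewed as a
subgroup of `SL_m(ℝ)` (as the image of the kernel of reduction mod `N`). -/
def GammaN (m N : ℕ) : Subgroup (SLR m) :=
  Subgroup.map (Matrix.SpecialLinearGroup.map (n := Fin m) (Int.castRingHom ℝ))
    (MonoidHom.ker (Matrix.SpecialLinearGroup.map (n := Fin m) (Int.castRingHom (ZMod N))))

/-- The space `SL_m(ℝ)/Γ_m(N)`. -/
abbrev XspaceN (m N : ℕ) := SLR m ⧸ GammaN m N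


set_option linter.all false

section PartA

open scoped ENNReal

variable {ι : Type*} {d N : ℕ}

/-- action on tuples -/
def act (g : Matrix (Fin d) (Fin d) ℝ) (V : ι → Fin d → ℝ) : ι → Fin d → ℝ :=
  fun i => g.mulVec (V i)

/-- cast of integer tuples -/
def cst (U : ι → Fin d → ℤ) : ι → Fin d → ℝ := fun i j => (U i j : ℝ)

/-- Siegel sum on the group -/
def Ssum (O : Set (ι → Fin d → ℤ)) (f : (ι → Fin d → ℝ) → ℝ≥0∞) (g : Matrix (Fin d) (Fin d) ℝ) :
    ℝ≥0∞ := ∑' U : O, f (act g (cst U.1))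

/-- stability under the congruence group -/
def Stab (N : ℕ) (O : Set (ι → Fin d → ℤ)) : Prop :=
  ∀ γ : Matrix.SpecialLinearGroup (Fin d) ℤ,
    γ ∈ (MonoidHom.ker (Matrix.SpecialLinearGroup.map (n := Fin d) (Int.castRingHom (ZMod N)))) →
    ∀ U ∈ O, (fun i => (γ : Matrix (Fin d) (Fin d) ℤ).mulVec (U i)) ∈ O

/-- Siegel sum on the quotient -/
def Tsum (O : Set (ι → Fin d → ℤ)) (f : (ι → Fin d → ℝ) → ℝ≥0∞) (x : XspaceN d N) : ℝ≥0∞ :=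
  Ssum O f ((Quotient.out x : SLR d) : Matrix (Fin d) (Fin d) ℝ)

structure Good (μ : Measure (XspaceN d N)) : Prop where
  prob : IsProbabilityMeasure μ
  inv : ∀ γ : SLR d, Measure.map (fun x => γ • x) μ = μ

lemma act_mul (g h : Matrix (Fin d) (Fin d) ℝ) (V : ι → Fin d → ℝ) :
    act (g * h) V = act g (act h V) := by
  funext i; simp [act, Matrix.mulVec_mulVec]

lemma act_one (V : ι → Fin d → ℝ) : act (1 : Matrix (Fin d) (Fin d) ℝ) V = V := by
  funext i; simp [act]

lemma cst_smul (γ : Matrix (Fin d) (Fin d) ℤ) (U : ι → Fin d → ℤ) :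
    cst (fun i => γ.mulVec (U i)) = act (γ.map (Int.castRingHom ℝ)) (cst U) := by
  funext i j; simp [cst, act, Matrix.mulVec, dotProduct]

lemma cst_inj : Function.Injective (cst : (ι → Fin d → ℤ) → _) := by
  intro U U' h
  funext i j
  have := congrFun (congrFun h i) j
  simpa [cst] using this

lemma Ssum_mul (O : Set (ι → Fin d → ℤ)) (hO : Stab N O) (f : (ι → Fin d → ℝ) → ℝ≥0∞) (g : SLR d)
    (h : SLR d) (hh : h ∈ GammaN d N) :
    Ssum O f ((g * h : SLR d) : Matrix (Fin d) (Fin d) ℝ) = Ssum O f (g : Matrix (Fin d) (Fin d) ℝ) := by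
  obtain ⟨γ, hγ, rfl⟩ := hh
  have hγ' := inv_mem hγ
  let e : O ≃ O :=
    { toFun := fun U => ⟨_, hO γ hγ U.1 U.2⟩
      invFun := fun U => ⟨_, hO γ⁻¹ hγ' U.1 U.2⟩
      left_inv := fun U => by
        ext i : 2
        simp only [Matrix.mulVec_mulVec, ← Matrix.SpecialLinearGroup.coe_mul, inv_mul_cancel,
          Matrix.SpecialLinearGroup.coe_one, Matrix.one_mulVec]
      right_inv := fun U => by
        ext i : 2
        simp only [Matrix.mulVec_mulVec, ← Matrix.SpecialLinearGroup.coe_mul, mul_inv_cancel,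
          Matrix.SpecialLinearGroup.coe_one, Matrix.one_mulVec] }
  unfold Ssum
  refine Eq.trans ?_ (e.tsum_eq (fun U : O => f (act (g : Matrix (Fin d) (Fin d) ℝ) (cst U.1))))
  refine tsum_congr fun U => ?_
  congr 1
  simp only [e, Equiv.coe_fn_mk, cst_smul, Matrix.SpecialLinearGroup.coe_mul, act_mul]
  rfl

lemma Tsum_mk {O : Set (ι → Fin d → ℤ)} (hO : Stab N O) (f : (ι → Fin d → ℝ) → ℝ≥0∞) (g : SLR d) :
    Tsum (N := N) O f (QuotientGroup.mk g) = Ssum O f (g : Matrix (Fin d) (Fin d) ℝ) := by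
  obtain ⟨h, hh⟩ := QuotientGroup.mk_out_eq_mul (GammaN d N) g
  have : Tsum (N := N) O f (QuotientGroup.mk g) = Ssum O f ((g * h : SLR d) : Matrix (Fin d) (Fin d) ℝ) := by
    unfold Tsum
    rw [← hh]
  rw [this, Ssum_mul O hO f g h h.2]

lemma measurable_entry (i j : Fin d) :
    Measurable (fun g : SLR d => (g : Matrix (Fin d) (Fin d) ℝ) i j) := by
  have h1 : Measurable (fun g : SLR d => (g : Matrix (Fin d) (Fin d) ℝ)) := measurable_subtype_coe
  exact (measurable_pi_apply j).comp ((measurable_pi_apply i).comp h1)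

lemma measurable_act_right (V : ι → Fin d → ℝ) :
    Measurable (fun g : SLR d => act (g : Matrix (Fin d) (Fin d) ℝ) V) := by
  refine measurable_pi_lambda _ fun i => measurable_pi_lambda _ fun j => ?_
  simp only [act, Matrix.mulVec, dotProduct]
  exact Finset.measurable_sum _ fun t _ => (measurable_entry j t).mul measurable_const

lemma measurable_act_left (g : Matrix (Fin d) (Fin d) ℝ) :
    Measurable (fun V : ι → Fin d → ℝ => act g V) := by
  refine measurable_pi_lambda _ fun i => measurable_pi_lambda _ fun j => ?_
  simp only [act, Matrix.mulVec, dotProduct]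
  refine Finset.measurable_sum _ fun t _ => Measurable.const_mul ?_ _
  exact (measurable_pi_apply t).comp (measurable_pi_apply i)

lemma measurable_smulX (h : SLR d) : Measurable (fun x : XspaceN d N => h • x) := by
  rw [QuotientGroup.measurable_from_quotient]
  have : ((fun x : XspaceN d N => h • x) ∘ QuotientGroup.mk) =
      (QuotientGroup.mk : SLR d → XspaceN d N) ∘ (fun g => h * g) := by
    funext g; rfl
  rw [this]
  refine (QuotientGroup.measurable_from_quotient.1 measurable_id).comp ?_
  refine Measurable.subtype_mk ?_
  refine measurable_pi_lambda _ fun i => measurable_pi_lambda _ fun j => ?_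
  simp only [Matrix.mul_apply]
  exact Finset.measurable_sum _ fun t _ => (measurable_entry t j).const_mul _

variable [Fintype ι]

lemma measurable_Tsum {O : Set (ι → Fin d → ℤ)} (hO : Stab N O) {f : (ι → Fin d → ℝ) → ℝ≥0∞}
    (hf : Measurable f) : Measurable (Tsum (N := N) O f) := by
  rw [QuotientGroup.measurable_from_quotient]
  have : (Tsum (N := N) O f ∘ QuotientGroup.mk) =
      fun g : SLR d => Ssum O f (g : Matrix (Fin d) (Fin d) ℝ) := by
    funext g; exact Tsum_mk hO f g
  rw [this]
  exact Measurable.tsum fun U => hf.comp (measurable_act_right _)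

lemma lintegral_Tsum_smul {μ : Measure (XspaceN d N)} (hμ : Good μ) {O : Set (ι → Fin d → ℤ)}
    (hO : Stab N O) {f : (ι → Fin d → ℝ) → ℝ≥0∞}
    (hf : Measurable f) (h : SLR d) :
    ∫⁻ x, Tsum O (fun V => f (act (h : Matrix (Fin d) (Fin d) ℝ) V)) x ∂μ = ∫⁻ x, Tsum O f x ∂μ := by
  conv_rhs => rw [← hμ.inv h, lintegral_map (measurable_Tsum hO hf) (measurable_smulX h)]
  refine lintegral_congr fun x => ?_
  induction x using QuotientGroup.induction_on with
  | H g =>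
    rw [Tsum_mk hO]
    have : h • (QuotientGroup.mk g : XspaceN d N) = QuotientGroup.mk (h * g) := rfl
    rw [this, Tsum_mk hO]
    simp only [Ssum, Matrix.SpecialLinearGroup.coe_mul, act_mul]

/-- the point measure -/
def kap (O : Set (ι → Fin d → ℤ)) (x : XspaceN d N) : Measure (ι → Fin d → ℝ) :=
  Measure.sum fun U : O => Measure.dirac (act ((Quotient.out x : SLR d) : Matrix (Fin d) (Fin d) ℝ) (cst U.1))

lemma lintegral_kap (O : Set (ι → Fin d → ℤ)) (x : XspaceN d N) {f : (ι → Fin d → ℝ) → ℝ≥0∞}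
    (hf : Measurable f) : ∫⁻ V, f V ∂(kap O x) = Tsum O f x := by
  simp only [kap, lintegral_sum_measure, lintegral_dirac' _ hf]
  rfl

lemma kap_apply (O : Set (ι → Fin d → ℤ)) (x : XspaceN d N) {s : Set (ι → Fin d → ℝ)}
    (hs : MeasurableSet s) : kap O x s = Tsum O (s.indicator 1) x := by
  rw [← lintegral_kap O x (measurable_one.indicator hs), lintegral_indicator_one hs]

lemma measurable_kap {O : Set (ι → Fin d → ℤ)} (hO : Stab N O) :
    Measurable (kap (N := N) O) := by
  refine Measure.measurable_of_measurable_coe _ fun s hs => ?_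
  simp only [kap_apply O _ hs]
  exact measurable_Tsum hO (measurable_one.indicator hs)

/-- the intensity measure -/
def nuO (μ : Measure (XspaceN d N)) (O : Set (ι → Fin d → ℤ)) : Measure (ι → Fin d → ℝ) :=
  μ.bind (kap O)

lemma lintegral_nuO (μ : Measure (XspaceN d N)) {O : Set (ι → Fin d → ℤ)} (hO : Stab N O)
    {f : (ι → Fin d → ℝ) → ℝ≥0∞} (hf : Measurable f) :
    ∫⁻ V, f V ∂(nuO μ O) = ∫⁻ x, Tsum O f x ∂μ := by
  rw [nuO, Measure.lintegral_bind (measurable_kap hO).aemeasurable hf.aemeasurable]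
  exact lintegral_congr fun x => lintegral_kap O x hf

lemma act_inj (g : SLR d) : Function.Injective (act (ι := ι) (g : Matrix (Fin d) (Fin d) ℝ)) := by
  intro V W h
  have := congrArg (act ((g⁻¹ : SLR d) : Matrix (Fin d) (Fin d) ℝ)) h
  simpa only [← act_mul, ← Matrix.SpecialLinearGroup.coe_mul, inv_mul_cancel,
    Matrix.SpecialLinearGroup.coe_one, act_one] using this

/-- only finitely many integer tuples land in a bounded set -/
lemma finite_pts (g : SLR d) (R : ℝ) :
    {U : ι → Fin d → ℤ | act (g : Matrix (Fin d) (Fin d) ℝ) (cst U) ∈ Metric.closedBall 0 R}.Finite := by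
  have hb : Bornology.IsBounded ((act ((g⁻¹ : SLR d) : Matrix (Fin d) (Fin d) ℝ)) ''
      (Metric.closedBall (0 : ι → Fin d → ℝ) R)) := by
    have hc : Continuous (act (ι := ι) ((g⁻¹ : SLR d) : Matrix (Fin d) (Fin d) ℝ)) := by
      unfold act
      exact continuous_pi fun i => Continuous.matrix_mulVec continuous_const (continuous_apply i)
    exact ((isCompact_closedBall _ _).image hc).isBounded
  obtain ⟨C, hC⟩ := hb.subset_closedBall 0
  classical
  have hfin : (Set.Icc (fun (_ : ι) (_ : Fin d) => -⌈C⌉) (fun _ _ => ⌈C⌉)).Finite := Set.finite_Icc _ _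
  refine hfin.subset fun U hU => ?_
  have h1 : cst U ∈ Metric.closedBall (0 : ι → Fin d → ℝ) C := by
    refine hC ⟨_, hU, ?_⟩
    rw [← act_mul, ← Matrix.SpecialLinearGroup.coe_mul, inv_mul_cancel,
      Matrix.SpecialLinearGroup.coe_one, act_one]
  rw [mem_closedBall_zero_iff] at h1
  have h2 : ∀ i j, |(U i j : ℝ)| ≤ C := fun i j => by
    have := (norm_le_pi_norm (cst U i) j).trans ((norm_le_pi_norm (cst U) i).trans h1)
    simpa [cst] using this
  refine ⟨fun i j => ?_, fun i j => ?_⟩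
  · have := (abs_le.1 (h2 i j)).1
    have h3 := Int.le_ceil C
    have : ((-⌈C⌉ : ℤ) : ℝ) ≤ (U i j : ℝ) := by push_cast; linarith
    exact_mod_cast this
  · have := (abs_le.1 (h2 i j)).2
    have h3 := Int.le_ceil C
    have : ((U i j : ℤ) : ℝ) ≤ (⌈C⌉ : ℤ) := by linarith
    exact_mod_cast this

lemma Ssum_ball_lt_top (O : Set (ι → Fin d → ℤ)) (g : SLR d) (R : ℝ) :
    Ssum O ((Metric.closedBall (0 : ι → Fin d → ℝ) R).indicator 1) (g : Matrix (Fin d) (Fin d) ℝ) < ⊤ := by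
  have hfin := finite_pts (ι := ι) g R
  have hfin3 : {U : O | act (g : Matrix (Fin d) (Fin d) ℝ) (cst U.1) ∈ Metric.closedBall 0 R}.Finite :=
    Set.Finite.preimage (f := Subtype.val) Subtype.val_injective.injOn hfin
  unfold Ssum
  rw [tsum_eq_sum (s := hfin3.toFinset)]
  · refine ENNReal.sum_lt_top.2 fun U _ => ?_
    by_cases h : act (g : Matrix (Fin d) (Fin d) ℝ) (cst U.1) ∈ Metric.closedBall 0 R
    · simp [Set.indicator_of_mem h]
    · simp [Set.indicator_of_notMem h]
  · intro U hU
    simp only [Set.Finite.mem_toFinset, Set.mem_setOf_eq] at hU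
    simp [Set.indicator_of_notMem hU]

lemma sfinite_nuO (μ : Measure (XspaceN d N)) [IsFiniteMeasure μ] {O : Set (ι → Fin d → ℤ)} (hO : Stab N O) :
    SFinite (nuO μ O) := by
  let B : ℕ → Set (ι → Fin d → ℝ) := disjointed fun n : ℕ => Metric.closedBall (0 : ι → Fin d → ℝ) (n : ℝ)
  have hBm : ∀ n, MeasurableSet (B n) := fun n =>
    MeasurableSet.disjointed (fun n => Metric.isClosed_closedBall.measurableSet) n
  have hBd : Pairwise (Function.onFun Disjoint B) := disjoint_disjointed _
  have hBu : ⋃ n, B n = Set.univ := by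
    rw [iUnion_disjointed]
    exact Metric.iUnion_closedBall_nat 0
  have hfin : ∀ n x, kap (N := N) O x (B n) < ⊤ := fun n x => by
    refine (measure_mono (disjointed_le _ n)).trans_lt ?_
    rw [kap_apply _ _ Metric.isClosed_closedBall.measurableSet]
    exact Ssum_ball_lt_top O _ _
  have hmk : ∀ s, MeasurableSet s → Measurable fun x => kap (N := N) O x s := fun s hs =>
    (Measure.measurable_coe hs).comp (measurable_kap hO)
  let A : ℕ → ℕ → Set (XspaceN d N) := fun n => disjointed fun m : ℕ => {x | kap O x (B n) ≤ m}
  have hA0 : ∀ (n m : ℕ), MeasurableSet {x : XspaceN d N | kap O x (B n) ≤ (m : ℝ≥0∞)} := fun n m =>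
    measurableSet_le (hmk _ (hBm n)) measurable_const
  have hAm : ∀ n m, MeasurableSet (A n m) := fun n m => MeasurableSet.disjointed (hA0 n) m
  have hAd : ∀ n, Pairwise (Function.onFun Disjoint (A n)) := fun n => disjoint_disjointed _
  have hAu : ∀ n, ⋃ m, A n m = Set.univ := fun n => by
    rw [iUnion_disjointed]
    refine Set.eq_univ_of_forall fun x => ?_
    obtain ⟨m, hm⟩ := ENNReal.exists_nat_gt (hfin n x).ne
    exact Set.mem_iUnion.2 ⟨m, hm.le⟩
  have hmr : ∀ n, Measurable fun x => (kap (N := N) O x).restrict (B n) := fun n =>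
    Measure.measurable_of_measurable_coe _ fun s hs => by
      simp only [Measure.restrict_apply hs]
      exact hmk _ (hs.inter (hBm n))
  let ν : ℕ × ℕ → Measure (ι → Fin d → ℝ) := fun p =>
    (μ.restrict (A p.1 p.2)).bind fun x => (kap O x).restrict (B p.1)
  have hν : ∀ p, IsFiniteMeasure (ν p) := fun p => by
    refine ⟨?_⟩
    simp only [ν]
    rw [Measure.bind_apply MeasurableSet.univ (hmr _).aemeasurable]
    calc ∫⁻ x in A p.1 p.2, (kap O x).restrict (B p.1) Set.univ ∂μ
        ≤ ∫⁻ x in A p.1 p.2, (p.2 : ℝ≥0∞) ∂μ := by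
          refine setLIntegral_mono measurable_const fun x hx => ?_
          rw [Measure.restrict_apply_univ]
          exact disjointed_subset (fun m : ℕ => {x | kap O x (B p.1) ≤ m}) p.2 hx
      _ < ⊤ := by
          rw [setLIntegral_const]
          exact ENNReal.mul_lt_top (ENNReal.natCast_lt_top _) (measure_lt_top _ _)
  have : nuO μ O = Measure.sum ν := by
    ext s hs
    rw [Measure.sum_apply _ hs, ENNReal.tsum_prod', nuO, Measure.bind_apply hs (measurable_kap hO).aemeasurable]
    have h1 : ∀ x, kap (N := N) O x s = ∑' n, kap O x (s ∩ B n) := fun x => by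
      rw [← measure_iUnion, ← Set.inter_iUnion, hBu, Set.inter_univ]
      · exact fun i j hij => (hBd hij).mono Set.inter_subset_right Set.inter_subset_right
      · exact fun n => hs.inter (hBm n)
    simp only [h1]
    rw [lintegral_tsum fun n => (hmk _ (hs.inter (hBm n))).aemeasurable]
    refine tsum_congr fun n => ?_
    rw [← setLIntegral_univ, ← hAu n, lintegral_iUnion (hAm n) (hAd n)]
    refine tsum_congr fun m => ?_
    simp only [ν]
    rw [Measure.bind_apply hs (hmr _).aemeasurable]
    simp only [Measure.restrict_apply hs]
  rw [this]
  infer_instance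

end PartA

section PartB

open scoped ENNReal

variable {ι : Type*} [Fintype ι] [DecidableEq ι] {d N : ℕ}

/-- minor -/
def mnr (f : ι → Fin d) (V : ι → Fin d → ℝ) : Matrix ι ι ℝ := Matrix.of fun l b => V l (f b)

/-- translation in one coordinate -/
def trc (i : Fin d) (w : ι → ℝ) : ι → Fin d → ℝ := fun l => Pi.single i (w l)

lemma measurable_entryV (l : ι) (j : Fin d) : Measurable fun V : ι → Fin d → ℝ => V l j :=
  (measurable_pi_apply j).comp (measurable_pi_apply l)

lemma null_minor (f : ι → Fin d) (hf : Function.Injective f) (V : ι → Fin d → ℝ)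
    (hV : LinearIndependent ℝ V) :
    ∀ᵐ H : Fin d → Fin d → ℝ, (mnr f (act (Matrix.of H) V)).det ≠ 0 := by
  have hinj : Function.Injective (Matrix.of V).vecMul := Matrix.vecMul_injective_iff.2 hV
  obtain ⟨P, hP⟩ : ∃ P : Matrix (Fin d) ι ℝ, Matrix.of V * P = 1 := by
    rw [← Matrix.mulVec_surjective_iff_exists_right_inverse]
    have h2 := hV.rank_matrix (M := Matrix.of V)
    have := LinearMap.range_eq_top (f := (Matrix.of V).mulVecLin)
    rw [← Matrix.coe_mulVecLin, ← this]
    apply Submodule.eq_top_of_finrank_eq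
    rw [Module.finrank_fintype_fun_eq_card]
    exact h2
  let H0 : Fin d → Fin d → ℝ := Function.extend f (fun b t => P t b) 0
  have key : ∀ (H : Fin d → Fin d → ℝ) (x : ℝ), mnr f (act (Matrix.of (H + x • H0)) V) =
      mnr f (act (Matrix.of H) V) + x • 1 := by
    intro H x
    ext l b
    have h1 := congrFun (congrFun hP l) b
    simp only [Matrix.mul_apply, Matrix.of_apply] at h1
    simp only [mnr, act, Matrix.mulVec, dotProduct, Matrix.of_apply, Matrix.add_apply,
      Matrix.smul_apply, ← h1, Pi.add_apply, Pi.smul_apply, smul_eq_mul, add_mul,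
      Finset.sum_add_distrib, Finset.mul_sum, H0, hf.extend_apply]
    congr 1
    exact Finset.sum_congr rfl fun t _ => by ring
  have hms : MeasurableSet {H : Fin d → Fin d → ℝ | (mnr f (act (Matrix.of H) V)).det ≠ 0} := by
    have hc : Continuous fun H : Fin d → Fin d → ℝ => (mnr f (act (Matrix.of H) V)).det := by
      refine Continuous.matrix_det ?_
      refine continuous_matrix fun l b => ?_
      simp only [mnr, act, Matrix.mulVec, dotProduct, Matrix.of_apply]
      fun_prop
    exact (isOpen_ne_fun hc continuous_const).measurableSet
  let L : ℝ →ₗ[ℝ] (Fin d → Fin d → ℝ) := LinearMap.toSpanSingleton ℝ _ H0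
  refine MeasureTheory.ae_mem_of_ae_add_linearMap_mem L volume volume hms fun H => ?_
  have hfin : {x : ℝ | (-(mnr f (act (Matrix.of H) V))).charpoly.IsRoot x}.Finite := by
    exact Polynomial.finite_setOf_isRoot (Matrix.charpoly_monic _).ne_zero
  have := hfin.measure_zero volume
  filter_upwards [compl_mem_ae_iff.2 this] with x hx
  change (mnr f (act (Matrix.of (H + x • H0)) V)).det ≠ 0
  rw [key]
  intro h0
  apply hx
  simp only [Set.mem_setOf_eq, Polynomial.IsRoot.def, Matrix.eval_charpoly]
  rw [← h0]
  congr 1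
  rw [sub_neg_eq_add, add_comm, Matrix.scalar_apply, Matrix.smul_one_eq_diagonal]

/-- hypotheses on the intensity measure -/
structure InvM (ν : Measure (ι → Fin d → ℝ)) : Prop where
  sf : SFinite ν
  inv : ∀ (h : SLR d) (f : (ι → Fin d → ℝ) → ℝ≥0∞), Measurable f →
    ∫⁻ V, f (act (h : Matrix (Fin d) (Fin d) ℝ) V) ∂ν = ∫⁻ V, f V ∂ν
  li : ∀ᵐ V ∂ν, LinearIndependent ℝ V

lemma mnr_smul (f : ι → Fin d) (c : ℝ) (H : Matrix (Fin d) (Fin d) ℝ) (V : ι → Fin d → ℝ) :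
    mnr f (act (c • H) V) = c • mnr f (act H V) := by
  ext l b
  simp [mnr, act, Matrix.smul_mulVec]

lemma measurable_mnr_det (f : ι → Fin d) : Measurable fun V : ι → Fin d → ℝ => (mnr f V).det := by
  have hc : Continuous fun V : ι → Fin d → ℝ => (mnr f V).det := by
    refine Continuous.matrix_det ?_
    refine continuous_matrix fun l b => ?_
    simp only [mnr, Matrix.of_apply]
    fun_prop
  exact hc.measurable

lemma generic [NeZero d] {ν : Measure (ι → Fin d → ℝ)} (hν : InvM ν) (f : ι → Fin d)
    (hf : Function.Injective f) : ∀ᵐ V ∂ν, (mnr f V).det ≠ 0 := by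
  haveI := hν.sf
  have hc : Continuous fun p : (ι → Fin d → ℝ) × (Fin d → Fin d → ℝ) =>
      (mnr f (act (Matrix.of p.2) p.1)).det := by
    refine Continuous.matrix_det ?_
    refine continuous_matrix fun l b => ?_
    simp only [mnr, act, Matrix.mulVec, dotProduct, Matrix.of_apply]
    fun_prop
  have h1 : ∀ᵐ V ∂ν, ∀ᵐ H : Fin d → Fin d → ℝ, (mnr f (act (Matrix.of H) V)).det ≠ 0 := by
    filter_upwards [hν.li] with V hV using null_minor f hf V hV
  rw [Measure.ae_ae_comm (isOpen_ne_fun hc continuous_const).measurableSet] at h1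
  let A : Set (Fin d → Fin d → ℝ) := {H | 0 < (Matrix.of H).det}
  have hA : IsOpen A := by
    refine isOpen_lt continuous_const ?_
    refine Continuous.matrix_det ?_
    exact continuous_id
  have hAn : A.Nonempty := ⟨(1 : Matrix (Fin d) (Fin d) ℝ), by
    change 0 < (1 : Matrix (Fin d) (Fin d) ℝ).det
    simp⟩
  have hA0 : volume A ≠ 0 := (hA.measure_pos volume hAn).ne'
  obtain ⟨H, hHA, hH⟩ : ∃ H ∈ A, ∀ᵐ V ∂ν, (mnr f (act (Matrix.of H) V)).det ≠ 0 := by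
    by_contra hcon
    push Not at hcon
    apply hA0
    refine measure_mono_null ?_ (ae_iff.1 h1)
    intro H hH
    simpa using hcon H hH
  simp only [A, Set.mem_setOf_eq] at hHA
  let c : ℝ := (Matrix.of H).det ^ ((d : ℝ)⁻¹)
  have hc0 : 0 < c := Real.rpow_pos_of_pos hHA _
  have hcd : c ^ d = (Matrix.of H).det := Real.rpow_inv_natCast_pow hHA.le (NeZero.ne d)
  let h : SLR d := ⟨c⁻¹ • Matrix.of H, by
    rw [Matrix.det_smul, Fintype.card_fin, inv_pow, hcd]
    exact inv_mul_cancel₀ hHA.ne'⟩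
  let S : Set (ι → Fin d → ℝ) := {V | (mnr f V).det = 0}
  have hS : MeasurableSet S := measurable_mnr_det f (measurableSet_singleton 0)
  have h2 := hν.inv h (S.indicator 1) (measurable_one.indicator hS)
  rw [lintegral_indicator_one hS] at h2
  have h3 : ∫⁻ V, S.indicator 1 (act (h : Matrix (Fin d) (Fin d) ℝ) V) ∂ν = 0 := by
    refine (lintegral_eq_zero_iff' ((measurable_one.indicator hS).comp (measurable_act_left _)).aemeasurable).2 ?_
    filter_upwards [hH] with V hV
    refine Set.indicator_of_notMem ?_ _
    simp only [S, Set.mem_setOf_eq, h, mnr_smul, Matrix.det_smul]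
    exact mul_ne_zero (pow_ne_zero _ (inv_ne_zero hc0.ne')) hV
  rw [h3] at h2
  rw [ae_iff]
  simpa [S] using h2.symm

/-- unipotent -/
def unip (f : ι → Fin d) (i : Fin d) (hi : ∀ b, f b ≠ i) (a : ι → ℝ) : SLR d :=
  ⟨(1 : Matrix (Fin d) (Fin d) ℝ) + Matrix.replicateCol Unit (Pi.single i (1 : ℝ) : Fin d → ℝ) *
    Matrix.replicateRow Unit (∑ b, a b • Pi.single (f b) (1 : ℝ) : Fin d → ℝ), by
    rw [Matrix.det_one_add_replicateCol_mul_replicateRow]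
    simp [Finset.sum_apply, Pi.single_apply, fun b => (hi b).symm]⟩

lemma act_unip (f : ι → Fin d) (i : Fin d) (hi : ∀ b, f b ≠ i) (a : ι → ℝ) (V : ι → Fin d → ℝ) :
    act (unip f i hi a : Matrix (Fin d) (Fin d) ℝ) V = V + trc i (mnr f V *ᵥ a) := by
  funext l
  simp only [act, unip, Matrix.add_mulVec, Matrix.one_mulVec, Pi.add_apply]
  congr 1
  rw [← Matrix.mulVec_mulVec]
  funext j
  simp only [trc, mnr, Matrix.mulVec, dotProduct, Matrix.replicateCol_apply, Matrix.replicateRow_apply,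
    Finset.univ_unique, Finset.sum_singleton, Finset.sum_apply, Pi.smul_apply, Pi.single_apply,
    smul_eq_mul, Matrix.of_apply]
  by_cases h : j = i
  · simp only [h, if_true, one_mul, mul_ite, mul_one, mul_zero, Finset.sum_mul, ite_mul, zero_mul]
    rw [Finset.sum_comm]
    refine Finset.sum_congr rfl fun b _ => ?_
    simp [mul_comm]
  · simp [h]

lemma mnr_trc (f : ι → Fin d) (i : Fin d) (hi : ∀ b, f b ≠ i) (w : ι → ℝ) (V : ι → Fin d → ℝ) :
    mnr f (V + trc i w) = mnr f V := by
  ext l b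
  simp [mnr, trc, Pi.single_apply, hi b]

lemma measurable_trc (i : Fin d) : Measurable (trc (ι := ι) i) := by
  refine measurable_pi_lambda _ fun l => measurable_pi_lambda _ fun j => ?_
  simp only [trc, Pi.single_apply]
  by_cases h : j = i
  · simp only [h, if_true]; exact measurable_pi_apply l
  · simp only [h, if_false]; exact measurable_const

lemma measurable_mnr_mulVec (f : ι → Fin d) :
    Measurable fun p : (ι → Fin d → ℝ) × (ι → ℝ) => mnr f p.1 *ᵥ p.2 := by
  have : Continuous fun p : (ι → Fin d → ℝ) × (ι → ℝ) => mnr f p.1 *ᵥ p.2 := by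
    refine continuous_pi fun l => ?_
    simp only [mnr, Matrix.mulVec, dotProduct, Matrix.of_apply]
    fun_prop
  exact this.measurable

lemma measurable_mnr_inv (f : ι → Fin d) (w : ι → ℝ) :
    Measurable fun V : ι → Fin d → ℝ => (mnr f V)⁻¹ *ᵥ w := by
  have h1 : Measurable fun V : ι → Fin d → ℝ => (mnr f V).adjugate *ᵥ w := by
    have : Continuous fun V : ι → Fin d → ℝ => (mnr f V).adjugate *ᵥ w := by
      refine Continuous.matrix_mulVec ?_ continuous_const
      refine Continuous.matrix_adjugate ?_
      refine continuous_matrix fun l b => ?_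
      simp only [mnr, Matrix.of_apply]
      fun_prop
    exact this.measurable
  simp only [Matrix.inv_def, Matrix.smul_mulVec, Ring.inverse_eq_inv']
  exact (measurable_mnr_det f).inv.smul h1

lemma lintegral_unitcube (κ : Type*) [Fintype κ] :
    ∫⁻ a : κ → ℝ, (Set.Icc (0 : κ → ℝ) 1).indicator 1 a = (1 : ℝ≥0∞) := by
  rw [lintegral_indicator_one measurableSet_Icc, Real.volume_Icc_pi]
  simp

lemma trans_one [NeZero d] {ν : Measure (ι → Fin d → ℝ)} (hν : InvM ν) (hcard : Fintype.card ι < d)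
    (i : Fin d) (w : ι → ℝ) (F : (ι → Fin d → ℝ) → ℝ≥0∞) (hF : Measurable F) :
    ∫⁻ V, F (V + trc i w) ∂ν = ∫⁻ V, F V ∂ν := by
  haveI := hν.sf
  obtain ⟨f0⟩ : Nonempty (ι ↪ {j : Fin d // j ≠ i}) := by
    refine Function.Embedding.nonempty_of_card_le ?_
    rw [Fintype.card_subtype_compl, Fintype.card_fin, Fintype.card_subtype_eq]
    omega
  let f : ι → Fin d := fun b => (f0 b).1
  have hfi : Function.Injective f := Subtype.val_injective.comp f0.injective
  have hi : ∀ b, f b ≠ i := fun b => (f0 b).2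
  let φ : (ι → ℝ) → ℝ≥0∞ := (Set.Icc (0 : ι → ℝ) 1).indicator 1
  have hφ : Measurable φ := measurable_one.indicator measurableSet_Icc
  have hφ1 : ∫⁻ a, φ a = 1 := lintegral_unitcube ι
  have mw := measurable_mnr_mulVec f
  have mi := measurable_mnr_inv f w
  have mt := measurable_trc (ι := ι) i
  have e1 : ∫⁻ V, F (V + trc i w) ∂ν = ∫⁻ a, ∫⁻ V, φ a * F (V + trc i (mnr f V *ᵥ a + w)) ∂ν := by
    calc ∫⁻ V, F (V + trc i w) ∂ν = ∫⁻ a, φ a * ∫⁻ V, F (V + trc i w) ∂ν := by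
          rw [lintegral_mul_const _ hφ, hφ1, one_mul]
      _ = _ := by
          refine lintegral_congr fun a => ?_
          have hm : Measurable fun V : ι → Fin d → ℝ => F (V + trc i (mnr f V *ᵥ a + w)) :=
            hF.comp (measurable_id.add (mt.comp
              ((mw.comp (measurable_id.prodMk measurable_const)).add measurable_const)))
          rw [lintegral_const_mul _ hm]
          congr 1
          have := hν.inv (unip f i hi a) (fun V => F (V + trc i w))
            (hF.comp (measurable_id.add measurable_const))
          rw [← this]
          refine lintegral_congr fun V => ?_
          rw [act_unip, add_assoc]
          congr 2
          funext l
          simp [trc, Pi.single_add]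
  have e2 : ∀ᵐ V ∂ν, ∫⁻ a, φ a * F (V + trc i (mnr f V *ᵥ a + w)) =
      ∫⁻ a, φ (a - (mnr f V)⁻¹ *ᵥ w) * F (V + trc i (mnr f V *ᵥ a)) := by
    filter_upwards [generic hν f hfi] with V hV
    rw [← lintegral_add_right_eq_self (fun a => φ (a - (mnr f V)⁻¹ *ᵥ w) * F (V + trc i (mnr f V *ᵥ a)))
      ((mnr f V)⁻¹ *ᵥ w)]
    refine lintegral_congr fun a => ?_
    rw [add_sub_cancel_right, Matrix.mulVec_add, Matrix.mulVec_mulVec,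
      Matrix.mul_nonsing_inv _ (isUnit_iff_ne_zero.2 hV), Matrix.one_mulVec]
  rw [e1, lintegral_lintegral_swap, lintegral_congr_ae e2, lintegral_lintegral_swap]
  · have e3 : ∀ a : ι → ℝ, ∫⁻ V, φ (a - (mnr f V)⁻¹ *ᵥ w) * F (V + trc i (mnr f V *ᵥ a)) ∂ν =
        ∫⁻ V, φ (a - (mnr f V)⁻¹ *ᵥ w) * F V ∂ν := by
      intro a
      rw [← hν.inv (unip f i hi a) (fun V => φ (a - (mnr f V)⁻¹ *ᵥ w) * F V)
        ((hφ.comp (measurable_const.sub mi)).mul hF)]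
      refine lintegral_congr fun V => ?_
      rw [act_unip, mnr_trc f i hi]
    simp only [e3]
    rw [lintegral_lintegral_swap]
    · refine lintegral_congr fun V => ?_
      rw [lintegral_mul_const (f := fun a => φ (a - (mnr f V)⁻¹ *ᵥ w)) _ (hφ.comp (measurable_id.sub measurable_const)),
        lintegral_sub_right_eq_self φ, hφ1, one_mul]
    · exact ((hφ.comp (measurable_fst.sub (mi.comp measurable_snd))).mul
        (hF.comp measurable_snd)).aemeasurable
  · refine Measurable.aemeasurable ?_
    exact (hφ.comp (measurable_snd.sub (mi.comp measurable_fst))).mul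
      (hF.comp (measurable_fst.add (mt.comp mw)))
  · refine Measurable.aemeasurable ?_
    exact (hφ.comp measurable_fst).mul
      (hF.comp (measurable_snd.add (mt.comp ((mw.comp measurable_swap).add measurable_const))))

lemma trans_all [NeZero d] {ν : Measure (ι → Fin d → ℝ)} (hν : InvM ν) (hcard : Fintype.card ι < d)
    (W : ι → Fin d → ℝ) (F : (ι → Fin d → ℝ) → ℝ≥0∞) (hF : Measurable F) :
    ∫⁻ V, F (V + W) ∂ν = ∫⁻ V, F V ∂ν := by
  have key : ∀ (s : Finset (Fin d)), ∀ F : (ι → Fin d → ℝ) → ℝ≥0∞, Measurable F →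
      ∫⁻ V, F (V + ∑ i ∈ s, trc i (fun l => W l i)) ∂ν = ∫⁻ V, F V ∂ν := by
    intro s
    induction s using Finset.induction_on with
    | empty => intro F hF; simp
    | insert i s his ih =>
      intro F hF
      rw [Finset.sum_insert his]
      have := trans_one hν hcard i (fun l => W l i) F hF
      rw [← this, ← ih (fun V => F (V + trc i fun l => W l i)) (hF.comp (measurable_id.add measurable_const))]
      refine lintegral_congr fun V => ?_
      congr 1
      abel
  have hW : ∑ i, trc i (fun l => W l i) = W := by
    funext l j
    simp [trc, Finset.sum_apply, Pi.single_apply]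
  rw [← key Finset.univ F hF, hW]

lemma T1abs [NeZero d] {ν : Measure (ι → Fin d → ℝ)} (hν : InvM ν) (hcard : Fintype.card ι < d) :
    ∃ c : ℝ≥0∞, ∀ F : (ι → Fin d → ℝ) → ℝ≥0∞, Measurable F → ∫⁻ V, F V ∂ν = c * ∫⁻ V, F V := by
  haveI := hν.sf
  let h : (ι → Fin d → ℝ) → ℝ≥0∞ := (Set.Icc (0 : ι → Fin d → ℝ) 1).indicator 1
  have hh : Measurable h := measurable_one.indicator measurableSet_Icc
  have hh1 : ∫⁻ a, h a = 1 := by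
    simp only [h]
    rw [lintegral_indicator_one measurableSet_Icc]
    have : Set.Icc (0 : ι → Fin d → ℝ) 1 = Set.univ.pi fun _ : ι => Set.Icc (0 : Fin d → ℝ) 1 := by
      rw [Set.pi_univ_Icc]; rfl
    rw [this, volume_pi_pi]
    simp [Real.volume_Icc_pi]
  refine ⟨∫⁻ V, h V ∂ν, fun F hF => ?_⟩
  calc ∫⁻ V, F V ∂ν = ∫⁻ V, (∫⁻ X, F V * h (V + X)) ∂ν := by
        refine lintegral_congr fun V => ?_
        rw [lintegral_const_mul (f := fun X => h (V + X)) _ (hh.comp (measurable_const.add measurable_id)),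
          lintegral_add_left_eq_self h, hh1, mul_one]
    _ = ∫⁻ X, ∫⁻ V, F V * h (V + X) ∂ν := by
        rw [lintegral_lintegral_swap]
        exact ((hF.comp measurable_fst).mul (hh.comp (measurable_fst.add measurable_snd))).aemeasurable
    _ = ∫⁻ X, ∫⁻ V, F (V - X) * h V ∂ν := by
        refine lintegral_congr fun X => ?_
        rw [← trans_all hν hcard (-X) (fun V => F V * h (V + X))
          (hF.mul (hh.comp (measurable_id.add measurable_const)))]
        refine lintegral_congr fun V => ?_
        rw [neg_add_cancel_right, sub_eq_add_neg]
    _ = ∫⁻ V, (∫⁻ X, F (V - X) * h V) ∂ν := by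
        rw [lintegral_lintegral_swap]
        exact ((hF.comp (measurable_snd.sub measurable_fst)).mul (hh.comp measurable_snd)).aemeasurable
    _ = ∫⁻ V, (∫⁻ X, F X) * h V ∂ν := by
        refine lintegral_congr fun V => ?_
        rw [lintegral_mul_const (f := fun X => F (V - X)) _ (hF.comp (measurable_const.sub measurable_id)),
          lintegral_sub_left_eq_self F]
    _ = _ := by rw [lintegral_const_mul _ hh, mul_comm]

theorem T1 [NeZero d] {μ : Measure (XspaceN d N)} (hμ : Good μ) {O : Set (ι → Fin d → ℤ)}
    (hO : Stab N O) (hli : ∀ U ∈ O, LinearIndependent ℝ (cst U)) (hcard : Fintype.card ι < d) :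
    ∃ c : ℝ≥0∞, ∀ F : (ι → Fin d → ℝ) → ℝ≥0∞, Measurable F →
      ∫⁻ x, Tsum O F x ∂μ = c * ∫⁻ V, F V := by
  haveI := hμ.prob
  have hν : InvM (nuO μ O) := by
    refine ⟨sfinite_nuO μ hO, fun h f hf => ?_, ?_⟩
    · rw [lintegral_nuO μ hO hf, ← lintegral_Tsum_smul hμ hO hf h]
      exact lintegral_nuO μ hO (hf.comp (measurable_act_left _))
    · have hm : MeasurableSet {V : ι → Fin d → ℝ | LinearIndependent ℝ V} :=
        isOpen_setOf_linearIndependent.measurableSet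
      rw [ae_iff]
      change nuO μ O {V : ι → Fin d → ℝ | LinearIndependent ℝ V}ᶜ = 0
      rw [← lintegral_indicator_one hm.compl, lintegral_nuO μ hO (measurable_one.indicator hm.compl)]
      have : ∀ x : XspaceN d N, Tsum O ({V : ι → Fin d → ℝ | LinearIndependent ℝ V}ᶜ.indicator 1) x = 0 := by
        intro x
        unfold Tsum Ssum
        rw [ENNReal.tsum_eq_zero]
        intro U
        refine Set.indicator_of_notMem ?_ _
        simp only [Set.mem_compl_iff, Set.mem_setOf_eq, not_not]
        have h1 := hli U.1 U.2
        let g : SLR d := Quotient.out x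
        have hinj : Function.Injective (Matrix.mulVecLin (g : Matrix (Fin d) (Fin d) ℝ)) := by
          rw [Matrix.coe_mulVecLin, Matrix.mulVec_injective_iff_isUnit, Matrix.isUnit_iff_isUnit_det]
          simp
        exact h1.map' _ (LinearMap.ker_eq_bot.2 hinj)
      simp [this]
  obtain ⟨c, hc⟩ := T1abs hν hcard
  exact ⟨c, fun F hF => by rw [← hc F hF, lintegral_nuO μ hO hF]⟩

end PartB

section PartC

open scoped ENNReal

variable {d N : ℕ}

lemma Ssum_le_sigma {ι A : Type*} {ι' : A → Type*} (O : Set (ι → Fin d → ℤ)) (f : (ι → Fin d → ℝ) → ℝ≥0∞)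
    (O' : ∀ a, Set (ι' a → Fin d → ℤ)) (f' : ∀ a, (ι' a → Fin d → ℝ) → ℝ≥0∞)
    (g : Matrix (Fin d) (Fin d) ℝ) (p : ∀ a, (ι' a → Fin d → ℤ) → (ι → Fin d → ℤ))
    (h : ∀ U ∈ O, f (act g (cst U)) ≠ 0 → ∃ a, ∃ U' ∈ O' a, p a U' = U ∧
      f (act g (cst U)) ≤ f' a (act g (cst U'))) :
    Ssum O f g ≤ ∑' a, Ssum (O' a) (f' a) g := by
  have h' : ∀ U : {U : O // f (act g (cst U.1)) ≠ 0}, ∃ q : Σ a, O' a, p q.1 q.2.1 = U.1.1 ∧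
      f (act g (cst U.1.1)) ≤ f' q.1 (act g (cst q.2.1)) := by
    rintro ⟨⟨U, hU⟩, hf⟩
    obtain ⟨a, U', hU', h1, h2⟩ := h U hU hf
    exact ⟨⟨a, U', hU'⟩, h1, h2⟩
  choose j hj1 hj2 using h'
  have hinj : Function.Injective j := by
    intro U1 U2 h12
    have := hj1 U1
    rw [h12, hj1 U2] at this
    exact Subtype.ext (Subtype.ext this.symm)
  calc Ssum O f g = ∑' U : {U : O // f (act g (cst U.1)) ≠ 0}, f (act g (cst U.1.1)) := by
        unfold Ssum
        exact (tsum_subtype_eq_of_support_subset (f := fun U : O => f (act g (cst U.1)))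
          (s := {U : O | f (act g (cst U.1)) ≠ 0}) (fun U hU => hU)).symm
    _ ≤ ∑' U : {U : O // f (act g (cst U.1)) ≠ 0}, f' (j U).1 (act g (cst (j U).2.1)) :=
        ENNReal.tsum_le_tsum hj2
    _ ≤ ∑' q : Σ a, O' a, f' q.1 (act g (cst q.2.1)) :=
        ENNReal.tsum_comp_le_tsum_of_injective hinj (fun q : Σ a, O' a => f' q.1 (act g (cst q.2.1)))
    _ = _ := by rw [ENNReal.tsum_sigma']; rfl

lemma Ssum_le {ι ι' : Type*} (O : Set (ι → Fin d → ℤ)) (f : (ι → Fin d → ℝ) → ℝ≥0∞)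
    (O' : Set (ι' → Fin d → ℤ)) (f' : (ι' → Fin d → ℝ) → ℝ≥0∞)
    (g : Matrix (Fin d) (Fin d) ℝ) (p : (ι' → Fin d → ℤ) → (ι → Fin d → ℤ))
    (h : ∀ U ∈ O, f (act g (cst U)) ≠ 0 → ∃ U' ∈ O', p U' = U ∧
      f (act g (cst U)) ≤ f' (act g (cst U'))) :
    Ssum O f g ≤ Ssum O' f' g := by
  have := Ssum_le_sigma (A := Unit) O f (fun _ => O') (fun _ => f') g (fun _ => p)
    (fun U hU hf => ⟨(), h U hU hf⟩)
  simpa using this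

/-- cast of an integer vector -/
def ci (z : Fin d → ℤ) : Fin d → ℝ := fun j => (z j : ℝ)

lemma ci_inj : Function.Injective (ci (d := d)) := by
  intro a b h
  funext j
  have := congrFun h j
  simpa [ci] using this

lemma cst_apply {ι : Type*} (U : ι → Fin d → ℤ) (i : ι) : cst U i = ci (U i) := rfl

lemma ci_add (a b : Fin d → ℤ) : ci (a + b) = ci a + ci b := by funext j; simp [ci]
lemma ci_sub (a b : Fin d → ℤ) : ci (a - b) = ci a - ci b := by funext j; simp [ci]
lemma ci_smul (a : ℤ) (b : Fin d → ℤ) : ci (a • b) = (a : ℝ) • ci b := by funext j; simp [ci]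
lemma ci_zero : ci (0 : Fin d → ℤ) = 0 := by funext j; simp [ci]
lemma ci_sum {ι : Type*} (s : Finset ι) (b : ι → Fin d → ℤ) : ci (∑ i ∈ s, b i) = ∑ i ∈ s, ci (b i) := by
  funext j; simp [ci, Finset.sum_apply]
lemma ci_mulVec (γ : Matrix (Fin d) (Fin d) ℤ) (z : Fin d → ℤ) :
    ci (γ *ᵥ z) = (γ.map (Int.castRingHom ℝ)) *ᵥ ci z := by
  funext j; simp [ci, Matrix.mulVec, dotProduct]

/-- primitive tuples -/
def Prim (d r : ℕ) : Set (Fin r → Fin d → ℤ) :=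
  {U | ∀ (s : Fin r → ℝ) (z : Fin d → ℤ), ∑ i, s i • cst U i = ci z → ∃ t : Fin r → ℤ, ∀ i, s i = t i}

lemma Prim_li {r : ℕ} {U : Fin r → Fin d → ℤ} (hU : U ∈ Prim d r) : LinearIndependent ℝ (cst U) := by
  rw [Fintype.linearIndependent_iff]
  intro s hs i
  by_contra hi
  have h1 : ∑ l, ((2 * s i)⁻¹ • s) l • cst U l = ci 0 := by
    simp only [Pi.smul_apply, smul_assoc, ← Finset.smul_sum, hs, ci_zero, smul_zero]
  obtain ⟨t, ht⟩ := hU _ _ h1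
  have h2 := ht i
  simp only [Pi.smul_apply, smul_eq_mul] at h2
  have h3 : (2 * s i)⁻¹ * s i = 1 / 2 := by field_simp
  rw [h3] at h2
  have h4 : (2 * t i : ℤ) = 1 := by
    have : ((2 * t i : ℤ) : ℝ) = (1 : ℤ) := by push_cast; linarith
    exact_mod_cast this
  omega

lemma act_comb {ι : Type*} [Fintype ι] (g : Matrix (Fin d) (Fin d) ℝ) (s : ι → ℝ) (V : ι → Fin d → ℝ) :
    ∑ i, s i • act g V i = g *ᵥ (∑ i, s i • V i) := by
  simp only [act]
  rw [← Matrix.mulVecLin_apply, map_sum]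
  simp

lemma Prim_stab (r : ℕ) : Stab N (Prim d r) := by
  intro γ _ U hU s z hz
  rw [cst_smul, act_comb] at hz
  refine hU s (((γ⁻¹ : Matrix.SpecialLinearGroup (Fin d) ℤ) : Matrix (Fin d) (Fin d) ℤ) *ᵥ z) ?_
  rw [ci_mulVec, ← hz, Matrix.mulVec_mulVec, ← Matrix.map_mul, ← Matrix.SpecialLinearGroup.coe_mul,
    inv_mul_cancel]
  simp

lemma exists_rinv {ι : Type*} [Fintype ι] [DecidableEq ι] (V : ι → Fin d → ℝ)
    (hV : LinearIndependent ℝ V) : ∃ P : Matrix (Fin d) ι ℝ, Matrix.of V * P = 1 := by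
  rw [← Matrix.mulVec_surjective_iff_exists_right_inverse]
  have h2 := hV.rank_matrix (M := Matrix.of V)
  have := LinearMap.range_eq_top (f := (Matrix.of V).mulVecLin)
  rw [← Matrix.coe_mulVecLin, ← this]
  apply Submodule.eq_top_of_finrank_eq
  rw [Module.finrank_fintype_fun_eq_card]
  exact h2

/-- recover coefficients -/
lemma coef_of_rinv {ι : Type*} [Fintype ι] [DecidableEq ι] {V : ι → Fin d → ℝ} {P : Matrix (Fin d) ι ℝ}
    (hP : Matrix.of V * P = 1) (s : ι → ℝ) : (∑ i, s i • V i) ᵥ* P = s := by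
  have : (∑ i, s i • V i) = s ᵥ* Matrix.of V := by
    funext j
    simp [Matrix.vecMul, dotProduct, Finset.sum_apply]
  rw [this, Matrix.vecMul_vecMul, hP, Matrix.vecMul_one]

lemma sum_snoc {r : ℕ} (s : Fin r → ℝ) (c : ℝ) (V : Fin r → Fin d → ℝ) (v : Fin d → ℝ) :
    ∑ i, (Fin.snoc s c : Fin (r + 1) → ℝ) i • (Fin.snoc V v : Fin (r + 1) → Fin d → ℝ) i =
      ∑ i, s i • V i + c • v := by
  rw [Fin.sum_univ_castSucc]
  simp

lemma cst_snoc {r : ℕ} (U : Fin r → Fin d → ℤ) (v : Fin d → ℤ) :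
    cst (Fin.snoc U v : Fin (r + 1) → Fin d → ℤ) = Fin.snoc (cst U) (ci v) := by
  funext i
  refine Fin.lastCases ?_ (fun i => ?_) i
  · simp [cst_apply]
  · simp [cst_apply]

lemma finite_bdd (C : ℝ) : {z : Fin d → ℤ | ∀ j, |(z j : ℝ)| ≤ C}.Finite := by
  have hfin : (Set.Icc (fun (_ : Fin d) => -⌈C⌉) (fun _ => ⌈C⌉)).Finite := Set.finite_Icc _ _
  refine hfin.subset fun U h2 => ?_
  have h3 := Int.le_ceil C
  refine ⟨fun j => ?_, fun j => ?_⟩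
  · have := (abs_le.1 (h2 j)).1
    have : ((-⌈C⌉ : ℤ) : ℝ) ≤ (U j : ℝ) := by push_cast; linarith
    exact_mod_cast this
  · have := (abs_le.1 (h2 j)).2
    have : ((U j : ℤ) : ℝ) ≤ (⌈C⌉ : ℤ) := by linarith
    exact_mod_cast this

/-- Lemma E -/
lemma lemmaE {r : ℕ} {U : Fin r → Fin d → ℤ} (hU : U ∈ Prim d r) (v : Fin d → ℤ)
    (hv : LinearIndependent ℝ (cst (Fin.snoc U v : Fin (r + 1) → Fin d → ℤ))) :
    ∃ (v' : Fin d → ℤ) (a : ℕ) (b : Fin r → ℤ), 1 ≤ a ∧ (∀ i, 0 ≤ b i ∧ b i < a) ∧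
      v = (a : ℤ) • v' + ∑ i, b i • U i ∧ (Fin.snoc U v' : Fin (r + 1) → Fin d → ℤ) ∈ Prim d (r + 1) := by
  rw [cst_snoc] at hv
  obtain ⟨P, hP⟩ := exists_rinv _ hv
  have hcoef : ∀ (s : Fin r → ℝ) (c : ℝ) (w : Fin d → ℝ), ∑ i, s i • cst U i + c • ci v = w →
      (w ᵥ* P) (Fin.last r) = c := by
    intro s c w hw
    have := coef_of_rinv hP (Fin.snoc s c)
    rw [sum_snoc, hw] at this
    rw [this]; simp
  let H : AddSubgroup ℝ :=
    { carrier := {c | ∃ (s : Fin r → ℝ) (z : Fin d → ℤ), ∑ i, s i • cst U i + c • ci v = ci z}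
      add_mem' := by
        rintro c c' ⟨s, z, h⟩ ⟨s', z', h'⟩
        refine ⟨s + s', z + z', ?_⟩
        rw [ci_add, ← h, ← h']
        simp only [Pi.add_apply, add_smul, Finset.sum_add_distrib]
        abel
      zero_mem' := ⟨0, 0, by simp [ci_zero]⟩
      neg_mem' := by
        rintro c ⟨s, z, h⟩
        refine ⟨-s, -z, ?_⟩
        have : ci (-z) = - ci z := by funext j; simp [ci]
        rw [this, ← h]
        simp only [Pi.neg_apply, neg_smul, Finset.sum_neg_distrib]
        abel }
  have hred : ∀ c ∈ H, ∃ (s : Fin r → ℝ) (z : Fin d → ℤ), (∀ i, -1 < s i ∧ s i ≤ 0) ∧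
      ∑ i, s i • cst U i + c • ci v = ci z := by
    rintro c ⟨s, z, h⟩
    refine ⟨fun i => s i - ⌈s i⌉, z - ∑ i, ⌈s i⌉ • U i, fun i => ⟨?_, ?_⟩, ?_⟩
    · have := Int.ceil_lt_add_one (s i); linarith
    · have := Int.le_ceil (s i); linarith
    · rw [ci_sub, ci_sum, ← h]
      simp only [sub_smul, Finset.sum_sub_distrib, ci_smul, cst_apply]
      abel
  let T : Set ℝ := {c | c ∈ H ∧ 0 < c ∧ c ≤ 1}
  have hTfin : T.Finite := by
    let C : ℝ := ∑ i, ‖cst U i‖ + ‖ci v‖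
    refine ((finite_bdd (d := d) C).image (fun z => (ci z ᵥ* P) (Fin.last r))).subset ?_
    rintro c ⟨hc, hc0, hc1⟩
    obtain ⟨s, z, hs, h⟩ := hred c hc
    refine ⟨z, fun j => ?_, hcoef s c _ h⟩
    have h1 : |(z j : ℝ)| ≤ ‖ci z‖ := norm_le_pi_norm (ci z) j
    refine h1.trans ?_
    rw [← h]
    refine (norm_add_le _ _).trans (add_le_add ((norm_sum_le _ _).trans (Finset.sum_le_sum fun i _ => ?_)) ?_)
    · rw [norm_smul]
      refine mul_le_of_le_one_left (norm_nonneg _) ?_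
      rw [Real.norm_eq_abs, abs_le]
      constructor <;> linarith [(hs i).1, (hs i).2]
    · rw [norm_smul]
      refine mul_le_of_le_one_left (norm_nonneg _) ?_
      rw [Real.norm_eq_abs, abs_le]
      constructor <;> linarith
  have h1H : (1 : ℝ) ∈ H := ⟨0, v, by simp⟩
  obtain ⟨c0, hc0, hmin⟩ := Set.exists_min_image T id hTfin ⟨1, h1H, one_pos, le_rfl⟩
  have hcyc : H = AddSubgroup.closure {c0} := by
    refine AddSubgroup.cyclic_of_min ⟨⟨hc0.1, hc0.2.1⟩, ?_⟩
    rintro c ⟨hc, hcp⟩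
    by_cases h1 : c ≤ 1
    · exact hmin c ⟨hc, hcp, h1⟩
    · exact hc0.2.2.trans (not_le.1 h1).le
  have hint : ∀ c ∈ H, ∃ m : ℤ, c = m * c0 := by
    intro c hc
    rw [hcyc, AddSubgroup.mem_closure_singleton] at hc
    obtain ⟨m, hm⟩ := hc
    exact ⟨m, by rw [← hm]; simp⟩
  obtain ⟨s, v', hs, hsv⟩ := hred c0 hc0.1
  obtain ⟨m, hm⟩ := hint 1 h1H
  have hm0 : 0 < m := by
    by_contra hcon
    have : (m : ℝ) ≤ 0 := by exact_mod_cast not_lt.1 hcon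
    nlinarith [hc0.2.1]
  obtain ⟨a, rfl⟩ := Int.eq_ofNat_of_zero_le hm0.le
  have ha : 1 ≤ a := by exact_mod_cast hm0
  have haR : (0 : ℝ) < a := by exact_mod_cast ha
  have hm' : (1 : ℝ) = (a : ℝ) * c0 := by simpa using hm
  have hav : (a : ℝ) • ci v' = ∑ i, ((a : ℝ) * s i) • cst U i + ci v := by
    rw [← hsv, smul_add, smul_smul, ← hm', one_smul, Finset.smul_sum]
    simp only [smul_smul]
  obtain ⟨t, ht⟩ := hU (fun i => (a : ℝ) * s i) ((a : ℤ) • v' - v) (by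
    rw [ci_sub, ci_smul]
    simp [hav])
  refine ⟨v', a, fun i => - t i, ha, fun i => ⟨?_, ?_⟩, ?_, ?_⟩
  · have : (t i : ℝ) ≤ 0 := by rw [← ht i]; nlinarith [(hs i).2]
    have : t i ≤ 0 := by exact_mod_cast this
    change 0 ≤ - t i
    omega
  · have : (-(a : ℝ)) < (t i : ℝ) := by rw [← ht i]; nlinarith [(hs i).1]
    have : -(a : ℤ) < t i := by exact_mod_cast this
    change - t i < a
    omega
  · apply ci_inj
    rw [ci_add, ci_sum, ci_smul]
    simp only [ci_smul, Int.cast_neg, ← ht, Int.cast_natCast]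
    rw [hav]
    simp only [cst_apply, neg_smul, Finset.sum_neg_distrib]
    abel
  · intro s' z hz
    rw [cst_snoc, ← Fin.snoc_init_self (n := r) s', sum_snoc] at hz
    set q := s' (Fin.last r) with hq
    have hqH : q * c0 ∈ H := by
      refine ⟨fun i => Fin.init s' i + q * s i, z, ?_⟩
      rw [← hz, ← hsv]
      simp only [add_smul, Finset.sum_add_distrib, smul_add, Finset.smul_sum, smul_smul]
      abel
    obtain ⟨m, hm⟩ := hint _ hqH
    have hqm : q = m := mul_right_cancel₀ hc0.2.1.ne' hm
    obtain ⟨t', ht'⟩ := hU (Fin.init s') (z - m • v') (by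
      rw [ci_sub, ci_smul, ← hz, hqm]
      simp)
    refine ⟨Fin.snoc t' m, fun i => ?_⟩
    refine Fin.lastCases ?_ (fun i => ?_) i
    · simp [← hq, hqm]
    · simpa [Fin.init] using ht' i

end PartC

section PartD

open scoped ENNReal

variable {d N : ℕ}

/-- completion of a tuple to a square matrix -/
def Wm (r : ℕ) (V : Fin r → Fin d → ℝ) : Matrix (Fin d) (Fin d) ℝ :=
  Matrix.of fun i => if h : i.1 < r then V ⟨i.1, h⟩ else Pi.single i 1

lemma cont_Wm (r : ℕ) : Continuous (Wm (d := d) r) := by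
  refine continuous_matrix fun i j => ?_
  simp only [Wm, Matrix.of_apply]
  by_cases h : i.1 < r
  · simp only [h, dif_pos]; fun_prop
  · simp only [h, dif_neg, not_false_eq_true]; fun_prop

/-- test set -/
def Kr (d r : ℕ) : Set (Fin r → Fin d → ℝ) := {V | ‖V‖ < 2 ∧ 1 / 2 < |(Wm r V).det|}

lemma isOpen_Kr (r : ℕ) : IsOpen (Kr d r) :=
  (isOpen_lt continuous_norm continuous_const).inter
    (isOpen_lt continuous_const (cont_Wm r).matrix_det.abs)

lemma Kr_nonempty {r : ℕ} (hr : r ≤ d) : (Kr d r).Nonempty := by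
  refine ⟨fun l => Pi.single (Fin.castLE hr l) 1, ?_, ?_⟩
  · refine lt_of_le_of_lt ?_ one_lt_two
    refine (pi_norm_le_iff_of_nonneg zero_le_one).2 fun l => (pi_norm_le_iff_of_nonneg zero_le_one).2 fun j => ?_
    by_cases h : j = Fin.castLE hr l
    · simp [h]
    · simp [h]
  · have : Wm r (fun l => (Pi.single (Fin.castLE hr l) 1 : Fin d → ℝ)) = 1 := by
      ext i j
      simp only [Wm, Matrix.of_apply, Matrix.one_apply]
      by_cases h : i.1 < r
      · simp [h, Fin.castLE, Pi.single_apply, eq_comm]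
      · simp [h, Pi.single_apply, eq_comm]
    rw [this]; norm_num

lemma exists_int_vec (S : Set (Fin d → ℝ)) (hs : ∀ x ∈ S, -x ∈ S) (hc : Convex ℝ S)
    (hv : (2 : ℝ≥0∞) ^ d < volume S) : ∃ z : Fin d → ℤ, z ≠ 0 ∧ ci z ∈ S := by
  let b := Pi.basisFun ℝ (Fin d)
  have hF := ZSpan.isAddFundamentalDomain' b (volume : Measure (Fin d → ℝ))
  have : Countable (Submodule.span ℤ (Set.range b)).toAddSubgroup := by
    change Countable (Submodule.span ℤ (Set.range b))
    infer_instance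
  obtain ⟨x, hx0, hxS⟩ := exists_ne_zero_mem_lattice_of_measure_mul_two_pow_lt_measure hF hs hc (by
    rw [ZSpan.fundamentalDomain_pi_basisFun, volume_pi_pi]
    simpa using hv)
  have hx : (x : Fin d → ℝ) ∈ Submodule.span ℤ (Set.range b) := x.2
  rw [Module.Basis.mem_span_iff_repr_mem] at hx
  choose z hz using hx
  have hzx : ci z = (x : Fin d → ℝ) := by
    funext j
    have := hz j
    simpa [ci, b] using this
  refine ⟨z, ?_, hzx ▸ hxS⟩
  rintro rfl
  apply hx0
  rw [ci_zero] at hzx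
  exact Subtype.ext hzx.symm

lemma mink_step {r : ℕ} (hr : r < d) (g : SLR d) {U : Fin r → Fin d → ℤ} (hU : U ∈ Prim d r)
    (hK : act (g : Matrix (Fin d) (Fin d) ℝ) (cst U) ∈ Kr d r) :
    ∃ v : Fin d → ℤ, (Fin.snoc U v : Fin (r + 1) → Fin d → ℤ) ∈ Prim d (r + 1) ∧
      act (g : Matrix (Fin d) (Fin d) ℝ) (cst (Fin.snoc U v : Fin (r + 1) → Fin d → ℤ)) ∈
        Metric.closedBall 0 (8 * d) := by
  set V := act (g : Matrix (Fin d) (Fin d) ℝ) (cst U) with hV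
  let G : Matrix (Fin d) (Fin d) ℝ := g
  have hGdet : G.det = 1 := g.2
  obtain ⟨hK1, hK2⟩ := hK
  have hWdet : (Wm r V).det ≠ 0 := by
    intro h; rw [h] at hK2; norm_num at hK2
  let box : Set (Fin d → ℝ) := Set.univ.pi fun i => Set.Ioo (-(if i.1 < r then 1 else 3)) (if i.1 < r then (1 : ℝ) else 3)
  let Lm : Matrix (Fin d) (Fin d) ℝ := ((Wm r V)ᵀ)⁻¹ * G
  have hLdet : Lm.det = (Wm r V).det⁻¹ := by
    simp only [Lm, Matrix.det_mul, hGdet, mul_one, Matrix.det_nonsing_inv, Matrix.det_transpose,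
      Ring.inverse_eq_inv']
  have hld : LinearMap.det (Matrix.toLin' Lm) = (Wm r V).det⁻¹ := by
    rw [LinearMap.det_toLin', hLdet]
  let S : Set (Fin d → ℝ) := (Matrix.toLin' Lm) ⁻¹' box
  have hbox : (2 : ℝ≥0∞) ^ d * 3 ≤ volume box := by
    simp only [box, volume_pi_pi, Real.volume_Ioo]
    let i0 : Fin d := ⟨r, hr⟩
    have h2 : ∀ i : Fin d, ENNReal.ofReal ((if i.1 < r then (1 : ℝ) else 3) - -(if i.1 < r then (1 : ℝ) else 3)) =
        2 * (if i.1 < r then 1 else 3) := by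
      intro i
      split_ifs
      · norm_num
      · rw [← ENNReal.ofReal_ofNat 2, ← ENNReal.ofReal_ofNat 3, ← ENNReal.ofReal_mul (by norm_num)]; norm_num
    simp only [h2, Finset.prod_mul_distrib, Finset.prod_const, Finset.card_univ, Fintype.card_fin]
    gcongr
    rw [← Finset.mul_prod_erase _ _ (Finset.mem_univ i0)]
    have h3 : (if i0.1 < r then (1 : ℝ≥0∞) else 3) = 3 := by simp [i0]
    rw [h3]
    refine le_mul_of_one_le_right' ?_
    refine Finset.one_le_prod' fun i _ => ?_
    split_ifs
    · exact le_rfl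
    · norm_num
  have hvol : (2 : ℝ≥0∞) ^ d < volume S := by
    simp only [S]
    rw [Measure.addHaar_preimage_linearMap _ (by rw [hld]; exact inv_ne_zero hWdet), hld, inv_inv]
    calc (2 : ℝ≥0∞) ^ d < 2 ^ d * (3 * ENNReal.ofReal (1 / 2)) := by
          conv_lhs => rw [← mul_one ((2 : ℝ≥0∞) ^ d)]
          refine ENNReal.mul_lt_mul_right (by simp) (by simp) ?_
          rw [← ENNReal.ofReal_ofNat 3, ← ENNReal.ofReal_mul (by norm_num), ← ENNReal.ofReal_one]
          exact (ENNReal.ofReal_lt_ofReal_iff (by norm_num)).2 (by norm_num)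
      _ = ENNReal.ofReal (1 / 2) * (2 ^ d * 3) := by ring
      _ ≤ _ := mul_le_mul' (ENNReal.ofReal_le_ofReal hK2.le) hbox
  have hbc : Convex ℝ box := convex_pi fun i _ => convex_Ioo _ _
  have hSc : Convex ℝ S := hbc.linear_preimage _
  have hSs : ∀ x ∈ S, -x ∈ S := by
    intro x hx i hi
    have h := hx i hi
    rw [map_neg, Pi.neg_apply, Set.mem_Ioo]
    rw [Set.mem_Ioo] at h
    constructor <;> linarith
  obtain ⟨x, hx0, hxS⟩ := exists_int_vec S hSs hSc hvol
  set y : Fin d → ℝ := Lm *ᵥ ci x with hy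
  have hybox : ∀ i, |y i| < if i.1 < r then (1 : ℝ) else 3 := by
    intro i
    have := hxS i (Set.mem_univ i)
    rw [Matrix.toLin'_apply, Set.mem_Ioo] at this
    exact abs_lt.2 this
  have hgx : G *ᵥ ci x = ∑ i, y i • Wm r V i := by
    have h1 : (Wm r V)ᵀ *ᵥ y = G *ᵥ ci x := by
      rw [hy, Matrix.mulVec_mulVec, ← Matrix.mul_assoc, Matrix.mul_nonsing_inv, Matrix.one_mul]
      rw [Matrix.det_transpose]; exact isUnit_iff_ne_zero.2 hWdet
    rw [← h1]
    funext j
    simp only [Matrix.mulVec, dotProduct, Matrix.transpose_apply, Finset.sum_apply, Pi.smul_apply, smul_eq_mul]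
    exact Finset.sum_congr rfl fun i _ => mul_comm _ _
  have hWi : ∀ i, ‖Wm r V i‖ ≤ 2 := by
    intro i
    change ‖(if h : i.1 < r then V ⟨i.1, h⟩ else Pi.single i 1 : Fin d → ℝ)‖ ≤ 2
    split_ifs with h
    · exact (norm_le_pi_norm V _).trans hK1.le
    · refine (pi_norm_le_iff_of_nonneg zero_le_two).2 fun j => ?_
      by_cases h : j = i
      · simp [h]
      · simp [h]
  have hgxn : ‖G *ᵥ ci x‖ ≤ 6 * d := by
    rw [hgx]
    refine (norm_sum_le _ _).trans ?_
    have : ∀ i ∈ Finset.univ, ‖y i • Wm r V i‖ ≤ 6 := by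
      intro i _
      rw [norm_smul]
      have h1 : ‖y i‖ ≤ 3 := by
        rw [Real.norm_eq_abs]
        refine (hybox i).le.trans ?_
        split_ifs <;> norm_num
      nlinarith [hWi i, norm_nonneg (y i), norm_nonneg (Wm r V i)]
    refine (Finset.sum_le_sum this).trans ?_
    simp [mul_comm]
  have hWrow : ∀ l : Fin r, Wm r V (Fin.castLE hr.le l) = V l := by
    intro l
    change (if h : (Fin.castLE hr.le l).1 < r then V ⟨(Fin.castLE hr.le l).1, h⟩ else Pi.single _ 1 : Fin d → ℝ) = V l
    simp
  have hWli : LinearIndependent ℝ (fun i => Wm r V i) := by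
    have := Matrix.linearIndependent_rows_of_det_ne_zero hWdet
    exact this
  have hgU : ∀ s : Fin r → ℝ, G *ᵥ (∑ i, s i • cst U i) = ∑ i, s i • V i := by
    intro s
    rw [hV, act_comb]
  have hginj : Function.Injective (G *ᵥ ·) := by
    have : Function.Injective G.mulVec := by
      rw [Matrix.mulVec_injective_iff_isUnit, Matrix.isUnit_iff_isUnit_det, hGdet]
      exact isUnit_one
    exact this
  have hnot : ∀ s : Fin r → ℝ, ∑ i, s i • cst U i ≠ ci x := by
    intro s hs
    have h1 : ∑ i, y i • Wm r V i = ∑ i : Fin d, (if h : i.1 < r then s ⟨i.1, h⟩ else 0) • Wm r V i := by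
      rw [← hgx, ← hs, hgU]
      have h2 : ∀ l : Fin r, s l • V l = (fun i : Fin d => (if h : i.1 < r then s ⟨i.1, h⟩ else 0) • Wm r V i) (Fin.castLE hr.le l) := by
        intro l
        simp only [hWrow, Fin.val_castLE, Fin.is_lt, dif_pos]
      rw [Finset.sum_congr rfl fun l _ => h2 l]
      refine Finset.sum_of_injOn (Fin.castLE hr.le) (Fin.castLE_injective _).injOn (by simp) ?_ (fun _ _ => rfl)
      intro i _ hi
      have : ¬ i.1 < r := by
        intro h
        apply hi
        exact ⟨⟨i.1, h⟩, by simp, by ext; simp⟩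
      simp [this]
    have h3 : ∀ i : Fin d, y i = (if h : i.1 < r then s ⟨i.1, h⟩ else 0) := by
      intro i
      have h4 := Fintype.linearIndependent_iff.1 hWli (fun i => y i - (if h : i.1 < r then s ⟨i.1, h⟩ else 0))
        (by simp only [sub_smul, Finset.sum_sub_distrib]; rw [h1, sub_self]) i
      linarith
    obtain ⟨t, ht⟩ := hU s x hs
    have h5 : ∀ l, s l = 0 := by
      intro l
      have h6 := hybox (Fin.castLE hr.le l)
      rw [h3] at h6
      simp only [Fin.val_castLE, Fin.is_lt, dif_pos, if_true] at h6
      have h6' : |s l| < 1 := h6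
      rw [ht l] at h6' ⊢
      have : |t l| < 1 := by exact_mod_cast h6'
      rw [Int.abs_lt_one_iff.1 this]; simp
    apply hx0
    apply ci_inj
    rw [← hs, ci_zero]
    simp [h5]
  have hli : LinearIndependent ℝ (cst (Fin.snoc U x : Fin (r + 1) → Fin d → ℤ)) := by
    rw [cst_snoc, linearIndependent_finSnoc]
    refine ⟨Prim_li hU, fun hmem => ?_⟩
    rw [Submodule.mem_span_range_iff_exists_fun] at hmem
    obtain ⟨s, hs⟩ := hmem
    exact hnot s hs
  obtain ⟨v', a, b, ha, hb, hxv, hprim⟩ := lemmaE hU x hli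
  refine ⟨v', hprim, ?_⟩
  have haR : (1 : ℝ) ≤ a := by exact_mod_cast ha
  have hd1 : (1 : ℝ) ≤ d := by exact_mod_cast (by omega : 1 ≤ d)
  have hgv : (a : ℝ) • (G *ᵥ ci v') = G *ᵥ ci x - ∑ i, (b i : ℝ) • V i := by
    rw [← hgU, ← Matrix.mulVec_sub, ← Matrix.mulVec_smul]
    congr 1
    rw [hxv, ci_add, ci_smul, ci_sum]
    simp only [ci_smul, cst_apply, Int.cast_natCast]
    abel
  have hrd : (r : ℝ) + 1 ≤ d := by exact_mod_cast hr
  have hvn : ‖G *ᵥ ci v'‖ ≤ 8 * d := by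
    have h1 : (a : ℝ) * ‖G *ᵥ ci v'‖ ≤ 6 * d + a * (2 * r) := by
      have h2 : ‖(a : ℝ) • (G *ᵥ ci v')‖ = (a : ℝ) * ‖G *ᵥ ci v'‖ := by
        rw [norm_smul, Real.norm_eq_abs, abs_of_nonneg (by linarith)]
      rw [← h2, hgv]
      refine (norm_sub_le _ _).trans (add_le_add hgxn ((norm_sum_le _ _).trans ?_))
      have : ∀ i ∈ (Finset.univ : Finset (Fin r)), ‖(b i : ℝ) • V i‖ ≤ (a : ℝ) * 2 := by
        intro i _
        rw [norm_smul]
        have h3 : ‖(b i : ℝ)‖ ≤ a := by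
          rw [Real.norm_eq_abs, abs_le]
          have h4 : (0 : ℝ) ≤ b i := by exact_mod_cast (hb i).1
          have h5 : (b i : ℝ) ≤ a := by exact_mod_cast (hb i).2.le
          constructor <;> linarith
        have h4 : ‖V i‖ ≤ 2 := (norm_le_pi_norm V i).trans hK1.le
        exact mul_le_mul h3 h4 (norm_nonneg _) (by linarith)
      refine (Finset.sum_le_sum this).trans ?_
      simp only [Finset.sum_const, Finset.card_univ, Fintype.card_fin, nsmul_eq_mul]
      nlinarith
    have h3 : (a : ℝ) * ‖G *ᵥ ci v'‖ ≤ a * (6 * d + 2 * r) := by nlinarith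
    have := le_of_mul_le_mul_left h3 (by linarith)
    linarith
  rw [mem_closedBall_zero_iff]
  refine (pi_norm_le_iff_of_nonneg (by positivity)).2 fun i => ?_
  rw [cst_snoc]
  refine Fin.lastCases ?_ (fun i => ?_) i
  · simpa [act] using hvn
  · have h4 : ‖V i‖ ≤ 2 := (norm_le_pi_norm V i).trans hK1.le
    have h5 : act (g : Matrix (Fin d) (Fin d) ℝ) (Fin.snoc (cst U) (ci v') : Fin (r + 1) → Fin d → ℝ) i.castSucc = V i := by
      simp [act, hV]
    rw [h5]
    linarith

lemma base_count (d : ℕ) (R : ℝ) : ∃ M : ℝ≥0∞, M < ⊤ ∧ ∀ g : SLR d,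
    Ssum (Prim d d) ((Metric.closedBall 0 R).indicator 1) (g : Matrix (Fin d) (Fin d) ℝ) ≤ M := by
  obtain ⟨K, hK⟩ : ∃ K : ℝ, ∀ X : Fin d → Fin d → ℝ, X ∈ Metric.closedBall (0 : Fin d → Fin d → ℝ) R →
      ∀ i j, |(Matrix.of X).adjugate i j| ≤ K := by
    have hc : Continuous fun X : Fin d → Fin d → ℝ => fun i j => (Matrix.of X).adjugate i j := by
      have : Continuous fun X : Fin d → Fin d → ℝ => (Matrix.of X).adjugate :=
        Continuous.matrix_adjugate continuous_id
      exact this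
    obtain ⟨K, hK⟩ := ((isCompact_closedBall (0 : Fin d → Fin d → ℝ) R).image hc).isBounded.subset_closedBall 0
    refine ⟨K, fun X hX i j => ?_⟩
    have := hK ⟨X, hX, rfl⟩
    rw [mem_closedBall_zero_iff] at this
    exact (norm_le_pi_norm ((fun i j => (Matrix.of X).adjugate i j) i) j).trans
      ((norm_le_pi_norm (fun i j => (Matrix.of X).adjugate i j) i).trans this)
  let C : ℝ := d * (R * K)
  have hfin : {A : Fin d → Fin d → ℤ | ∀ i, A i ∈ {z : Fin d → ℤ | ∀ j, |(z j : ℝ)| ≤ C}}.Finite := by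
    have := Set.Finite.pi fun _ : Fin d => finite_bdd (d := d) C
    refine this.subset fun A hA i _ => hA i
  refine ⟨hfin.toFinset.card, ENNReal.natCast_lt_top _, fun g => ?_⟩
  let G : Matrix (Fin d) (Fin d) ℝ := g
  by_cases hex : ∃ U0 ∈ Prim d d, act G (cst U0) ∈ Metric.closedBall 0 R
  swap
  · push Not at hex
    unfold Ssum
    rw [ENNReal.tsum_eq_zero.2]
    · exact zero_le
    · intro U
      exact Set.indicator_of_notMem (hex U.1 U.2) _
  obtain ⟨U0, hU0, hball0⟩ := hex
  let X0 : Matrix (Fin d) (Fin d) ℝ := Matrix.of (act G (cst U0))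
  have hX0 : ∀ U : Fin d → Fin d → ℤ, Matrix.of (act G (cst U)) = (Matrix.of U).map (Int.castRingHom ℝ) * Gᵀ := by
    intro U
    ext i j
    simp only [act, Matrix.mulVec, dotProduct, Matrix.of_apply, Matrix.mul_apply, Matrix.map_apply,
      Matrix.transpose_apply, cst]
    exact Finset.sum_congr rfl fun k _ => mul_comm _ _
  have hGd : G.det = 1 := g.2
  have hdet : X0.det = ((Matrix.of U0).det : ℝ) := by
    simp only [X0]
    rw [hX0, Matrix.det_mul, Matrix.det_transpose, hGd, mul_one]
    exact ((Int.castRingHom ℝ).map_det (Matrix.of U0)).symm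
  have hdet0 : (Matrix.of U0).det ≠ 0 := by
    intro h0
    have h1 : ((Matrix.of U0).map (Int.castRingHom ℝ)).det = 0 := by
      have := (Int.castRingHom ℝ).map_det (Matrix.of U0)
      rw [h0, map_zero] at this
      exact this.symm
    have h2 : LinearIndependent ℝ ((Matrix.of U0).map (Int.castRingHom ℝ)).row := Prim_li hU0
    rw [Matrix.linearIndependent_rows_iff_isUnit, Matrix.isUnit_iff_isUnit_det, h1] at h2
    simp at h2
  have hdet1 : 1 ≤ |X0.det| := by
    rw [hdet]
    exact_mod_cast Int.one_le_abs hdet0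
  have hX0u : IsUnit X0.det := isUnit_iff_ne_zero.2 (by intro h; rw [h] at hdet1; norm_num at hdet1)
  have hR : 0 ≤ R := (norm_nonneg _).trans (mem_closedBall_zero_iff.1 hball0)
  have key := Ssum_le_sigma (A := hfin.toFinset) (ι' := fun _ => Fin 0) (Prim d d)
    ((Metric.closedBall 0 R).indicator 1) (fun _ => Set.univ) (fun _ _ => 1) G
    (fun A _ => fun i => ∑ k, A.1 i k • U0 k) (by
      intro U hU hf
      have hball : act G (cst U) ∈ Metric.closedBall 0 R := by
        by_contra hcon
        exact hf (Set.indicator_of_notMem hcon _)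
      let X : Matrix (Fin d) (Fin d) ℝ := Matrix.of (act G (cst U))
      let A : Matrix (Fin d) (Fin d) ℝ := X * X0⁻¹
      have hAX : A * X0 = X := by
        simp only [A]
        rw [Matrix.mul_assoc, Matrix.nonsing_inv_mul _ hX0u, Matrix.mul_one]
      have hAU : A * (Matrix.of U0).map (Int.castRingHom ℝ) = (Matrix.of U).map (Int.castRingHom ℝ) := by
        have h1 : A * (Matrix.of U0).map (Int.castRingHom ℝ) * Gᵀ = (Matrix.of U).map (Int.castRingHom ℝ) * Gᵀ := by
          rw [Matrix.mul_assoc, ← hX0, ← hX0]; exact hAX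
        have h2 := congrArg (· * (Gᵀ)⁻¹) h1
        simpa only [Matrix.mul_assoc, Matrix.mul_nonsing_inv Gᵀ (by rw [Matrix.det_transpose, hGd]; exact isUnit_one), Matrix.mul_one] using h2
      have hrow : ∀ i, ∑ k, A i k • cst U0 k = ci (U i) := by
        intro i
        funext j
        have := congrFun (congrFun hAU i) j
        simpa [Matrix.mul_apply, cst, ci, Finset.sum_apply] using this
      choose t ht using fun i => hU0 (A i) (U i) (hrow i)
      have htC : ∀ i k, |(t i k : ℝ)| ≤ C := by
        intro i k
        rw [← ht i k]
        have hA : A i k = X0.det⁻¹ * ∑ l, X i l * X0.adjugate l k := by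
          simp only [A, Matrix.inv_def, Ring.inverse_eq_inv', Matrix.mul_smul, Matrix.smul_apply, smul_eq_mul, Matrix.mul_apply]
        rw [hA, abs_mul, abs_inv]
        have h1 : |∑ l, X i l * X0.adjugate l k| ≤ C := by
          refine (Finset.abs_sum_le_sum_abs _ _).trans ?_
          have : ∀ l ∈ Finset.univ, |X i l * X0.adjugate l k| ≤ R * K := by
            intro l _
            rw [abs_mul]
            refine mul_le_mul ?_ (hK _ hball0 l k) (abs_nonneg _) hR
            exact (norm_le_pi_norm (act G (cst U) i) l).trans ((norm_le_pi_norm (act G (cst U)) i).trans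
              (mem_closedBall_zero_iff.1 hball))
          refine (Finset.sum_le_sum this).trans ?_
          simp [C]
        refine (mul_le_of_le_one_left (abs_nonneg _) ?_).trans h1
        exact inv_le_one_of_one_le₀ hdet1
      refine ⟨⟨t, hfin.mem_toFinset.2 htC⟩, Fin.elim0, Set.mem_univ _, ?_, ?_⟩
      · funext i
        apply ci_inj
        rw [← hrow, ci_sum]
        simp only [ci_smul, ht, cst_apply]
      · rw [Set.indicator_of_mem hball]; rfl)
  refine key.trans ?_
  have h1 : Ssum (Set.univ : Set (Fin 0 → Fin d → ℤ)) (fun _ => (1 : ℝ≥0∞)) G = 1 := by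
    unfold Ssum
    rw [tsum_eq_single ⟨Fin.elim0, Set.mem_univ _⟩]
    intro U hU
    exact absurd (Subtype.ext (Subsingleton.elim _ _)) hU
  simp only [h1]
  simp

/-- uniform bound -/
def QQ (d r : ℕ) : Prop := ∀ R : ℝ, ∃ M : ℝ≥0∞, M < ⊤ ∧ ∀ (N : ℕ) (μ : Measure (XspaceN d N)), Good μ →
  ∫⁻ x, Tsum (Prim d r) ((Metric.closedBall 0 R).indicator 1) x ∂μ ≤ M

/-- uniform bound, all functions -/
def UB {ι : Type*} [Fintype ι] (O : Set (ι → Fin d → ℤ)) (C : ℝ≥0∞) : Prop :=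
  ∀ (N : ℕ) (μ : Measure (XspaceN d N)), Good μ → ∀ F : (ι → Fin d → ℝ) → ℝ≥0∞, Measurable F →
    ∫⁻ x, Tsum O F x ∂μ ≤ C * ∫⁻ V, F V

lemma QQ_base (d : ℕ) : QQ d d := by
  intro R
  obtain ⟨M, hM, h⟩ := base_count d R
  refine ⟨M, hM, fun N μ hμ => ?_⟩
  have := hμ.prob
  calc ∫⁻ x, Tsum (Prim d d) ((Metric.closedBall 0 R).indicator 1) x ∂μ ≤ ∫⁻ x, M ∂μ :=
        lintegral_mono fun x => h _
    _ = M := by simp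

lemma UB_step {r : ℕ} (hr : r < d) (hQ : QQ d (r + 1)) : ∃ C < ⊤, UB (Prim d r) C := by
  obtain ⟨M, hM, h⟩ := hQ (8 * d)
  have hKo := isOpen_Kr (d := d) r
  have hK0 : volume (Kr d r) ≠ 0 := (hKo.measure_pos volume (Kr_nonempty hr.le)).ne'
  have hKt : volume (Kr d r) ≠ ⊤ := by
    refine ((measure_mono ?_).trans_lt (Metric.isBounded_ball (x := (0 : Fin r → Fin d → ℝ)) (r := 2)).measure_lt_top).ne
    intro V hV
    rw [mem_ball_zero_iff]
    exact hV.1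
  refine ⟨M / volume (Kr d r), ENNReal.div_lt_top hM.ne hK0, fun N μ hμ F hF => ?_⟩
  have : NeZero d := ⟨by omega⟩
  obtain ⟨c, hc⟩ := T1 hμ (Prim_stab r) (fun U hU => Prim_li hU) (by simpa using hr)
  rw [hc F hF]
  refine mul_le_mul' ?_ le_rfl
  rw [ENNReal.le_div_iff_mul_le (Or.inl hK0) (Or.inl hKt), ← lintegral_indicator_one hKo.measurableSet,
    ← hc _ (measurable_one.indicator hKo.measurableSet)]
  refine le_trans (lintegral_mono fun x => ?_) (h N μ hμ)
  refine Ssum_le _ _ _ _ _ (fun U' => Fin.init U') fun U hU hf => ?_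
  have hK : act ((Quotient.out x : SLR d) : Matrix (Fin d) (Fin d) ℝ) (cst U) ∈ Kr d r := by
    by_contra hcon
    exact hf (Set.indicator_of_notMem hcon _)
  obtain ⟨v, hv, hb⟩ := mink_step hr _ hU hK
  refine ⟨_, hv, Fin.init_snoc _ _, ?_⟩
  rw [Set.indicator_of_mem hK, Set.indicator_of_mem hb]
  exact le_rfl

lemma UB_QQ {r : ℕ} {C : ℝ≥0∞} (hC : C < ⊤) (h : UB (Prim d r) C) : QQ d r := by
  intro R
  refine ⟨C * volume (Metric.closedBall (0 : Fin r → Fin d → ℝ) R),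
    ENNReal.mul_lt_top hC Metric.isBounded_closedBall.measure_lt_top, fun N μ hμ => ?_⟩
  refine (h N μ hμ _ (measurable_one.indicator Metric.isClosed_closedBall.measurableSet)).trans ?_
  rw [lintegral_indicator_one Metric.isClosed_closedBall.measurableSet]

theorem T2 {r : ℕ} (hr : r < d) : ∃ C < ⊤, UB (Prim d r) C := by
  have key : ∀ m ≤ d, QQ d (d - m) := by
    intro m
    induction m with
    | zero => intro _; exact QQ_base d
    | succ m ih =>
      intro hm
      have h1 := ih (by omega)
      have h2 : d - m = d - (m + 1) + 1 := by omega
      rw [h2] at h1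
      obtain ⟨C, hC, h⟩ := UB_step (by omega) h1
      exact UB_QQ hC h
  refine UB_step hr ?_
  have := key (d - (r + 1)) (by omega)
  have h2 : d - (d - (r + 1)) = r + 1 := by omega
  rwa [h2] at this

end PartD

section PartE

open scoped ENNReal

variable {d N : ℕ}

/-- linear combinations of rows -/
def cmb {κ ι : Type*} [Fintype ι] (B : Matrix κ ι ℝ) (V : ι → Fin d → ℝ) : κ → Fin d → ℝ :=
  fun i => ∑ j, B i j • V j

/-- integral combinations -/
def icmb {κ ι : Type*} [Fintype ι] (B : Matrix κ ι ℤ) (V : ι → Fin d → ℤ) : κ → Fin d → ℤ :=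
  fun i => ∑ j, B i j • V j

lemma act_cmb {κ ι : Type*} [Fintype ι] (g : Matrix (Fin d) (Fin d) ℝ) (B : Matrix κ ι ℝ)
    (V : ι → Fin d → ℝ) : act g (cmb B V) = cmb B (act g V) := by
  funext i
  simp only [cmb]
  rw [act_comb]
  rfl

lemma cst_icmb {κ ι : Type*} [Fintype ι] (B : Matrix κ ι ℤ) (U : ι → Fin d → ℤ) :
    cst (icmb B U) = cmb (B.map (Int.cast : ℤ → ℝ)) (cst U) := by
  funext i
  rw [cst_apply]
  simp only [icmb, ci_sum, ci_smul, cmb, cst_apply, Matrix.map_apply]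

lemma cmb_cmb {κ ι τ : Type*} [Fintype ι] [Fintype τ] (B : Matrix κ ι ℝ) (B' : Matrix ι τ ℝ)
    (V : τ → Fin d → ℝ) : cmb B (cmb B' V) = cmb (B * B') V := by
  funext i
  simp only [cmb, Finset.smul_sum, Matrix.mul_apply, Finset.sum_smul, smul_smul, Matrix.of_apply]
  rw [Finset.sum_comm]

lemma cmb_one {ι : Type*} [Fintype ι] [DecidableEq ι] (V : ι → Fin d → ℝ) :
    cmb (1 : Matrix ι ι ℝ) V = V := by
  funext i
  simp [cmb, Matrix.one_apply]

lemma measurable_cmb {κ ι : Type*} [Fintype ι] (B : Matrix κ ι ℝ) :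
    Measurable (cmb (d := d) B) := by
  classical
  refine measurable_pi_lambda _ fun i => measurable_pi_lambda _ fun t => ?_
  simp only [cmb, Finset.sum_apply, Pi.smul_apply, smul_eq_mul]
  exact Finset.measurable_sum _ fun j _ =>
    (measurable_entryV j t).const_mul _

/-- `cmb` as a linear map -/
def cmbL {ι : Type*} [Fintype ι] (d : ℕ) (B : Matrix ι ι ℝ) :
    (ι → Fin d → ℝ) →ₗ[ℝ] (ι → Fin d → ℝ) where
  toFun := cmb B
  map_add' V W := by funext i; simp [cmb, Finset.sum_add_distrib]
  map_smul' c V := by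
    funext i; simp only [cmb, Finset.smul_sum, Pi.smul_apply, RingHom.id_apply]
    exact Finset.sum_congr rfl fun j _ => smul_comm _ _ _

/-- flip -/
def flipL (ι : Type*) (d : ℕ) : (ι → Fin d → ℝ) ≃ₗ[ℝ] (Fin d → ι → ℝ) where
  toFun V := fun j i => V i j
  invFun V := fun i j => V j i
  map_add' V W := rfl
  map_smul' c V := rfl
  left_inv V := rfl
  right_inv V := rfl

lemma det_cmbL {ι : Type*} [Fintype ι] [DecidableEq ι] (B : Matrix ι ι ℝ) :
    LinearMap.det (cmbL d B) = B.det ^ d := by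
  rw [← LinearMap.det_conj _ (flipL ι d)]
  have : (flipL ι d : (ι → Fin d → ℝ) →ₗ[ℝ] (Fin d → ι → ℝ)) ∘ₗ cmbL d B ∘ₗ
      ((flipL ι d).symm : (Fin d → ι → ℝ) →ₗ[ℝ] (ι → Fin d → ℝ)) =
      LinearMap.pi (fun i : Fin d => (Matrix.toLin' B).comp (LinearMap.proj i)) := by
    refine LinearMap.ext fun V => ?_
    funext j i
    simp only [LinearMap.comp_apply, LinearMap.pi_apply, LinearMap.proj_apply, Matrix.toLin'_apply,
      LinearEquiv.coe_coe]
    show (cmb B (fun i j => V j i)) i j = _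
    simp [cmb, Matrix.mulVec, dotProduct]
  rw [this, LinearMap.det_pi]
  simp

lemma lintegral_cmb {ι : Type*} [Fintype ι] [DecidableEq ι] (B : Matrix ι ι ℝ) (hB : B.det ≠ 0)
    {f : (ι → Fin d → ℝ) → ℝ≥0∞} (hf : Measurable f) :
    ∫⁻ V, f (cmb B V) = ENNReal.ofReal (|B.det|⁻¹ ^ d) * ∫⁻ V, f V := by
  have h1 : LinearMap.det (cmbL d B) ≠ 0 := by rw [det_cmbL]; exact pow_ne_zero _ hB
  have h2 := Measure.map_linearMap_addHaar_eq_smul_addHaar (volume : Measure (ι → Fin d → ℝ)) h1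
  have h3 : ∫⁻ V, f (cmb B V) = ∫⁻ V, f V ∂(Measure.map (cmbL d B) volume) := by
    exact (lintegral_map hf (measurable_cmb B)).symm
  rw [h3, h2, lintegral_smul_measure, det_cmbL, abs_inv, abs_pow, inv_pow]
  rfl

lemma hnf {r : ℕ} (U : Fin r → Fin d → ℤ) (hU : LinearIndependent ℝ (cst U)) :
    ∃ A : Matrix (Fin r) (Fin r) ℤ, ∃ W ∈ Prim d r, (∀ i, 1 ≤ A i i) ∧ (∀ i j, i < j → A i j = 0) ∧
      (∀ i j, j < i → 0 ≤ A i j ∧ A i j < A i i) ∧ icmb A W = U := by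
  induction r with
  | zero =>
    refine ⟨0, U, ?_, fun i => i.elim0, fun i => i.elim0, fun i => i.elim0, ?_⟩
    · intro s z _; exact ⟨fun i => i.elim0, fun i => i.elim0⟩
    · funext i; exact i.elim0
  | succ r ih =>
    obtain ⟨U, u, rfl⟩ : ∃ U' u, U = (Fin.snoc U' u : Fin (r+1) → Fin d → ℤ) :=
      ⟨Fin.init U, U (Fin.last r), (Fin.snoc_init_self U).symm⟩
    have hU0 := hU
    rw [cst_snoc, linearIndependent_finSnoc] at hU
    obtain ⟨A, W, hW, h1, h2, h3, h4⟩ := ih U hU.1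
    have hsp : Submodule.span ℝ (Set.range (cst W)) = Submodule.span ℝ (Set.range (cst U)) := by
      have hle : Submodule.span ℝ (Set.range (cst U)) ≤ Submodule.span ℝ (Set.range (cst W)) := by
        rw [Submodule.span_le]
        rintro _ ⟨i, rfl⟩
        rw [← h4, cst_icmb]
        exact Submodule.sum_mem _ fun j _ => Submodule.smul_mem _ _ (Submodule.subset_span ⟨j, rfl⟩)
      symm
      apply Submodule.eq_of_le_of_finrank_eq hle
      rw [finrank_span_eq_card hU.1, finrank_span_eq_card (Prim_li hW)]
    have hWu : LinearIndependent ℝ (cst (Fin.snoc W u : Fin (r + 1) → Fin d → ℤ)) := by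
      rw [cst_snoc, linearIndependent_finSnoc, hsp]
      exact ⟨Prim_li hW, hU.2⟩
    obtain ⟨w, a, b, ha, hb, hu, hp⟩ := lemmaE hW u hWu
    refine ⟨Matrix.of (Fin.snoc (fun i => Fin.snoc (A i) 0) (Fin.snoc b (a : ℤ)) : Fin (r+1) → Fin (r+1) → ℤ),
      _, hp, ?_, ?_, ?_, ?_⟩
    · intro i
      refine Fin.lastCases ?_ (fun i => ?_) i
      · simpa using ha
      · simpa using h1 i
    · intro i j
      refine Fin.lastCases ?_ (fun i => ?_) i
      · intro h; exact absurd h (not_lt.2 (Fin.le_last _))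
      · refine Fin.lastCases ?_ (fun j => ?_) j
        · simp
        · simpa using h2 i j
    · intro i j
      refine Fin.lastCases ?_ (fun i => ?_) i
      · refine Fin.lastCases ?_ (fun j => ?_) j
        · simp
        · simpa using hb j
      · refine Fin.lastCases ?_ (fun j => ?_) j
        · intro h; exact absurd h (not_lt.2 (Fin.le_last _))
        · simpa using h3 i j
    · funext i
      refine Fin.lastCases ?_ (fun i => ?_) i
      · simp only [icmb, Matrix.of_apply, Fin.sum_univ_castSucc, Fin.snoc_last, Fin.snoc_castSucc]
        rw [hu, add_comm]
      · simp only [icmb, Matrix.of_apply, Fin.sum_univ_castSucc, Fin.snoc_last, Fin.snoc_castSucc, zero_smul, add_zero]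
        exact congrFun h4 i

lemma tsum_pi_prod {T : Type*} (w : T → ℝ≥0∞) (r : ℕ) :
    ∑' h : Fin r → T, ∏ i, w (h i) = (∑' t, w t) ^ r := by
  induction r with
  | zero => simp
  | succ r ih =>
    rw [← (Fin.consEquiv (fun _ : Fin (r+1) => T)).tsum_eq, ENNReal.tsum_prod', pow_succ', ← ih,
      ← ENNReal.tsum_mul_right]
    refine tsum_congr fun t => ?_
    rw [← ENNReal.tsum_mul_left]
    refine tsum_congr fun h => ?_
    simp [Fin.prod_univ_succ, Fin.consEquiv]

/-- index type for HNF rows -/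
abbrev HT (r : ℕ) := Σ a : ℕ, Fin r → Fin (a + 1)

/-- HNF matrix from the index -/
def hmat {r : ℕ} (h : Fin r → HT r) : Matrix (Fin r) (Fin r) ℤ :=
  fun i j => if i = j then ((h i).1 + 1 : ℤ) else if j < i then (((h i).2 j : ℕ) : ℤ) else 0

lemma hmat_det {r : ℕ} (h : Fin r → HT r) :
    ((hmat h).map (Int.cast : ℤ → ℝ)).det = ∏ i, (((h i).1 + 1 : ℕ) : ℝ) := by
  rw [Matrix.det_of_lowerTriangular]
  · refine Finset.prod_congr rfl fun i _ => ?_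
    simp [hmat]
  · intro i j hij
    have hij' : i < j := hij
    simp [hmat, hij'.ne, not_lt.2 hij'.le]

lemma exists_hmat {r : ℕ} (A : Matrix (Fin r) (Fin r) ℤ) (h1 : ∀ i, 1 ≤ A i i)
    (h2 : ∀ i j, i < j → A i j = 0) (h3 : ∀ i j, j < i → 0 ≤ A i j ∧ A i j < A i i) :
    ∃ h : Fin r → HT r, hmat h = A := by
  refine ⟨fun i => ⟨(A i i).toNat - 1, fun j => Fin.ofNat _ (A i j).toNat⟩, ?_⟩
  ext i j
  simp only [hmat]
  split_ifs with hij hij'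
  · subst hij; have := h1 i; omega
  · have := h1 i
    have := h3 i j hij'
    simp only [Fin.ofNat]
    rw [Nat.mod_eq_of_lt] <;> omega
  · rw [h2 i j (lt_of_le_of_ne (not_lt.1 hij') hij)]

/-- independent tuples -/
def Ind (κ : Type*) (d : ℕ) : Set (κ → Fin d → ℤ) := {U | LinearIndependent ℝ (cst U)}

lemma li_act {κ : Type*} (g : SLR d) {V : κ → Fin d → ℝ} (hV : LinearIndependent ℝ V) :
    LinearIndependent ℝ (act (g : Matrix (Fin d) (Fin d) ℝ) V) := by
  refine hV.map' (Matrix.mulVecLin (g : Matrix (Fin d) (Fin d) ℝ)) ?_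
  rw [LinearMap.ker_eq_bot, Matrix.coe_mulVecLin, Matrix.mulVec_injective_iff_isUnit,
    Matrix.isUnit_iff_isUnit_det, g.det_coe]
  exact isUnit_one

lemma Ind_stab (κ : Type*) : Stab N (Ind κ d) := by
  intro γ _ U hU
  show LinearIndependent ℝ _
  rw [cst_smul]
  exact li_act (Matrix.SpecialLinearGroup.map (Int.castRingHom ℝ) γ) hU

lemma sum_HT_lt_top {r : ℕ} (hr : r + 2 ≤ d) :
    ∑' t : HT r, ENNReal.ofReal ((((t.1 + 1 : ℕ) : ℝ))⁻¹ ^ d) < ⊤ := by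
  rw [ENNReal.tsum_sigma']
  have : ∀ a : ℕ, ∑' _ : Fin r → Fin (a + 1), ENNReal.ofReal ((((a + 1 : ℕ) : ℝ))⁻¹ ^ d) ≤
      ENNReal.ofReal (1 / ((a + 1 : ℕ) : ℝ) ^ 2) := by
    intro a
    rw [tsum_fintype, Finset.sum_const, Finset.card_univ, Fintype.card_fun, Fintype.card_fin, Fintype.card_fin,
      nsmul_eq_mul, ← ENNReal.ofReal_natCast, ← ENNReal.ofReal_mul (by positivity)]
    apply ENNReal.ofReal_le_ofReal
    have h1 : (1 : ℝ) ≤ ((a + 1 : ℕ) : ℝ) := by push_cast; linarith [Nat.cast_nonneg (α := ℝ) a]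
    obtain ⟨s, rfl⟩ : ∃ s, d = r + 2 + s := ⟨d - (r + 2), by omega⟩
    rw [inv_pow, Nat.cast_pow, pow_add, pow_add]
    generalize ((a + 1 : ℕ) : ℝ) = x at h1
    have hx : 0 < x := by linarith
    rw [mul_assoc, mul_inv, ← mul_assoc, mul_inv_cancel₀ (by positivity), one_mul, mul_inv, one_div]
    exact mul_le_of_le_one_right (by positivity) (inv_le_one_of_one_le₀ (one_le_pow₀ h1))
  refine lt_of_le_of_lt (ENNReal.tsum_le_tsum this) ?_
  have hs : Summable (fun a : ℕ => 1 / ((a + 1 : ℕ) : ℝ) ^ 2) :=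
    (summable_nat_add_iff 1).2 (Real.summable_one_div_nat_pow.2 (by norm_num : 1 < 2))
  rw [← ENNReal.ofReal_tsum_of_nonneg (fun a => by positivity) hs]
  exact ENNReal.ofReal_lt_top

theorem T3fin {r : ℕ} (hr : r + 2 ≤ d) : ∃ C < ⊤, UB (Ind (Fin r) d) C := by
  obtain ⟨C, hC, hP⟩ := T2 (d := d) (r := r) (by omega)
  refine ⟨C * (∑' t : HT r, ENNReal.ofReal ((((t.1 + 1 : ℕ) : ℝ))⁻¹ ^ d)) ^ r,
    ENNReal.mul_lt_top hC (ENNReal.pow_lt_top (sum_HT_lt_top hr)), fun N μ hμ F hF => ?_⟩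
  have h1 : ∀ x : XspaceN d N, Tsum (Ind (Fin r) d) F x ≤ ∑' h : Fin r → HT r,
      Tsum (Prim d r) (fun V => F (cmb ((hmat h).map (Int.cast : ℤ → ℝ)) V)) x := by
    intro x
    refine Ssum_le_sigma _ _ (fun _ => Prim d r) _ _ (fun h => icmb (hmat h)) fun U hU _ => ?_
    obtain ⟨A, W, hW, h1, h2, h3, h4⟩ := hnf U hU
    obtain ⟨h, rfl⟩ := exists_hmat A h1 h2 h3
    refine ⟨h, W, hW, h4, ?_⟩
    rw [← h4]
    refine le_of_eq (congrArg F ?_)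
    exact (congrArg _ (cst_icmb _ _)).trans (act_cmb _ _ _)
  refine (lintegral_mono h1).trans ?_
  have hm : ∀ h : Fin r → HT r, Measurable (fun V => F (cmb (d := d) ((hmat h).map (Int.cast : ℤ → ℝ)) V)) :=
    fun h => hF.comp (measurable_cmb _)
  rw [lintegral_tsum (fun h => (measurable_Tsum (Prim_stab r) (hm h)).aemeasurable),
    ← tsum_pi_prod, ← ENNReal.tsum_mul_left, ← ENNReal.tsum_mul_right]
  refine ENNReal.tsum_le_tsum fun h => ?_
  refine (hP N μ hμ _ (hm h)).trans ?_
  have hpos : 0 < ∏ i, (((h i).1 + 1 : ℕ) : ℝ) := Finset.prod_pos fun i _ => by positivity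
  rw [lintegral_cmb _ (by rw [hmat_det]; exact hpos.ne') hF, hmat_det, mul_assoc, abs_of_pos hpos,
    ← Finset.prod_inv_distrib, ← Finset.prod_pow, ENNReal.ofReal_prod_of_nonneg (fun i _ => by positivity)]

end PartE

section PartF

open scoped ENNReal

variable {d N : ℕ}

lemma lintegral_reindex {κ κ' : Type*} [Fintype κ] [Fintype κ'] (e : κ ≃ κ')
    (F : (κ → Fin d → ℝ) → ℝ≥0∞) :
    ∫⁻ V : κ' → Fin d → ℝ, F (fun i => V (e i)) = ∫⁻ V, F V := by
  have h := (volume_measurePreserving_piCongrLeft (fun _ => Fin d → ℝ) e).symm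
  exact h.lintegral_comp_emb (MeasurableEquiv.measurableEmbedding _) F

theorem T3 {κ : Type*} [Fintype κ] (hr : Fintype.card κ + 2 ≤ d) : ∃ C < ⊤, UB (Ind κ d) C := by
  obtain ⟨C, hC, h⟩ := T3fin hr
  refine ⟨C, hC, fun N μ hμ F hF => ?_⟩
  let e := Fintype.equivFin κ
  rw [← lintegral_reindex e F]
  refine le_trans (lintegral_mono fun x => ?_) (h N μ hμ (fun V => F (fun i => V (e i)))
    (hF.comp (measurable_pi_lambda _ fun i => measurable_pi_apply _)))
  refine Ssum_le _ _ _ _ _ (fun U i => U (e i)) fun U hU _ => ⟨fun i => U (e.symm i), ?_, ?_, ?_⟩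
  · exact LinearIndependent.comp (v := cst U) hU e.symm e.symm.injective
  · simp
  · refine le_of_eq (congrArg F ?_)
    funext i
    show _ = _ *ᵥ (ci (U (e.symm (e i))))
    rw [Equiv.symm_apply_apply]
    rfl

/-- congruence-constrained independent tuples -/
def OqM {κ τ : Type*} [Fintype κ] (d q : ℕ) (M : Matrix τ κ ℤ) : Set (κ → Fin d → ℤ) :=
  {U | U ∈ Ind κ d ∧ ∀ i t, (q : ℤ) ∣ icmb M U i t}

lemma OqM_stab {κ τ : Type*} [Fintype κ] (q : ℕ) (M : Matrix τ κ ℤ) : Stab N (OqM d q M) := by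
  intro γ hγ U hU
  refine ⟨Ind_stab κ γ hγ U hU.1, fun i t => ?_⟩
  have : icmb M (fun i => (γ : Matrix (Fin d) (Fin d) ℤ) *ᵥ U i) i =
      (γ : Matrix (Fin d) (Fin d) ℤ) *ᵥ (icmb M U i) := by
    simp only [icmb]
    rw [← Matrix.mulVecLin_apply, map_sum]
    refine Finset.sum_congr rfl fun j _ => ?_
    rw [LinearMap.map_smul_of_tower, Matrix.mulVecLin_apply]
  rw [this]
  simp only [Matrix.mulVec, dotProduct]
  exact Finset.dvd_sum fun s _ => Dvd.dvd.mul_left (hU.2 i s) _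

/-- the lattice -/
def Lq {κ τ : Type*} [Fintype κ] (q : ℕ) (M : Matrix τ κ ℤ) : Submodule ℤ (κ → ℤ) where
  carrier := {x | ∀ i, (q : ℤ) ∣ (M *ᵥ x) i}
  add_mem' := by
    intro a b ha hb i
    rw [Matrix.mulVec_add]
    exact dvd_add (ha i) (hb i)
  zero_mem' := by intro i; simp
  smul_mem' := by
    intro c x hx i
    rw [Matrix.mulVec_smul]
    exact Dvd.dvd.mul_left (hx i) c

lemma Lq_basis {κ τ : Type*} [Fintype κ] [DecidableEq κ] (q : ℕ) (hq : 1 ≤ q) (M : Matrix τ κ ℤ) :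
    ∃ B : Matrix κ κ ℤ, B.det ≠ 0 ∧ (∀ x ∈ Lq q M, ∃ y, x = B *ᵥ y) ∧ ∀ l, (fun j => B j l) ∈ Lq q M := by
  have hfr : Module.finrank ℤ (Lq q M) = Module.finrank ℤ (κ → ℤ) := by
    refine le_antisymm (Submodule.finrank_le _) ?_
    let φ : (κ → ℤ) →ₗ[ℤ] Lq q M := LinearMap.codRestrict (Lq q M) ((q : ℤ) • LinearMap.id) (by
      intro x i
      simp only [LinearMap.smul_apply, LinearMap.id_apply, Matrix.mulVec_smul]
      exact Dvd.intro _ rfl)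
    refine LinearMap.finrank_le_finrank_of_injective (f := φ) ?_
    intro x y hxy
    have h2 : (q : ℤ) • x = (q : ℤ) • y := congrArg Subtype.val hxy
    funext i
    have := congrFun h2 i
    simp only [Pi.smul_apply, smul_eq_mul] at this
    exact mul_left_cancel₀ (by positivity) this
  obtain ⟨b', a, b, -⟩ := Submodule.exists_smith_normal_form_of_rank_eq (Pi.basisFun ℤ κ) hfr
  have hx : ∀ x ∈ Lq q M, ∃ y, x = (Matrix.of fun j l => (b l : κ → ℤ) j : Matrix κ κ ℤ) *ᵥ y := by
    intro x hx
    refine ⟨b.repr ⟨x, hx⟩, ?_⟩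
    have := congrArg Subtype.val (b.sum_repr ⟨x, hx⟩)
    simp only [Submodule.coe_sum, Submodule.coe_smul] at this
    conv_lhs => rw [← this]
    funext j
    simp [Matrix.mulVec, dotProduct, Finset.sum_apply, mul_comm]
  refine ⟨Matrix.of fun j l => (b l : κ → ℤ) j, ?_, hx, fun l => (b l).2⟩
  have h1 : ∀ j : κ, ∃ y, (q : ℤ) • (Pi.single j 1 : κ → ℤ) = (Matrix.of fun j l => (b l : κ → ℤ) j : Matrix κ κ ℤ) *ᵥ y := by
    intro j
    apply hx
    intro i
    rw [Matrix.mulVec_smul]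
    exact Dvd.intro _ rfl
  choose y hy using h1
  have h2 : (Matrix.of fun j l => (b l : κ → ℤ) j : Matrix κ κ ℤ) * (Matrix.of fun l j => y j l : Matrix κ κ ℤ) = (q : ℤ) • 1 := by
    ext i j
    have := congrFun (hy j) i
    rw [Matrix.mul_apply]
    simp only [Matrix.mulVec, dotProduct] at this
    simp only [Matrix.of_apply] at this ⊢
    rw [← this]
    simp [Matrix.one_apply, Pi.single_apply]
  intro h0
  have h3 := congrArg Matrix.det h2
  rw [Matrix.det_mul, h0, zero_mul, Matrix.det_smul, Matrix.det_one, mul_one] at h3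
  exact pow_ne_zero _ (by positivity) h3.symm

theorem T4 {κ τ : Type*} [Fintype κ] [DecidableEq κ] {C : ℝ≥0∞} (hC : UB (Ind κ d) C) (q : ℕ) (hq : 1 ≤ q)
    (M : Matrix τ κ ℤ)
    (hmin : ∀ q' : ℕ, 1 ≤ q' → (∀ i j, (q : ℤ) ∣ q' * M i j) → q ≤ q') :
    UB (OqM d q M) (C * ENNReal.ofReal (((q : ℝ)⁻¹) ^ d)) := by
  intro N μ hμ F hF
  obtain ⟨B, hB, hx, hl⟩ := Lq_basis q hq M
  have hqB : (q : ℝ) ≤ |((B.det : ℤ) : ℝ)| := by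
    have h1 : ∀ i j, (q : ℤ) ∣ (M * B) i j := fun i j => hl j i
    have h2 : ∀ i j, (q : ℤ) ∣ (M * B * B.adjugate) i j := by
      intro i j
      rw [Matrix.mul_apply]
      exact Finset.dvd_sum fun s _ => Dvd.dvd.mul_right (h1 i s) _
    rw [Matrix.mul_assoc, Matrix.mul_adjugate] at h2
    have h3 := hmin B.det.natAbs (Int.natAbs_pos.2 hB) (fun i j => by
      have := h2 i j
      simp only [Matrix.mul_smul, Matrix.mul_one, Matrix.smul_apply, smul_eq_mul] at this
      rw [Int.natCast_natAbs]
      rcases abs_choice B.det with h | h <;> rw [h]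
      · exact this
      · rw [neg_mul]; exact (dvd_neg).2 this)
    calc (q : ℝ) ≤ (B.det.natAbs : ℝ) := by exact_mod_cast h3
      _ = _ := by rw [← Int.cast_abs, Nat.cast_natAbs]
  have hdet : (B.map (Int.cast : ℤ → ℝ)).det = (B.det : ℤ) := by
    have := (Int.castRingHom ℝ).map_det B
    simpa using this.symm
  have hq0 : (0 : ℝ) < q := by exact_mod_cast hq
  have hdet0 : (B.map (Int.cast : ℤ → ℝ)).det ≠ 0 := by rw [hdet]; exact_mod_cast hB
  calc ∫⁻ x, Tsum (OqM d q M) F x ∂μ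
      ≤ ∫⁻ x, Tsum (Ind κ d) (fun V => F (cmb (B.map (Int.cast : ℤ → ℝ)) V)) x ∂μ := by
        refine lintegral_mono fun x => ?_
        refine Ssum_le _ _ _ _ _ (icmb B) fun U hU _ => ?_
        have hU2 : ∀ t, (fun j => U j t) ∈ Lq q M := by
          intro t i
          have := hU.2 i t
          simp only [icmb, Finset.sum_apply, Pi.smul_apply, smul_eq_mul] at this
          simpa only [Matrix.mulVec, dotProduct] using this
        choose y hy using fun t => hx _ (hU2 t)
        have hUB : icmb B (fun l t => y t l) = U := by
          funext j t
          have := congrFun (hy t) j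
          rw [this]
          simp [icmb, Matrix.mulVec, dotProduct, Finset.sum_apply]
        refine ⟨fun l t => y t l, ?_, hUB, ?_⟩
        · show LinearIndependent ℝ _
          rw [linearIndependent_iff_card_le_finrank_span, Set.finrank,
            ← finrank_span_eq_card (b := cst U) hU.1]
          refine Submodule.finrank_mono ?_
          rw [Submodule.span_le]
          rintro _ ⟨i, rfl⟩
          rw [← hUB, cst_icmb]
          exact Submodule.sum_mem _ fun j _ => Submodule.smul_mem _ _ (Submodule.subset_span ⟨j, rfl⟩)
        · conv_lhs => rw [← hUB]
          refine le_of_eq (congrArg F ?_)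
          exact (congrArg _ (cst_icmb _ _)).trans (act_cmb _ _ _)
    _ ≤ C * ∫⁻ V, F (cmb (B.map (Int.cast : ℤ → ℝ)) V) := hC N μ hμ _ (hF.comp (measurable_cmb _))
    _ = C * ENNReal.ofReal (|(B.map (Int.cast : ℤ → ℝ)).det|⁻¹ ^ d) * ∫⁻ V, F V := by
        rw [lintegral_cmb _ hdet0 hF, mul_assoc]
    _ ≤ _ := by
        gcongr
        rw [hdet]
        exact hqB

end PartF

section PartG

open scoped ENNReal

variable {d N : ℕ}

lemma pivot_real {ι : Type*} [Fintype ι] [DecidableEq ι] (V : ι → Fin d → ℝ) :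
    ∃ J : Finset ι, LinearIndependent ℝ (fun j : J => V j) ∧ ∃ D : ι → J → ℝ, (∀ i j, |D i j| ≤ 1) ∧
      ∀ i, V i = ∑ j, D i j • V j := by
  classical
  obtain ⟨κ, a, ha, hsp, hli⟩ := exists_linearIndependent' ℝ V
  haveI : Finite κ := Finite.of_injective a ha
  haveI := Fintype.ofFinite κ
  have h1 : ∀ i, ∃ c : κ → ℝ, ∑ j, c j • V (a j) = V i := by
    intro i
    have : V i ∈ Submodule.span ℝ (Set.range (V ∘ a)) := by
      rw [hsp]; exact Submodule.subset_span ⟨i, rfl⟩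
    exact (Submodule.mem_span_range_iff_exists_fun ℝ).1 this
  choose c hc using h1
  have huniq : ∀ s : κ → ℝ, ∑ j, s j • V (a j) = 0 → s = 0 := by
    intro s hs
    funext j
    exact (Fintype.linearIndependent_iff.1 hli) s hs j
  haveI : Nonempty (κ → ι) := ⟨a⟩
  obtain ⟨f, hf⟩ := Finite.exists_max (fun f : κ → ι => |(Matrix.of fun j => c (f j)).det|)
  set A : Matrix κ κ ℝ := Matrix.of fun j => c (f j) with hA
  have hdet : A.det ≠ 0 := by
    have h2 := hf a
    have h3 : (Matrix.of fun j => c (a j)) = (1 : Matrix κ κ ℝ) := by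
      ext i j
      have := huniq (c (a i) - Pi.single i 1) (by
        simp only [Pi.sub_apply, sub_smul, Finset.sum_sub_distrib, hc]
        simp [Pi.single_apply])
      have h4 := congrFun this j
      simp only [Pi.sub_apply, Pi.zero_apply, Pi.single_apply] at h4
      simp only [Matrix.of_apply, Matrix.one_apply]
      rw [sub_eq_zero.1 h4]
      simp [eq_comm]
    simp only [h3, Matrix.det_one, abs_one] at h2
    intro h0
    rw [h0, abs_zero] at h2
    linarith
  have hfinj : Function.Injective f := by
    intro j j' hjj
    by_contra hne
    exact hdet (Matrix.det_zero_of_row_eq hne (by rw [hA]; show c (f j) = c (f j'); rw [hjj]))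
  have hVf : ∀ s : κ → ℝ, ∑ j, s j • V (f j) = ∑ l, (s ᵥ* A) l • V (a l) := by
    intro s
    simp only [← hc (f _), Matrix.vecMul, dotProduct, Finset.sum_smul, Finset.smul_sum, smul_smul]
    rw [Finset.sum_comm]
    rfl
  have hlif : LinearIndependent ℝ (V ∘ f) := by
    rw [Fintype.linearIndependent_iff]
    intro s hs
    have h2 := huniq _ ((hVf s).symm.trans hs)
    have := Matrix.eq_zero_of_vecMul_eq_zero hdet h2
    intro i; rw [this]; rfl
  let D : ι → κ → ℝ := fun i j => (A.updateRow j (c i)).det / A.det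
  have hD : ∀ i j, |D i j| ≤ 1 := by
    intro i j
    rw [abs_div, div_le_one (abs_pos.2 hdet)]
    have h2 := hf (Function.update f j i)
    have h3 : (Matrix.of fun l => c (Function.update f j i l)) = A.updateRow j (c i) := by
      ext l m
      simp only [Matrix.of_apply, Matrix.updateRow_apply, hA]
      by_cases h : l = j
      · subst h; simp
      · simp [h]
    simp only [h3] at h2
    exact h2
  have hDV : ∀ i, V i = ∑ j, D i j • V (f j) := by
    intro i
    rw [hVf, ← hc i]
    have h2 : D i ᵥ* A = c i := by
      have h3 := Matrix.mulVec_cramer Aᵀ (c i)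
      rw [Matrix.mulVec_transpose, Matrix.det_transpose] at h3
      have h4 : D i = (A.det)⁻¹ • (Aᵀ.cramer (c i)) := by
        funext j
        simp only [D, Pi.smul_apply, smul_eq_mul, Matrix.cramer_transpose_apply]
        rw [div_eq_inv_mul]
      rw [h4, Matrix.smul_vecMul, h3, smul_smul, inv_mul_cancel₀ hdet, one_smul]
    rw [h2]
  let e : κ ≃ (Finset.univ.image f : Finset ι) :=
    Equiv.ofBijective (fun j => ⟨f j, Finset.mem_image_of_mem _ (Finset.mem_univ _)⟩)
      ⟨fun j j' h => hfinj (congrArg Subtype.val h), fun ⟨i, hi⟩ => by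
        obtain ⟨j, -, rfl⟩ := Finset.mem_image.1 hi
        exact ⟨j, rfl⟩⟩
  refine ⟨Finset.univ.image f, ?_, fun i j => D i (e.symm j), fun i j => hD _ _, fun i => ?_⟩
  · have h2 := hlif.comp e.symm e.symm.injective
    convert h2 using 1
    funext j
    have : f (e.symm j) = j := congrArg Subtype.val (e.apply_symm_apply j)
    simp [this]
  · rw [hDV i]
    refine Fintype.sum_equiv e _ _ fun j => ?_
    simp only [Equiv.symm_apply_apply]
    rfl

lemma gram_det {κ : Type*} [Fintype κ] [DecidableEq κ] (U : κ → Fin d → ℤ)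
    (hU : LinearIndependent ℝ (cst U)) :
    (Matrix.of U * (Matrix.of U)ᵀ).det ≠ 0 := by
  intro h0
  have h1 : (Matrix.of (cst U) * (Matrix.of (cst U))ᵀ).det = 0 := by
    have : Matrix.of (cst U) * (Matrix.of (cst U))ᵀ =
        (Matrix.of U * (Matrix.of U)ᵀ).map (Int.castRingHom ℝ) := by
      ext i j; simp [Matrix.mul_apply, cst]
    rw [this, ← RingHom.mapMatrix_apply, ← RingHom.map_det, h0, map_zero]
  obtain ⟨x, hx, hx0⟩ := Matrix.exists_mulVec_eq_zero_iff.2 h1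
  have h2 := Matrix.self_mul_conjTranspose_mulVec_eq_zero (Matrix.of (cst U)) x
  rw [Matrix.conjTranspose_eq_transpose_of_trivial] at h2
  have h3 := h2.1 hx0
  apply hx
  rw [Fintype.linearIndependent_iff] at hU
  funext i
  refine hU x ?_ i
  rw [← h3]
  funext t
  simp [Matrix.mulVec, dotProduct, Finset.sum_apply, mul_comm]

/-- the arithmetic data of a pivot -/
def Mini {τ κ : Type*} (q : ℕ) (M : Matrix τ κ ℤ) : Prop :=
  ∀ q' : ℕ, 1 ≤ q' → (∀ i j, (q : ℤ) ∣ q' * M i j) → q ≤ q'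

/-- tuples with pivot J -/
def OJ {ι : Type*} (d : ℕ) (J : Finset ι) : Set (ι → Fin d → ℤ) :=
  {U | (fun j : J => U j) ∈ Ind J d ∧ ∃ (q : ℕ) (M : Matrix {i // i ∉ J} J ℤ), 1 ≤ q ∧
    (∀ i j, |M i j| ≤ q) ∧ Mini q M ∧ ∀ i : {i // i ∉ J}, (q : ℤ) • U i = icmb M (fun j : J => U j) i}

lemma pivot {ι : Type*} [Fintype ι] [DecidableEq ι] (U : ι → Fin d → ℤ) : ∃ J : Finset ι, U ∈ OJ d J := by
  obtain ⟨J, hJ, D, hD, hV⟩ := pivot_real (cst U)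
  have hJ' : (fun j : J => U j) ∈ Ind J d := hJ
  refine ⟨J, hJ', ?_⟩
  have hex : ∃ q : ℕ, 1 ≤ q ∧ ∀ (i : {i // i ∉ J}) (j : J), ∃ m : ℤ, (q : ℝ) * D i j = m := by
    have hG := gram_det _ hJ'
    set G := (Matrix.of (fun j : J => U j) * (Matrix.of (fun j : J => U j))ᵀ) with hGdef
    refine ⟨G.det.natAbs, Int.natAbs_pos.2 hG, fun i j => ?_⟩
    have h1 : (D i) ᵥ* (G.map (Int.castRingHom ℝ)) =
        fun l : J => ((∑ t, U i t * U l t : ℤ) : ℝ) := by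
      have h2 : (D i) ᵥ* Matrix.of (fun j : J => cst U j) = cst U i := by
        rw [hV i]; funext t
        simp [Matrix.vecMul, dotProduct, Finset.sum_apply]
      have h3 : G.map (Int.castRingHom ℝ) = Matrix.of (fun j : J => cst U j) * (Matrix.of (fun j : J => cst U j))ᵀ := by
        ext a b; simp [hGdef, Matrix.mul_apply, cst]
      rw [h3, ← Matrix.vecMul_vecMul, h2]
      funext l
      simp [Matrix.vecMul, dotProduct, cst]
    have h4 : (G.det : ℝ) • D i = (fun l : J => ((∑ t, U i t * U l t : ℤ) : ℝ)) ᵥ* ((G.adjugate).map (Int.castRingHom ℝ)) := by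
      rw [← h1, Matrix.vecMul_vecMul, ← Matrix.map_mul, Matrix.mul_adjugate]
      funext l
      have : ((G.det • (1 : Matrix J J ℤ)).map (Int.castRingHom ℝ)) = (G.det : ℝ) • (1 : Matrix J J ℝ) := by
        ext a b
        rw [Matrix.map_apply, Matrix.smul_apply, Matrix.smul_apply, Matrix.one_apply, Matrix.one_apply]
        split_ifs <;> simp
      rw [this, Matrix.vecMul_smul, Matrix.vecMul_one]
    have h5 : ∃ m : ℤ, (G.det : ℝ) * D i j = m := by
      refine ⟨∑ l : J, (∑ t, U i t * U l t) * G.adjugate l j, ?_⟩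
      have := congrFun h4 j
      simp only [Pi.smul_apply, smul_eq_mul] at this
      rw [this]
      simp [Matrix.vecMul, dotProduct]
    obtain ⟨m, hm⟩ := h5
    rw [Nat.cast_natAbs]
    rcases abs_choice G.det with h | h <;> rw [h]
    · exact ⟨m, hm⟩
    · exact ⟨-m, by rw [Int.cast_neg, Int.cast_neg]; linarith⟩
  classical
  obtain ⟨hq1, hq2⟩ := Nat.find_spec hex
  set q := Nat.find hex with hq
  choose M0 hM using hq2
  let M : Matrix {i // i ∉ J} J ℤ := M0
  replace hM : ∀ (i : {i // i ∉ J}) (j : J), (q : ℝ) * D i j = M i j := hM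
  have hq0 : (0 : ℝ) < q := by exact_mod_cast hq1
  refine ⟨q, M, hq1, fun i j => ?_, fun q' hq' h => ?_, fun i => ?_⟩
  · have h1 : |(M i j : ℝ)| ≤ q := by
      rw [← hM, abs_mul, abs_of_pos hq0]
      exact mul_le_of_le_one_right hq0.le (hD _ _)
    exact_mod_cast h1
  · refine Nat.find_min' hex ⟨hq', fun i j => ?_⟩
    obtain ⟨m, hm⟩ := h i j
    refine ⟨m, ?_⟩
    have hm' : (q' : ℝ) * M i j = q * m := by exact_mod_cast hm
    rw [← hM] at hm'
    have : (q : ℝ) * (q' * D i j) = q * m := by linarith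
    exact mul_left_cancel₀ hq0.ne' this
  · apply ci_inj
    rw [ci_smul, ← cst_apply, hV i]
    show _ = cst (icmb M _) i
    rw [cst_icmb, Finset.smul_sum]
    refine Finset.sum_congr rfl fun j _ => ?_
    rw [smul_smul]
    have := hM i j
    push_cast
    rw [this]
    rfl

/-- index set for pivots -/
abbrev QI {ι : Type*} (J : Finset ι) := Σ q : ℕ, ({i // i ∉ J} → J → Fin (2 * (q + 1) + 1))

/-- the matrix -/
def qmat {ι : Type*} {J : Finset ι} (a : QI J) : Matrix {i // i ∉ J} J ℤ :=
  fun i j => ((a.2 i j : ℕ) : ℤ) - (a.1 + 1 : ℕ)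

lemma sum_QI {ι : Type*} [Fintype ι] [DecidableEq ι] (J : Finset ι)
    (h : J.card * (Fintype.card ι - J.card) + 2 ≤ d) :
    ∑' a : QI J, ENNReal.ofReal ((((a.1 + 1 : ℕ) : ℝ))⁻¹ ^ d) < ⊤ := by
  rw [ENNReal.tsum_sigma']
  set s := J.card * (Fintype.card ι - J.card) with hs
  have : ∀ a : ℕ, ∑' _ : ({i // i ∉ J} → J → Fin (2 * (a + 1) + 1)), ENNReal.ofReal ((((a + 1 : ℕ) : ℝ))⁻¹ ^ d) ≤
      ENNReal.ofReal (3 ^ s * (1 / ((a + 1 : ℕ) : ℝ) ^ 2)) := by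
    intro a
    have hc : Fintype.card ({i // i ∉ J} → J → Fin (2 * (a + 1) + 1)) = (2 * (a + 1) + 1) ^ s := by
      rw [Fintype.card_fun, Fintype.card_fun, Fintype.card_fin, Fintype.card_coe, ← pow_mul,
        Fintype.card_subtype_compl, Fintype.card_coe]
    rw [tsum_fintype, Finset.sum_const, Finset.card_univ, hc,
      nsmul_eq_mul, ← ENNReal.ofReal_natCast, ← ENNReal.ofReal_mul (by positivity)]
    apply ENNReal.ofReal_le_ofReal
    have h1 : (1 : ℝ) ≤ ((a + 1 : ℕ) : ℝ) := by push_cast; linarith [Nat.cast_nonneg (α := ℝ) a]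
    obtain ⟨t, rfl⟩ : ∃ t, d = s + 2 + t := ⟨d - (s + 2), by omega⟩
    rw [inv_pow, Nat.cast_pow, pow_add, pow_add]
    have h3 : ((2 * (a + 1) + 1 : ℕ) : ℝ) ^ s ≤ 3 ^ s * ((a + 1 : ℕ) : ℝ) ^ s := by
      rw [← mul_pow]
      refine pow_le_pow_left₀ (by positivity) ?_ _
      push_cast; linarith [Nat.cast_nonneg (α := ℝ) a]
    refine (mul_le_mul_of_nonneg_right h3 (by positivity)).trans ?_
    clear h3
    generalize ((a + 1 : ℕ) : ℝ) = x at h1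
    have hx : 0 < x := by linarith
    rw [mul_assoc]
    refine mul_le_mul_of_nonneg_left ?_ (by positivity)
    rw [mul_assoc, mul_inv, ← mul_assoc, mul_inv_cancel₀ (by positivity), one_mul, mul_inv, one_div]
    exact mul_le_of_le_one_right (by positivity) (inv_le_one_of_one_le₀ (one_le_pow₀ h1))
  refine lt_of_le_of_lt (ENNReal.tsum_le_tsum this) ?_
  have hs : Summable (fun a : ℕ => 3 ^ s * (1 / ((a + 1 : ℕ) : ℝ) ^ 2)) :=
    ((summable_nat_add_iff 1).2 (Real.summable_one_div_nat_pow.2 (by norm_num : 1 < 2))).mul_left _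
  rw [← ENNReal.ofReal_tsum_of_nonneg (fun a => by positivity) hs]
  exact ENNReal.ofReal_lt_top

theorem T5 {ι : Type*} [Fintype ι] [DecidableEq ι] (J : Finset ι)
    (h : J.card * (Fintype.card ι - J.card) + 2 ≤ d) (hJ : J.card + 2 ≤ d) :
    ∃ C : ℝ≥0∞, C < ⊤ ∧ ∀ (N : ℕ) (μ : Measure (XspaceN d N)), Good μ → ∀ (f : (ι → Fin d → ℝ) → ℝ≥0∞)
      (φ : (J → Fin d → ℝ) → ℝ≥0∞), Measurable φ → (∀ V, f V ≤ φ (fun j => V j)) →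
      ∫⁻ x, Tsum (OJ d J) f x ∂μ ≤ C * ∫⁻ V, φ V := by
  obtain ⟨C, hC, hP⟩ := T3 (κ := J) (d := d) (by simpa using hJ)
  refine ⟨C * ∑' a : QI J, ENNReal.ofReal ((((a.1 + 1 : ℕ) : ℝ))⁻¹ ^ d),
    ENNReal.mul_lt_top hC (sum_QI J h), fun N μ hμ f φ hφ hf => ?_⟩
  have h1 : ∀ x : XspaceN d N, Tsum (OJ d J) f x ≤ ∑' a : {a : QI J // Mini (a.1 + 1) (qmat a)},
      Tsum (OqM d (a.1.1 + 1) (qmat a.1)) φ x := by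
    intro x
    refine Ssum_le_sigma _ _ _ _ _ (fun a U i => if hi : i ∈ J then U ⟨i, hi⟩ else
      fun t => icmb (qmat a.1) U ⟨i, hi⟩ t / ((a.1.1 + 1 : ℕ) : ℤ)) fun U hU _ => ?_
    obtain ⟨hU1, q, M, hq, hM, hmin, hUM⟩ := hU
    obtain ⟨q, rfl⟩ : ∃ q', q = q' + 1 := ⟨q - 1, by omega⟩
    have ha : qmat (⟨q, fun i j => Fin.ofNat _ (M i j + (q + 1 : ℕ)).toNat⟩ : QI J) = M := by
      ext i j
      have := abs_le.1 (hM i j)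
      simp only [qmat, Fin.ofNat]
      rw [Nat.mod_eq_of_lt] <;> omega
    refine ⟨⟨⟨q, fun i j => Fin.ofNat _ (M i j + (q + 1 : ℕ)).toNat⟩, by rw [ha]; exact hmin⟩,
      fun j => U j, ?_, ?_, ?_⟩
    · simp only [ha]
      refine ⟨hU1, fun i t => ?_⟩
      rw [← hUM i]
      exact Dvd.intro _ rfl
    · simp only [ha]
      funext i
      split_ifs with hi
      · rfl
      · funext t
        rw [← hUM ⟨i, hi⟩]
        simp only [Pi.smul_apply, smul_eq_mul]
        exact Int.mul_ediv_cancel_left _ (by positivity)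
    · exact hf _
  refine (lintegral_mono h1).trans ?_
  rw [lintegral_tsum (fun a => (measurable_Tsum (OqM_stab _ _) hφ).aemeasurable)]
  have h2 : ∀ a : {a : QI J // Mini (a.1 + 1) (qmat a)}, ∫⁻ x, Tsum (OqM d (a.1.1 + 1) (qmat a.1)) φ x ∂μ ≤
      C * ENNReal.ofReal ((((a.1.1 + 1 : ℕ) : ℝ))⁻¹ ^ d) * ∫⁻ V, φ V := by
    intro a
    exact T4 hP (a.1.1 + 1) (by omega) (qmat a.1) a.2 N μ hμ φ hφ
  refine (ENNReal.tsum_le_tsum h2).trans ?_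
  rw [ENNReal.tsum_mul_right, ENNReal.tsum_mul_left]
  refine mul_le_mul' (mul_le_mul' le_rfl ?_) le_rfl
  exact ENNReal.tsum_comp_le_tsum_of_injective Subtype.val_injective
    (fun a : QI J => ENNReal.ofReal ((((a.1 + 1 : ℕ) : ℝ))⁻¹ ^ d))

end PartG

section PartH

open scoped ENNReal Topology

variable {d N : ℕ}

/-- points of S in the dilated body -/
def Pts (S : Set (Fin d → ℤ)) (g : SLR d) (R : ℝ) : Set (Fin d → ℤ) :=
  {u | u ∈ S ∧ ‖(g : Matrix (Fin d) (Fin d) ℝ) *ᵥ ci u‖ ≤ R}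

lemma Pts_finite (S : Set (Fin d → ℤ)) (g : SLR d) (R : ℝ) : (Pts S g R).Finite := by
  have h := finite_pts (ι := Unit) g R
  refine ((h.preimage (f := fun (u : Fin d → ℤ) (_ : Unit) => u)
    (fun a _ b _ hab => congrFun hab ()))).subset ?_
  intro u hu
  show _ ∈ Metric.closedBall _ _
  rw [mem_closedBall_zero_iff, pi_norm_le_iff_of_nonempty]
  intro _
  exact hu.2

/-- tuples in S -/
def OC (κ : Type*) (S : Set (Fin d → ℤ)) : Set (κ → Fin d → ℤ) := {U | ∀ i, U i ∈ S}

lemma Ssum_OC {κ : Type*} [Fintype κ] (S : Set (Fin d → ℤ)) (g : SLR d) {R : ℝ} (hR : 0 ≤ R) :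
    Ssum (OC κ S) ((Metric.closedBall 0 R).indicator 1) (g : Matrix (Fin d) (Fin d) ℝ) =
      ((Nat.card (Pts S g R) : ℕ) : ℝ≥0∞) ^ Fintype.card κ := by
  classical
  unfold Ssum
  have h1 : ∀ U : OC κ S, act (g : Matrix (Fin d) (Fin d) ℝ) (cst U.1) ∈ Metric.closedBall (0 : κ → Fin d → ℝ) R ↔
      ∀ i, U.1 i ∈ Pts S g R := by
    intro U
    rw [mem_closedBall_zero_iff, pi_norm_le_iff_of_nonneg hR]
    exact ⟨fun h i => ⟨U.2 i, h i⟩, fun h i => (h i).2⟩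
  have h2 : (∑' U : OC κ S, (Metric.closedBall (0 : κ → Fin d → ℝ) R).indicator (1 : (κ → Fin d → ℝ) → ℝ≥0∞) (act (g : Matrix (Fin d) (Fin d) ℝ) (cst U.1)))
      = ∑' _ : {U : OC κ S | ∀ i, U.1 i ∈ Pts S g R}, (1 : ℝ≥0∞) := by
    rw [tsum_subtype {U : OC κ S | ∀ i, U.1 i ∈ Pts S g R} (fun _ => (1 : ℝ≥0∞))]
    refine tsum_congr fun U => ?_
    by_cases h : ∀ i, U.1 i ∈ Pts S g R
    · rw [Set.indicator_of_mem ((h1 U).2 h), Set.indicator_of_mem (by exact h)]; rfl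
    · rw [Set.indicator_of_notMem (fun hh => h ((h1 U).1 hh)), Set.indicator_of_notMem (by exact h)]
  let e : {U : OC κ S | ∀ i, U.1 i ∈ Pts S g R} ≃ (κ → Pts S g R) :=
    { toFun := fun U i => ⟨U.1.1 i, U.2 i⟩
      invFun := fun f => ⟨⟨fun i => (f i).1, fun i => (f i).2.1⟩, fun i => (f i).2⟩
      left_inv := fun U => rfl
      right_inv := fun f => rfl }
  haveI := (Pts_finite S g R).fintype
  rw [h2, ENNReal.tsum_const, mul_one, ENat.card_congr e, ENat.card_eq_coe_fintype_card, Fintype.card_fun,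
    Nat.card_eq_fintype_card, ENat.toENNReal_coe, Nat.cast_pow]

/-- the coset -/
def Cs (N : ℕ) (v₀ : Fin d → ℤ) : Set (Fin d → ℤ) := {u | ∀ j, (N : ℤ) ∣ u j - v₀ j}

lemma Cs_stab (N : ℕ) (v₀ : Fin d → ℤ) (γ : Matrix.SpecialLinearGroup (Fin d) ℤ)
    (hγ : γ ∈ (MonoidHom.ker (Matrix.SpecialLinearGroup.map (n := Fin d) (Int.castRingHom (ZMod N)))))
    (u : Fin d → ℤ) (hu : u ∈ Cs N v₀) : (γ : Matrix (Fin d) (Fin d) ℤ) *ᵥ u ∈ Cs N v₀ := by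
  have hγ' : ∀ i j, (N : ℤ) ∣ (γ : Matrix (Fin d) (Fin d) ℤ) i j - (1 : Matrix (Fin d) (Fin d) ℤ) i j := by
    intro i j
    rw [MonoidHom.mem_ker] at hγ
    have := congrArg (fun A : Matrix.SpecialLinearGroup (Fin d) (ZMod N) => (A : Matrix (Fin d) (Fin d) (ZMod N)) i j) hγ
    simp only [Matrix.SpecialLinearGroup.map_apply_coe, RingHom.mapMatrix_apply, Matrix.map_apply,
      Matrix.SpecialLinearGroup.coe_one] at this
    rw [← ZMod.intCast_zmod_eq_zero_iff_dvd, Int.cast_sub, sub_eq_zero]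
    refine this.trans ?_
    simp only [Matrix.one_apply]
    split_ifs <;> simp
  intro j
  have h1 : ((γ : Matrix (Fin d) (Fin d) ℤ) *ᵥ u) j - v₀ j = (u j - v₀ j) +
      ∑ t, ((γ : Matrix (Fin d) (Fin d) ℤ) j t - (1 : Matrix (Fin d) (Fin d) ℤ) j t) * u t := by
    simp only [Matrix.mulVec, dotProduct, sub_mul, Finset.sum_sub_distrib, Matrix.one_apply]
    simp
  rw [h1]
  exact dvd_add (hu j) (Finset.dvd_sum fun t _ => Dvd.dvd.mul_right (hγ' j t) _)

lemma OC_stab (κ : Type*) (N : ℕ) (v₀ : Fin d → ℤ) : Stab N (OC κ (Cs N v₀)) :=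
  fun γ hγ U hU i => Cs_stab N v₀ γ hγ _ (hU i)

lemma vol_body (g : SLR d) {R : ℝ} (hR : 0 ≤ R) :
    volume {y : Fin d → ℝ | ‖(g : Matrix (Fin d) (Fin d) ℝ) *ᵥ y‖ ≤ R} = ENNReal.ofReal ((2 * R) ^ d) := by
  have hd : LinearMap.det (Matrix.toLin' (g : Matrix (Fin d) (Fin d) ℝ)) = 1 := by
    rw [LinearMap.det_toLin']; exact g.det_coe
  have h := Measure.addHaar_preimage_linearMap (volume : Measure (Fin d → ℝ))
    (f := Matrix.toLin' (g : Matrix (Fin d) (Fin d) ℝ)) (by rw [hd]; exact one_ne_zero)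
    (Metric.closedBall 0 R)
  rw [hd] at h
  rw [Real.volume_pi_closedBall _ hR, inv_one, abs_one, ENNReal.ofReal_one, one_mul, Fintype.card_fin] at h
  rw [← h]
  congr 1
  ext y
  simp [Matrix.toLin'_apply]

/-- cubes -/
def cube (N : ℕ) (u : Fin d → ℤ) : Set (Fin d → ℝ) :=
  Set.pi Set.univ fun j => Set.Ico (u j : ℝ) ((u j : ℝ) + N)

lemma vol_cube (N : ℕ) (u : Fin d → ℤ) : volume (cube N u) = ENNReal.ofReal ((N : ℝ) ^ d) := by
  rw [cube, Real.volume_pi_Ico]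
  simp [ENNReal.ofReal_pow]

lemma exists_rho (g : SLR d) (N : ℕ) : ∃ ρ : ℝ, 0 ≤ ρ ∧ ∀ y : Fin d → ℝ, ‖y‖ ≤ N →
    ‖(g : Matrix (Fin d) (Fin d) ℝ) *ᵥ y‖ ≤ ρ := by
  let L := LinearMap.toContinuousLinearMap (Matrix.toLin' (g : Matrix (Fin d) (Fin d) ℝ))
  refine ⟨‖L‖ * N, by positivity, fun y hy => ?_⟩
  have : ‖L y‖ ≤ ‖L‖ * N := (L.le_opNorm y).trans (by gcongr)
  simpa [L, Matrix.toLin'_apply] using this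

lemma cube_norm (N : ℕ) (u : Fin d → ℤ) (y : Fin d → ℝ) (hy : y ∈ cube N u) : ‖y - ci u‖ ≤ N := by
  rw [pi_norm_le_iff_of_nonneg (by positivity)]
  intro j
  have := hy j (Set.mem_univ _)
  simp only [Set.mem_Ico] at this
  rw [Real.norm_eq_abs, abs_le]
  simp only [Pi.sub_apply, ci]
  constructor <;> linarith [Nat.cast_nonneg (α := ℝ) N]

lemma count_bounds (hN : 0 < N) (v₀ : Fin d → ℤ) (g : SLR d) : ∃ ρ : ℝ, 0 ≤ ρ ∧ ∀ R : ℝ, ρ ≤ R →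
    (2 * (R - ρ)) ^ d ≤ (N : ℝ) ^ d * Nat.card (Pts (Cs N v₀) g R) ∧
    (N : ℝ) ^ d * Nat.card (Pts (Cs N v₀) g R) ≤ (2 * (R + ρ)) ^ d := by
  obtain ⟨ρ, hρ, hg⟩ := exists_rho g N
  refine ⟨ρ, hρ, fun R hR => ?_⟩
  have hN' : (0 : ℝ) < N := by exact_mod_cast hN
  haveI := (Pts_finite (Cs N v₀) g R).fintype
  have hcount : ∑' u : Pts (Cs N v₀) g R, volume (cube N u.1) =
      ENNReal.ofReal ((N : ℝ) ^ d * Nat.card (Pts (Cs N v₀) g R)) := by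
    simp only [vol_cube]
    rw [tsum_fintype, Finset.sum_const, Finset.card_univ, nsmul_eq_mul, mul_comm,
      ENNReal.ofReal_mul (by positivity), ENNReal.ofReal_natCast, Nat.card_eq_fintype_card]
  constructor
  · rw [← ENNReal.ofReal_le_ofReal_iff (by positivity), ← hcount, ← vol_body g (by linarith)]
    refine (measure_mono ?_).trans (measure_iUnion_le _)
    intro y hy
    have hy' : ‖(g : Matrix (Fin d) (Fin d) ℝ) *ᵥ y‖ ≤ R - ρ := hy
    let u : Fin d → ℤ := fun j => v₀ j + N * ⌊(y j - v₀ j) / N⌋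
    have hyu : y ∈ cube N u := by
      intro j _
      have h1 := Int.floor_le ((y j - v₀ j) / (N : ℝ))
      have h2 := Int.lt_floor_add_one ((y j - v₀ j) / (N : ℝ))
      rw [le_div_iff₀ hN'] at h1
      rw [div_lt_iff₀ hN'] at h2
      simp only [u, Set.mem_Ico]
      push_cast
      constructor <;> nlinarith
    rw [Set.mem_iUnion]
    refine ⟨⟨u, fun j => ⟨⌊(y j - v₀ j) / N⌋, by simp [u]⟩, ?_⟩, hyu⟩
    have h3 := hg _ (cube_norm N u y hyu)
    have h4 : (g : Matrix (Fin d) (Fin d) ℝ) *ᵥ ci u = (g : Matrix (Fin d) (Fin d) ℝ) *ᵥ y -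
        (g : Matrix (Fin d) (Fin d) ℝ) *ᵥ (y - ci u) := by
      rw [Matrix.mulVec_sub]; abel
    rw [h4]
    exact (norm_sub_le _ _).trans (by linarith)
  · rw [← ENNReal.ofReal_le_ofReal_iff (by have : 0 ≤ R + ρ := by linarith
                                           positivity), ← hcount, ← vol_body g (by linarith)]
    rw [← measure_iUnion]
    · refine measure_mono (Set.iUnion_subset fun u y hy => ?_)
      have h3 := hg _ (cube_norm N u.1 y hy)
      have h4 : (g : Matrix (Fin d) (Fin d) ℝ) *ᵥ y = (g : Matrix (Fin d) (Fin d) ℝ) *ᵥ ci u.1 +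
          (g : Matrix (Fin d) (Fin d) ℝ) *ᵥ (y - ci u.1) := by
        rw [Matrix.mulVec_sub]; abel
      show ‖_‖ ≤ _
      rw [h4]
      exact (norm_add_le _ _).trans (add_le_add u.2.2 h3)
    · intro u u' huu
      rw [Function.onFun, Set.disjoint_left]
      intro y hy hy'
      apply huu
      ext j
      have h1 := hy j (Set.mem_univ _)
      have h2 := hy' j (Set.mem_univ _)
      simp only [Set.mem_Ico] at h1 h2
      have h3 : (u.1 j : ℝ) < u'.1 j + N := by linarith
      have h4 : (u'.1 j : ℝ) < u.1 j + N := by linarith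
      have h3' : u.1 j < u'.1 j + N := by exact_mod_cast h3
      have h4' : u'.1 j < u.1 j + N := by exact_mod_cast h4
      have h5 : (N : ℤ) ∣ u.1 j - u'.1 j := by
        have := dvd_sub (u.2.1 j) (u'.2.1 j)
        simpa using this
      have h6 := Int.eq_zero_of_abs_lt_dvd h5 (by rw [abs_lt]; constructor <;> linarith)
      linarith
    · intro u
      exact MeasurableSet.univ_pi fun j => measurableSet_Ico

lemma count_tendsto (hN : 0 < N) (v₀ : Fin d → ℤ) (g : SLR d) :
    Filter.Tendsto (fun n : ℕ => (Nat.card (Pts (Cs N v₀) g (n + 1 : ℕ)) : ℝ) / (2 * ((n + 1 : ℕ) : ℝ)) ^ d)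
      Filter.atTop (𝓝 (((N : ℝ) ^ d)⁻¹)) := by
  obtain ⟨ρ, hρ, h⟩ := count_bounds hN v₀ g
  have hN' : (0 : ℝ) < N := by exact_mod_cast hN
  have hlim : ∀ s : ℝ, Filter.Tendsto (fun n : ℕ => ((N : ℝ) ^ d)⁻¹ * (1 + s / ((n + 1 : ℕ) : ℝ)) ^ d)
      Filter.atTop (𝓝 (((N : ℝ) ^ d)⁻¹)) := by
    intro s
    have h1 : Filter.Tendsto (fun n : ℕ => s / ((n + 1 : ℕ) : ℝ)) Filter.atTop (𝓝 0) :=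
      (Filter.tendsto_add_atTop_iff_nat (f := fun n : ℕ => s / (n : ℝ)) 1).2 (tendsto_const_div_atTop_nhds_zero_nat s)
    have h2 := (((h1.const_add 1).pow d).const_mul (((N : ℝ) ^ d)⁻¹))
    simpa using h2
  refine tendsto_of_tendsto_of_tendsto_of_le_of_le' (hlim (-ρ)) (hlim ρ) ?_ ?_
  · filter_upwards [Filter.eventually_ge_atTop ⌈ρ⌉₊] with n hn
    have hR : ρ ≤ ((n + 1 : ℕ) : ℝ) := (Nat.le_ceil ρ).trans (by exact_mod_cast hn.trans (Nat.le_succ n))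
    have h1 := (h _ hR).1
    have hp : (0 : ℝ) < ((n + 1 : ℕ) : ℝ) := by positivity
    generalize ((n + 1 : ℕ) : ℝ) = R at *
    rw [le_div_iff₀ (by positivity), mul_assoc, ← mul_pow, inv_mul_le_iff₀ (by positivity)]
    have e : (1 + -ρ / R) * (2 * R) = 2 * (R - ρ) := by field_simp; ring
    rw [e]; exact h1
  · filter_upwards [Filter.eventually_ge_atTop ⌈ρ⌉₊] with n hn
    have hR : ρ ≤ ((n + 1 : ℕ) : ℝ) := (Nat.le_ceil ρ).trans (by exact_mod_cast hn.trans (Nat.le_succ n))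
    have h1 := (h _ hR).2
    have hp : (0 : ℝ) < ((n + 1 : ℕ) : ℝ) := by positivity
    generalize ((n + 1 : ℕ) : ℝ) = R at *
    rw [div_le_iff₀ (by positivity), mul_assoc, ← mul_pow, le_inv_mul_iff₀ (by positivity)]
    have e : (1 + ρ / R) * (2 * R) = 2 * (R + ρ) := by field_simp
    rw [e]; exact h1

lemma count_dom (S : Set (Fin d → ℤ)) (g : SLR d) (n : ℕ) :
    Nat.card (Pts S g (n + 1 : ℕ)) ≤ (Nat.card (Pts Set.univ g 1)) * (2 * (n + 1) + 1) ^ d := by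
  classical
  have hf := Pts_finite S g (n + 1 : ℕ)
  have hf1 := Pts_finite Set.univ g 1
  rw [Nat.card_coe_set_eq, Nat.card_coe_set_eq, Set.ncard_eq_toFinset_card _ hf, Set.ncard_eq_toFinset_card _ hf1]
  let fl : (Fin d → ℤ) → (Fin d → ℤ) := fun u j => ⌊((g : Matrix (Fin d) (Fin d) ℝ) *ᵥ ci u) j⌋
  let t : Finset (Fin d → ℤ) := Fintype.piFinset fun _ => Finset.Icc (-(n + 1 : ℤ)) (n + 1)
  have ht : t.card = (2 * (n + 1) + 1) ^ d := by
    simp only [t, Fintype.card_piFinset, Int.card_Icc, Finset.prod_const, Finset.card_univ, Fintype.card_fin]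
    congr 1
    omega
  rw [← ht]
  refine Finset.card_le_mul_card_image_of_maps_to (f := fl) ?_ _ ?_
  · intro u hu
    have hu' : u ∈ Pts S g (n + 1 : ℕ) := hf.mem_toFinset.1 hu
    rw [Fintype.mem_piFinset]
    intro j
    have h1 := (pi_norm_le_iff_of_nonneg (by positivity)).1 hu'.2 j
    rw [Real.norm_eq_abs, abs_le] at h1
    rw [Finset.mem_Icc]
    constructor
    · rw [Int.le_floor]; push_cast at h1 ⊢; linarith
    · have : ⌊((g : Matrix (Fin d) (Fin d) ℝ) *ᵥ ci u) j⌋ ≤ ⌊((n + 1 : ℕ) : ℝ)⌋ := Int.floor_le_floor h1.2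
      rw [Int.floor_natCast] at this
      exact_mod_cast this
  · intro b _
    rcases Finset.eq_empty_or_nonempty {a ∈ hf.toFinset | fl a = b} with h0 | ⟨u0, hu0⟩
    · rw [h0]; simp
    · refine Finset.card_le_card_of_injOn (fun u => u - u0) ?_ (fun a _ b _ h => by simpa using h)
      intro u hu
      have hu' := (Finset.mem_filter.1 (Finset.mem_coe.1 hu)).2
      have hu0' := (Finset.mem_filter.1 hu0).2
      rw [Finset.mem_coe, Set.Finite.mem_toFinset]
      refine ⟨Set.mem_univ _, ?_⟩
      rw [ci_sub, Matrix.mulVec_sub, pi_norm_le_iff_of_nonneg (by norm_num)]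
      intro j
      have h1 := congrFun (hu'.trans hu0'.symm) j
      simp only [fl] at h1
      rw [Real.norm_eq_abs, Pi.sub_apply]
      exact (Int.abs_sub_lt_one_of_floor_eq_floor h1).le

end PartH

section PartI

open scoped ENNReal Topology

variable {d N : ℕ}

lemma OJ_stab {ι : Type*} (J : Finset ι) : Stab N (OJ d J) := by
  rintro γ hγ U ⟨h1, q, M, hq, hM, hmin, h⟩
  refine ⟨Ind_stab (N := N) _ γ hγ _ h1, q, M, hq, hM, hmin, fun i => ?_⟩
  have h2 := congrArg (fun u => (γ : Matrix (Fin d) (Fin d) ℤ) *ᵥ u) (h i)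
  simp only [Matrix.mulVec_smul] at h2
  refine h2.trans ?_
  simp only [icmb, Matrix.mulVec_sum, Matrix.mulVec_smul]

lemma Stab_inter {ι : Type*} {O O' : Set (ι → Fin d → ℤ)} (h : Stab N O) (h' : Stab N O') : Stab N (O ∩ O') :=
  fun γ hγ U hU => ⟨h γ hγ U hU.1, h' γ hγ U hU.2⟩

lemma OJ_univ {ι : Type*} [Fintype ι] {U : ι → Fin d → ℤ} (h : U ∈ OJ d (Finset.univ : Finset ι)) :
    U ∈ Ind ι d := by
  have h1 := h.1
  let e : ι ≃ (Finset.univ : Finset ι) := ⟨fun i => ⟨i, Finset.mem_univ _⟩, fun i => i.1, fun _ => rfl, fun _ => rfl⟩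
  exact LinearIndependent.comp (v := cst (fun j : (Finset.univ : Finset ι) => U j)) h1 e e.injective

lemma OJ_empty {ι : Type*} {U : ι → Fin d → ℤ} (h : U ∈ OJ d (∅ : Finset ι)) : U = 0 := by
  obtain ⟨_, q, M, hq, _, _, h⟩ := h
  funext i
  have h2 := h ⟨i, Finset.notMem_empty i⟩
  have h3 : icmb M (fun j : (∅ : Finset ι) => U j) ⟨i, Finset.notMem_empty i⟩ = 0 := by
    simp [icmb]
  rw [h3] at h2
  rcases smul_eq_zero.1 h2 with h4 | h4
  · omega
  · exact h4

lemma Ssum_cover {ι A : Type*} (O O1 : Set (ι → Fin d → ℤ)) (t : Finset A) (O' : A → Set (ι → Fin d → ℤ))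
    (h : ∀ U ∈ O, U ∈ O1 ∨ ∃ a ∈ t, U ∈ O' a) (f : (ι → Fin d → ℝ) → ℝ≥0∞) (g : Matrix (Fin d) (Fin d) ℝ) :
    Ssum O f g ≤ Ssum O1 f g + ∑ a ∈ t, Ssum (O' a) f g := by
  have hs : O ⊆ O1 ∪ ⋃ a ∈ t, O' a := by
    intro U hU
    rcases h U hU with h | ⟨a, ha, h⟩
    · exact Or.inl h
    · exact Or.inr (Set.mem_biUnion ha h)
  let F : (ι → Fin d → ℤ) → ℝ≥0∞ := fun U => f (act g (cst U))
  refine (ENNReal.tsum_mono_subtype F hs).trans ((ENNReal.tsum_union_le F _ _).trans ?_)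
  exact add_le_add le_rfl (ENNReal.tsum_biUnion_le F t O')

lemma vol_ballk {κ : Type*} [Fintype κ] {R : ℝ} (hR : 0 ≤ R) :
    volume (Metric.closedBall (0 : κ → Fin d → ℝ) R) = ENNReal.ofReal ((2 * R) ^ d) ^ Fintype.card κ := by
  rw [volume_pi_closedBall _ hR]
  simp only [Real.volume_pi_closedBall _ hR, Finset.prod_const, Finset.card_univ, Fintype.card_fin]

def indB (κ : Type*) [Fintype κ] (d : ℕ) (R : ℝ) : (κ → Fin d → ℝ) → ℝ≥0∞ := (Metric.closedBall 0 R).indicator 1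

lemma indB_meas {κ : Type*} [Fintype κ] (R : ℝ) : Measurable (indB κ d R) :=
  measurable_one.indicator Metric.isClosed_closedBall.measurableSet

lemma indB_int {κ : Type*} [Fintype κ] {R : ℝ} (hR : 0 ≤ R) :
    ∫⁻ V, indB κ d R V = ENNReal.ofReal ((2 * R) ^ d) ^ Fintype.card κ := by
  rw [← vol_ballk hR]
  exact lintegral_indicator_one Metric.isClosed_closedBall.measurableSet

lemma indB_restr {κ : Type*} [Fintype κ] (J : Finset κ) {R : ℝ} (hR : 0 ≤ R) (V : κ → Fin d → ℝ) :
    indB κ d R V ≤ indB J d R (fun j => V j) := by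
  unfold indB
  by_cases h : V ∈ Metric.closedBall (0 : κ → Fin d → ℝ) R
  · have h' : (fun j : J => V j) ∈ Metric.closedBall (0 : J → Fin d → ℝ) R := by
      rw [mem_closedBall_zero_iff, pi_norm_le_iff_of_nonneg hR] at h ⊢
      exact fun j => h j
    rw [Set.indicator_of_mem h, Set.indicator_of_mem h']; rfl
  · rw [Set.indicator_of_notMem h]; exact zero_le

lemma ratio_eq {κ : Type*} [Fintype κ] (S : Set (Fin d → ℤ)) (g : SLR d) (n : ℕ) :
    Ssum (OC κ S) (indB κ d (n + 1 : ℕ)) (g : Matrix (Fin d) (Fin d) ℝ) /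
      ENNReal.ofReal ((2 * ((n + 1 : ℕ) : ℝ)) ^ d) ^ Fintype.card κ =
    ENNReal.ofReal (((Nat.card (Pts S g (n + 1 : ℕ)) : ℝ) / (2 * ((n + 1 : ℕ) : ℝ)) ^ d) ^ Fintype.card κ) := by
  have h := Ssum_OC (κ := κ) S g (R := ((n + 1 : ℕ) : ℝ)) (by positivity)
  unfold indB
  rw [h, div_pow, ENNReal.ofReal_div_of_pos (by positivity), ENNReal.ofReal_pow (by positivity),
    ENNReal.ofReal_pow (by positivity), ENNReal.ofReal_natCast, ENNReal.ofReal_pow (n := Fintype.card κ) (by positivity),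
    ENNReal.ofReal_pow (n := d) (by positivity)]

lemma ratio_dom {κ : Type*} [Fintype κ] (S : Set (Fin d → ℤ)) (g : SLR d) (n : ℕ) :
    Ssum (OC κ S) (indB κ d (n + 1 : ℕ)) (g : Matrix (Fin d) (Fin d) ℝ) /
      ENNReal.ofReal ((2 * ((n + 1 : ℕ) : ℝ)) ^ d) ^ Fintype.card κ ≤
    ((2 : ℝ≥0∞) ^ d) ^ Fintype.card κ * Ssum (OC κ Set.univ) (indB κ d 1) (g : Matrix (Fin d) (Fin d) ℝ) := by
  rw [ratio_eq]
  have h := Ssum_OC (κ := κ) Set.univ g (R := (1 : ℝ)) (by positivity)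
  unfold indB
  rw [h, ← mul_pow, ENNReal.ofReal_pow (by positivity)]
  gcongr
  have h1 : ((2 : ℝ≥0∞) ^ d) * (Nat.card (Pts Set.univ g 1) : ℝ≥0∞) =
      ENNReal.ofReal (2 ^ d * (Nat.card (Pts Set.univ g 1) : ℝ)) := by
    rw [ENNReal.ofReal_mul (by positivity), ENNReal.ofReal_natCast, ENNReal.ofReal_pow (by positivity)]
    simp
  rw [h1]
  apply ENNReal.ofReal_le_ofReal
  rw [div_le_iff₀ (by positivity)]
  have h2 : (Nat.card (Pts S g (n + 1 : ℕ)) : ℝ) ≤ (Nat.card (Pts Set.univ g 1) : ℝ) * (2 * (n + 1) + 1) ^ d := by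
    exact_mod_cast count_dom S g n
  refine h2.trans ?_
  have h3 : ((2 * ((n : ℝ) + 1) + 1) : ℝ) ^ d ≤ (2 * (2 * ((n + 1 : ℕ) : ℝ))) ^ d := by
    gcongr
    push_cast
    linarith [Nat.cast_nonneg (α := ℝ) n]
  rw [mul_pow 2 (2 * ((n + 1 : ℕ) : ℝ))] at h3
  calc _ ≤ (Nat.card (Pts Set.univ g 1) : ℝ) * (2 ^ d * (2 * ((n + 1 : ℕ) : ℝ)) ^ d) := by gcongr
    _ = _ := by ring

theorem T6 [NeZero d] {κ : Type*} [Fintype κ] [DecidableEq κ]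
    (h1 : ∀ r ≤ Fintype.card κ, r * (Fintype.card κ - r) + 2 ≤ d) (h2 : Fintype.card κ + 2 ≤ d)
    (hN : 0 < N) (v₀ : Fin d → ℤ) {μ : Measure (XspaceN d N)} (hμ : Good μ)
    (F : (κ → Fin d → ℝ) → ℝ≥0∞) (hF : Measurable F) :
    ∫⁻ x, Tsum (OC κ (Cs N v₀) ∩ Ind κ d) F x ∂μ =
      ENNReal.ofReal ((((N : ℝ) ^ d)⁻¹) ^ Fintype.card κ) * ∫⁻ V, F V := by
  haveI := hμ.prob
  have hst : Stab N (OC κ (Cs N v₀) ∩ Ind κ d) := Stab_inter (OC_stab κ N v₀) (Ind_stab κ)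
  obtain ⟨c, hc⟩ := T1 hμ hst (fun U hU => hU.2) (by omega)
  rw [hc F hF]
  congr 1
  have hT5 := fun J : Finset κ => T5 (d := d) J (h1 _ (Finset.card_le_univ J))
    (by have := Finset.card_le_univ J; omega)
  choose C hC hCb using hT5
  set m := Fintype.card κ with hm
  let w : ℕ → ℝ≥0∞ := fun n => ENNReal.ofReal ((2 * ((n + 1 : ℕ) : ℝ)) ^ d)
  have hw0 : ∀ n, w n ≠ 0 := fun n => by
    simp only [w, ne_eq, ENNReal.ofReal_eq_zero, not_le]; positivity
  have hwt : ∀ n, w n ≠ ⊤ := fun n => ENNReal.ofReal_ne_top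
  let A : ℕ → XspaceN d N → ℝ≥0∞ := fun n x => Tsum (OC κ (Cs N v₀)) (indB κ d (n + 1 : ℕ)) x
  have hAm : ∀ n, Measurable (A n) := fun n => measurable_Tsum (OC_stab κ N v₀) (indB_meas _)
  have L1 : Filter.Tendsto (fun n => ∫⁻ x, A n x / w n ^ m ∂μ) Filter.atTop
      (𝓝 (∫⁻ _, ENNReal.ofReal ((((N : ℝ) ^ d)⁻¹) ^ m) ∂μ)) := by
    refine tendsto_lintegral_of_dominated_convergence
      (fun x => ((2 : ℝ≥0∞) ^ d) ^ m * Tsum (OC κ Set.univ) (indB κ d 1) x) (fun n => (hAm n).div_const _) ?_ ?_ ?_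
    · intro n
      exact Filter.Eventually.of_forall fun x => ratio_dom (κ := κ) (Cs N v₀) (Quotient.out x) n
    · rw [lintegral_const_mul' _ _ (by simp)]
      refine ENNReal.mul_ne_top (by simp) (ne_of_lt ?_)
      have hb : ∀ x : XspaceN d N, Tsum (OC κ Set.univ) (indB κ d 1) x ≤
          ∑ J : Finset κ, Tsum (OJ d J) (indB κ d 1) x := by
        intro x
        refine (Ssum_cover _ ∅ Finset.univ (fun J => OJ d J) ?_ _ _).trans ?_
        · intro U _
          obtain ⟨J, hJ⟩ := pivot U
          exact Or.inr ⟨J, Finset.mem_univ _, hJ⟩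
        · have : Ssum (∅ : Set (κ → Fin d → ℤ)) (indB κ d 1) ((Quotient.out x : SLR d) : Matrix (Fin d) (Fin d) ℝ) = 0 := by
            simp [Ssum]
          rw [this, zero_add]; rfl
      refine (lintegral_mono hb).trans_lt ?_
      rw [lintegral_finset_sum _ (fun J _ => measurable_Tsum (OJ_stab J) (indB_meas _))]
      refine ENNReal.sum_lt_top.2 fun J _ => ?_
      refine (hCb J N μ hμ _ (indB J d 1) (indB_meas _) (indB_restr J zero_le_one)).trans_lt ?_
      rw [indB_int zero_le_one]
      exact ENNReal.mul_lt_top (hC J) (ENNReal.pow_lt_top ENNReal.ofReal_lt_top)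
    · refine Filter.Eventually.of_forall fun x => ?_
      have h3 : ∀ n, A n x / w n ^ m = ENNReal.ofReal (((Nat.card (Pts (Cs N v₀) (Quotient.out x : SLR d) (n + 1 : ℕ)) : ℝ) /
          (2 * ((n + 1 : ℕ) : ℝ)) ^ d) ^ m) := fun n => ratio_eq _ _ n
      simp only [h3]
      exact (ENNReal.continuous_ofReal.tendsto _).comp ((count_tendsto hN v₀ (Quotient.out x)).pow m)
  rw [lintegral_const, measure_univ, mul_one] at L1
  have L2 : Filter.Tendsto (fun n => ∫⁻ x, A n x / w n ^ m ∂μ) Filter.atTop (𝓝 c) := by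
    have hdiv : ∀ n, ∫⁻ x, A n x / w n ^ m ∂μ = (∫⁻ x, A n x ∂μ) / w n ^ m := by
      intro n
      simp only [div_eq_mul_inv]
      rw [lintegral_mul_const _ (hAm n)]
    have hwm0 : ∀ n, w n ^ m ≠ 0 := fun n => pow_ne_zero _ (hw0 n)
    have hwmt : ∀ n, w n ^ m ≠ ⊤ := fun n => ENNReal.pow_ne_top (hwt n)
    have hlow : ∀ n, c ≤ ∫⁻ x, A n x / w n ^ m ∂μ := by
      intro n
      rw [hdiv, ENNReal.le_div_iff_mul_le (Or.inl (hwm0 n)) (Or.inl (hwmt n))]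
      have := hc (indB κ d (n + 1 : ℕ)) (indB_meas _)
      rw [indB_int (by positivity)] at this
      refine this.symm.le.trans (lintegral_mono fun x => ?_)
      exact ENNReal.tsum_mono_subtype (fun U : κ → Fin d → ℤ => indB κ d (n + 1 : ℕ)
        (act ((Quotient.out x : SLR d) : Matrix (Fin d) (Fin d) ℝ) (cst U))) Set.inter_subset_left
    have hup : ∀ n, ∫⁻ x, A n x / w n ^ m ∂μ ≤ c + (∑ J ∈ Finset.univ.erase (Finset.univ : Finset κ), C J) * (w n)⁻¹ := by
      intro n
      rw [hdiv, ENNReal.div_le_iff_le_mul (Or.inl (hwm0 n)) (Or.inl (hwmt n)), add_mul]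
      have hb : ∀ x : XspaceN d N, A n x ≤ Tsum (OC κ (Cs N v₀) ∩ Ind κ d) (indB κ d (n + 1 : ℕ)) x +
          ∑ J ∈ Finset.univ.erase (Finset.univ : Finset κ), Tsum (OJ d J) (indB κ d (n + 1 : ℕ)) x := by
        intro x
        refine Ssum_cover _ _ _ (fun J => OJ d J) ?_ _ _
        intro U hU
        obtain ⟨J, hJ⟩ := pivot U
        by_cases hJu : J = Finset.univ
        · subst hJu; exact Or.inl ⟨hU, OJ_univ hJ⟩
        · exact Or.inr ⟨J, Finset.mem_erase.2 ⟨hJu, Finset.mem_univ _⟩, hJ⟩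
      refine (lintegral_mono hb).trans ?_
      rw [lintegral_add_left (measurable_Tsum hst (indB_meas _)), hc _ (indB_meas _), indB_int (by positivity),
        lintegral_finset_sum _ (fun J _ => measurable_Tsum (OJ_stab J) (indB_meas _))]
      refine add_le_add le_rfl ?_
      rw [mul_assoc, Finset.sum_mul]
      refine Finset.sum_le_sum fun J hJ => ?_
      refine (hCb J N μ hμ _ (indB J d (n + 1 : ℕ)) (indB_meas _) (indB_restr J (by positivity))).trans ?_
      rw [indB_int (by positivity)]
      gcongr
      have hlt : J.card < m := by
        refine lt_of_le_of_ne (Finset.card_le_univ J) fun h => (Finset.mem_erase.1 hJ).1 ?_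
        exact (Finset.card_eq_iff_eq_univ J).1 h
      obtain ⟨s, hs⟩ : ∃ s, m = s + 1 := ⟨m - 1, by omega⟩
      have hw1 : 1 ≤ w n := by
        simp only [w, ENNReal.one_le_ofReal]
        apply one_le_pow₀
        push_cast
        linarith [Nat.cast_nonneg (α := ℝ) n]
      rw [hs, pow_succ', ← mul_assoc, ENNReal.inv_mul_cancel (hw0 n) (hwt n), one_mul, Fintype.card_coe]
      exact pow_le_pow_right₀ hw1 (by omega)
    refine tendsto_of_tendsto_of_tendsto_of_le_of_le tendsto_const_nhds ?_ hlow hup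
    have hwinf : Filter.Tendsto (fun n => (w n)⁻¹) Filter.atTop (𝓝 0) := by
      rw [← ENNReal.inv_top]
      refine ENNReal.tendsto_inv_iff.2 ?_
      refine ENNReal.tendsto_ofReal_nhds_top.2 ?_
      refine (Filter.tendsto_pow_atTop (NeZero.ne d)).comp ?_
      refine Filter.Tendsto.const_mul_atTop (by norm_num) ?_
      exact (Filter.tendsto_add_atTop_iff_nat (f := fun n : ℕ => (n : ℝ)) 1).2 tendsto_natCast_atTop_atTop
    have hCt : (∑ J ∈ Finset.univ.erase (Finset.univ : Finset κ), C J) ≠ ⊤ :=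
      (ENNReal.sum_lt_top.2 fun J _ => hC J).ne
    have := (ENNReal.Tendsto.const_mul hwinf (Or.inr hCt)).const_add c
    simpa using this
  exact tendsto_nhds_unique L2 L1

end PartI

section PartJ

open scoped ENNReal Topology

variable {d N : ℕ}

lemma Ssum_card {κ : Type*} [Fintype κ] (O : Set (κ → Fin d → ℤ)) {E : Set (κ → Fin d → ℝ)}
    (hE : Bornology.IsBounded E) (g : SLR d) :
    Ssum O (E.indicator 1) (g : Matrix (Fin d) (Fin d) ℝ) =
      ((Nat.card {v : κ → Fin d → ℤ | v ∈ O ∧ act (g : Matrix (Fin d) (Fin d) ℝ) (cst v) ∈ E} : ℕ) : ℝ≥0∞) := by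
  classical
  obtain ⟨R, hR⟩ := hE.subset_closedBall 0
  set T := {v : κ → Fin d → ℤ | v ∈ O ∧ act (g : Matrix (Fin d) (Fin d) ℝ) (cst v) ∈ E} with hT
  have hfin : T.Finite := (finite_pts (ι := κ) g R).subset fun v hv => hR hv.2
  haveI := hfin.fintype
  unfold Ssum
  have h2 : (∑' U : O, E.indicator (1 : (κ → Fin d → ℝ) → ℝ≥0∞) (act (g : Matrix (Fin d) (Fin d) ℝ) (cst U.1)))
      = ∑' _ : T, (1 : ℝ≥0∞) := by
    rw [tsum_subtype T (fun _ => (1 : ℝ≥0∞)),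
      tsum_subtype O (fun U => E.indicator (1 : (κ → Fin d → ℝ) → ℝ≥0∞) (act (g : Matrix (Fin d) (Fin d) ℝ) (cst U)))]
    refine tsum_congr fun U => ?_
    by_cases h : U ∈ O
    · rw [Set.indicator_of_mem h]
      by_cases h' : act (g : Matrix (Fin d) (Fin d) ℝ) (cst U) ∈ E
      · rw [Set.indicator_of_mem h', Set.indicator_of_mem (show U ∈ T from ⟨h, h'⟩)]; rfl
      · rw [Set.indicator_of_notMem h', Set.indicator_of_notMem (fun hh : U ∈ T => h' hh.2)]
    · rw [Set.indicator_of_notMem h, Set.indicator_of_notMem (fun hh : U ∈ T => h hh.1)]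
  rw [h2, ENNReal.tsum_const, mul_one, ENat.card_eq_coe_fintype_card, Nat.card_eq_fintype_card,
    ENat.toENNReal_coe]

/-- the doubled function -/
def dbl {α β : Type*} (f : (α → Fin d → ℝ) → ℝ≥0∞) (h : (β → Fin d → ℝ) → ℝ≥0∞)
    (V : α ⊕ β → Fin d → ℝ) : ℝ≥0∞ := f (fun a => V (Sum.inl a)) * h (fun b => V (Sum.inr b))

lemma Ssum_sq {α : Type*} (S : Set (Fin d → ℤ)) (f : (α → Fin d → ℝ) → ℝ≥0∞)
    (g : Matrix (Fin d) (Fin d) ℝ) :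
    Ssum (OC α S) f g ^ 2 = Ssum (OC (α ⊕ α) S) (dbl f f) g := by
  let e : OC (α ⊕ α) S ≃ OC α S × OC α S :=
    { toFun := fun U => (⟨fun a => U.1 (Sum.inl a), fun a => U.2 _⟩, ⟨fun a => U.1 (Sum.inr a), fun a => U.2 _⟩)
      invFun := fun p => ⟨Sum.elim p.1.1 p.2.1, fun i => by
        rcases i with a | a
        · exact p.1.2 a
        · exact p.2.2 a⟩
      left_inv := fun U => by
        ext i : 2
        rcases i with a | a <;> rfl
      right_inv := fun p => rfl }
  have h1 : Ssum (OC (α ⊕ α) S) (dbl f f) g = ∑' p : OC α S × OC α S,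
      f (act g (cst p.1.1)) * f (act g (cst p.2.1)) := by
    unfold Ssum
    rw [← e.tsum_eq]
    rfl
  rw [h1, ENNReal.tsum_prod (f := fun a b : OC α S => f (act g (cst a.1)) * f (act g (cst b.1))), sq]
  simp only [ENNReal.tsum_mul_left, ENNReal.tsum_mul_right]
  rfl

lemma lintegral_dbl {r s : ℕ} {f : (Fin r → Fin d → ℝ) → ℝ≥0∞} {h : (Fin s → Fin d → ℝ) → ℝ≥0∞}
    (hf : Measurable f) (hh : Measurable h) :
    ∫⁻ V, dbl f h V = (∫⁻ V, f V) * ∫⁻ V, h V := by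
  have hm := volume_measurePreserving_sumPiEquivProdPi_symm (fun _ : Fin r ⊕ Fin s => Fin d → ℝ)
  rw [← hm.lintegral_comp_emb (MeasurableEquiv.measurableEmbedding _), Measure.volume_eq_prod]
  exact lintegral_prod_mul hf.aemeasurable hh.aemeasurable

lemma measurable_dbl {α β : Type*} {f : (α → Fin d → ℝ) → ℝ≥0∞} {h : (β → Fin d → ℝ) → ℝ≥0∞}
    (hf : Measurable f) (hh : Measurable h) : Measurable (dbl f h) := by
  refine Measurable.mul (hf.comp ?_) (hh.comp ?_) <;>
  exact measurable_pi_lambda _ fun a => measurable_pi_apply _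

lemma J_equiv {k : ℕ} (J : Finset (Fin k ⊕ Fin k)) : ∃ e : Fin J.toLeft.card ⊕ Fin J.toRight.card ≃ J,
    (∀ a, (e (Sum.inl a) : Fin k ⊕ Fin k) = Sum.inl (J.toLeft.orderEmbOfFin rfl a)) ∧
    (∀ a, (e (Sum.inr a) : Fin k ⊕ Fin k) = Sum.inr (J.toRight.orderEmbOfFin rfl a)) := by
  let p : Fin J.toLeft.card ⊕ Fin J.toRight.card → J := Sum.elim
    (fun a => ⟨Sum.inl (J.toLeft.orderEmbOfFin rfl a), Finset.mem_toLeft.1 (Finset.orderEmbOfFin_mem _ _ _)⟩)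
    (fun a => ⟨Sum.inr (J.toRight.orderEmbOfFin rfl a), Finset.mem_toRight.1 (Finset.orderEmbOfFin_mem _ _ _)⟩)
  have hp : Function.Bijective p := by
    rw [Fintype.bijective_iff_injective_and_card]
    constructor
    · rintro (a | a) (b | b) h
      · have := congrArg Subtype.val h
        simp only [p, Sum.elim_inl, Sum.inl.injEq] at this
        rw [(J.toLeft.orderEmbOfFin rfl).injective this]
      · have := congrArg Subtype.val h
        simp [p] at this
      · have := congrArg Subtype.val h
        simp [p] at this
      · have := congrArg Subtype.val h
        simp only [p, Sum.elim_inr, Sum.inr.injEq] at this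
        rw [(J.toRight.orderEmbOfFin rfl).injective this]
    · simp [Finset.card_toLeft_add_card_toRight]
  exact ⟨Equiv.ofBijective p hp, fun a => rfl, fun a => rfl⟩

/-- closed projection bound -/
def Acl (Er : (r : ℕ) → Set (Fin r → Fin d → ℝ)) (r : ℕ) : Set (Fin r → Fin d → ℝ) :=
  if r = 0 then Set.univ else closure (Er r)

lemma Acl_meas (Er : (r : ℕ) → Set (Fin r → Fin d → ℝ)) (r : ℕ) : MeasurableSet (Acl Er r) := by
  unfold Acl
  split_ifs
  · exact MeasurableSet.univ
  · exact isClosed_closure.measurableSet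

lemma jordan_closure {α : Type*} [TopologicalSpace α] [MeasureSpace α] {E : Set α} (h : volume (frontier E) = 0) :
    volume (closure E) = volume E := by
  refine le_antisymm ?_ (measure_mono subset_closure)
  rw [closure_eq_self_union_frontier]
  exact (measure_union_le _ _).trans (by rw [h, add_zero])

lemma jordan_interior {α : Type*} [TopologicalSpace α] [MeasureSpace α] {E : Set α} (h : volume (frontier E) = 0) :
    volume (interior E) = volume E := by
  refine le_antisymm (measure_mono interior_subset) ?_
  have : E ⊆ interior E ∪ frontier E := subset_closure.trans (closure_eq_interior_union_frontier E).subset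
  exact (measure_mono this).trans ((measure_union_le _ _).trans (by rw [h, add_zero]))

lemma jvol_nonneg (r : ℕ) (S : Set (Fin r → Fin d → ℝ)) : 0 ≤ jvol d r S := by
  unfold jvol
  split_ifs
  · exact zero_le_one
  · exact ENNReal.toReal_nonneg

lemma Acl_vol {k : ℕ} (Er : (r : ℕ) → Set (Fin r → Fin d → ℝ))
    (hEr : ∀ r, 1 ≤ r → r ≤ k → JordanMeasurable (Er r)) (r : ℕ) (hr : r ≤ k) :
    volume (Acl Er r) = ENNReal.ofReal (jvol d r (Er r)) := by
  rcases Nat.eq_zero_or_pos r with rfl | h0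
  · simp only [Acl, jvol, if_true, ENNReal.ofReal_one]
    rw [volume_pi, Measure.pi_of_empty]
    simp
  · have h := hEr r h0 hr
    simp only [Acl, jvol, h0.ne', if_false]
    rw [jordan_closure h.2, ENNReal.ofReal_toReal h.1.measure_lt_top.ne]

/-- pulled back bound -/
def fJ {k : ℕ} (Er : (r : ℕ) → Set (Fin r → Fin d → ℝ)) (J : Finset (Fin k ⊕ Fin k))
    (V : Fin k ⊕ Fin k → Fin d → ℝ) : ℝ≥0∞ :=
  (Acl Er J.toLeft.card).indicator 1 (fun a => V (Sum.inl (J.toLeft.orderEmbOfFin rfl a))) *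
  (Acl Er J.toRight.card).indicator 1 (fun a => V (Sum.inr (J.toRight.orderEmbOfFin rfl a)))

lemma fJ_meas {k : ℕ} (Er : (r : ℕ) → Set (Fin r → Fin d → ℝ)) (J : Finset (Fin k ⊕ Fin k)) :
    Measurable (fJ (d := d) Er J) := by
  refine Measurable.mul ((measurable_one.indicator (Acl_meas _ _)).comp ?_)
    ((measurable_one.indicator (Acl_meas _ _)).comp ?_) <;>
  exact measurable_pi_lambda _ fun a => measurable_pi_apply _

lemma fJ_bound {k : ℕ} (J : Finset (Fin k ⊕ Fin k))
    (h : J.card * (Fintype.card (Fin k ⊕ Fin k) - J.card) + 2 ≤ d) (hJ : J.card + 2 ≤ d) :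
    ∃ C : ℝ≥0∞, C < ⊤ ∧ ∀ (N : ℕ) (μ : Measure (XspaceN d N)), Good μ →
      ∀ Er : (r : ℕ) → Set (Fin r → Fin d → ℝ),
      ∫⁻ x, Tsum (OJ d J) (fJ Er J) x ∂μ ≤
        C * (volume (Acl Er J.toLeft.card) * volume (Acl Er J.toRight.card)) := by
  obtain ⟨C, hC, hb⟩ := T5 (d := d) J h hJ
  refine ⟨C, hC, fun N μ hμ Er => ?_⟩
  obtain ⟨e, he1, he2⟩ := J_equiv J
  let f1 : (Fin J.toLeft.card → Fin d → ℝ) → ℝ≥0∞ := (Acl Er J.toLeft.card).indicator 1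
  let f2 : (Fin J.toRight.card → Fin d → ℝ) → ℝ≥0∞ := (Acl Er J.toRight.card).indicator 1
  have hf1 : Measurable f1 := measurable_one.indicator (Acl_meas _ _)
  have hf2 : Measurable f2 := measurable_one.indicator (Acl_meas _ _)
  have hm : Measurable (fun V : J → Fin d → ℝ => dbl f1 f2 (fun i => V (e i))) :=
    (measurable_dbl hf1 hf2).comp (measurable_pi_lambda _ fun a => measurable_pi_apply _)
  refine (hb N μ hμ (fJ Er J) (fun V => dbl f1 f2 (fun i => V (e i))) hm ?_).trans ?_
  · intro V
    refine le_of_eq ?_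
    simp only [fJ, dbl, he1, he2]
    rfl
  · rw [lintegral_reindex e, lintegral_dbl hf1 hf2, lintegral_indicator_one (Acl_meas _ _),
      lintegral_indicator_one (Acl_meas _ _)]

end PartJ

section PartK

open scoped ENNReal Topology

variable {d N : ℕ}

lemma act_cst_zero {ι : Type*} (g : Matrix (Fin d) (Fin d) ℝ) : act g (cst (0 : ι → Fin d → ℤ)) = 0 := by
  have h : cst (0 : ι → Fin d → ℤ) = 0 := by funext i j; simp [cst]
  rw [h]; funext i
  simp [act]

lemma Ssum_zero {ι : Type*} (f : (ι → Fin d → ℝ) → ℝ≥0∞) (g : Matrix (Fin d) (Fin d) ℝ) :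
    Ssum {(0 : ι → Fin d → ℤ)} f g = f 0 := by
  unfold Ssum
  rw [tsum_singleton (0 : ι → Fin d → ℤ) (fun U => f (act g (cst U))), act_cst_zero]

/-- contribution of the zero tuple -/
def zz {k : ℕ} (S : Set (Fin d → ℤ)) (E : Set (Fin k → Fin d → ℝ)) : ℝ :=
  open Classical in if 0 ∈ S ∧ 0 ∈ E then 1 else 0

lemma Ssum_lower {k : ℕ} (hk : 1 ≤ k) (S : Set (Fin d → ℤ)) (E : Set (Fin k → Fin d → ℝ))
    (g : Matrix (Fin d) (Fin d) ℝ) :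
    Ssum (OC (Fin k) S ∩ Ind (Fin k) d) ((interior E).indicator 1) g + ENNReal.ofReal (zz S E) ≤
      Ssum (OC (Fin k) S) (E.indicator 1) g := by
  have hmono : Ssum (OC (Fin k) S ∩ Ind (Fin k) d) ((interior E).indicator 1) g ≤
      Ssum (OC (Fin k) S ∩ Ind (Fin k) d) (E.indicator 1) g :=
    ENNReal.tsum_le_tsum fun U => Set.indicator_le_indicator_of_subset interior_subset (fun _ => zero_le) _
  by_cases h : 0 ∈ S ∧ 0 ∈ E
  · have hz : ENNReal.ofReal (zz S E) = Ssum {(0 : Fin k → Fin d → ℤ)} (E.indicator 1) g := by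
      rw [Ssum_zero, Set.indicator_of_mem h.2, zz, if_pos h]; simp
    rw [hz]
    refine (add_le_add hmono le_rfl).trans ?_
    let F : (Fin k → Fin d → ℤ) → ℝ≥0∞ := fun U => E.indicator 1 (act g (cst U))
    have hdis : Disjoint (OC (Fin k) S ∩ Ind (Fin k) d) {(0 : Fin k → Fin d → ℤ)} := by
      rw [Set.disjoint_singleton_right]
      intro hh
      have h2 : LinearIndependent ℝ (cst (0 : Fin k → Fin d → ℤ)) := hh.2
      exact h2.ne_zero (⟨0, hk⟩ : Fin k) (by funext j; simp [cst])
    have h3 := Summable.tsum_union_disjoint (f := F) hdis ENNReal.summable ENNReal.summable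
    refine (le_of_eq h3.symm).trans ?_
    refine ENNReal.tsum_mono_subtype F (Set.union_subset Set.inter_subset_left ?_)
    rw [Set.singleton_subset_iff]
    exact fun i => h.1
  · have hz : ENNReal.ofReal (zz S E) = 0 := by rw [zz, if_neg h]; simp
    rw [hz, add_zero]
    exact hmono.trans (ENNReal.tsum_mono_subtype (fun U => E.indicator 1 (act g (cst U))) Set.inter_subset_left)

/-- proper nonempty subsets -/
def PJ (k : ℕ) : Finset (Finset (Fin k ⊕ Fin k)) := (Finset.univ.erase Finset.univ).erase ∅

lemma Ssum_upper {k : ℕ} (S : Set (Fin d → ℤ)) (E : Set (Fin k → Fin d → ℝ))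
    (Er : (r : ℕ) → Set (Fin r → Fin d → ℝ))
    (hproj : ∀ r, 1 ≤ r → r ≤ k → ∀ j : Fin r → Fin k, StrictMono j →
          ∀ v ∈ E, (fun a => v (j a)) ∈ Er r)
    (hk : 1 ≤ k) (g : Matrix (Fin d) (Fin d) ℝ) :
    Ssum (OC (Fin k ⊕ Fin k) S) (dbl (E.indicator 1) (E.indicator 1)) g ≤
      Ssum (OC (Fin k ⊕ Fin k) S ∩ Ind (Fin k ⊕ Fin k) d)
        (dbl ((closure E).indicator 1) ((closure E).indicator 1)) g + ENNReal.ofReal (zz S E) +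
      ∑ J ∈ PJ k, Ssum (OJ d J) (fJ Er J) g := by
  have hAcl : ∀ (r : ℕ) (j : Fin r → Fin k), StrictMono j → r ≤ k → ∀ v ∈ E, (fun a => v (j a)) ∈ Acl Er r := by
    intro r j hj hr v hv
    unfold Acl
    split_ifs with h0
    · exact Set.mem_univ _
    · exact subset_closure (hproj r (Nat.pos_of_ne_zero h0) hr j hj v hv)
  have hfJ : ∀ J (V : Fin k ⊕ Fin k → Fin d → ℝ), dbl (E.indicator 1) (E.indicator 1) V ≤ fJ Er J V := by
    intro J V
    refine mul_le_mul' ?_ ?_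
    · by_cases h : (fun a => V (Sum.inl a)) ∈ E
      · have h' := hAcl _ (J.toLeft.orderEmbOfFin rfl) (OrderEmbedding.strictMono _)
          ((Finset.card_le_univ _).trans (by simp)) _ h
        rw [Set.indicator_of_mem h, Set.indicator_of_mem h']; rfl
      · rw [Set.indicator_of_notMem h]; exact zero_le
    · by_cases h : (fun a => V (Sum.inr a)) ∈ E
      · have h' := hAcl _ (J.toRight.orderEmbOfFin rfl) (OrderEmbedding.strictMono _)
          ((Finset.card_le_univ _).trans (by simp)) _ h
        rw [Set.indicator_of_mem h, Set.indicator_of_mem h']; rfl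
      · rw [Set.indicator_of_notMem h]; exact zero_le
  have hcl : ∀ V : Fin k ⊕ Fin k → Fin d → ℝ, dbl (E.indicator 1) (E.indicator 1) V ≤
      dbl ((closure E).indicator 1) ((closure E).indicator 1) V := fun V =>
    mul_le_mul' (Set.indicator_le_indicator_of_subset subset_closure (fun _ => zero_le) _)
      (Set.indicator_le_indicator_of_subset subset_closure (fun _ => zero_le) _)
  let O0 : Set (Fin k ⊕ Fin k → Fin d → ℤ) := OC (Fin k ⊕ Fin k) S ∩ {0}
  refine (Ssum_cover _ ((OC (Fin k ⊕ Fin k) S ∩ Ind (Fin k ⊕ Fin k) d) ∪ O0)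
    (PJ k) (fun J => OJ d J) ?_ _ g).trans ?_
  · intro U hU
    obtain ⟨J, hJ⟩ := pivot U
    by_cases hu : J = Finset.univ
    · subst hu; exact Or.inl (Or.inl ⟨hU, OJ_univ hJ⟩)
    · by_cases he : J = ∅
      · subst he; exact Or.inl (Or.inr ⟨hU, OJ_empty hJ⟩)
      · exact Or.inr ⟨J, Finset.mem_erase.2 ⟨he, Finset.mem_erase.2 ⟨hu, Finset.mem_univ _⟩⟩, hJ⟩
  · refine add_le_add ?_ (Finset.sum_le_sum fun J _ => ENNReal.tsum_le_tsum fun U => hfJ J _)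
    let F : (Fin k ⊕ Fin k → Fin d → ℤ) → ℝ≥0∞ := fun U => dbl (E.indicator 1) (E.indicator 1) (act g (cst U))
    refine (ENNReal.tsum_union_le F _ _).trans (add_le_add (ENNReal.tsum_le_tsum fun U => hcl _) ?_)
    by_cases hS : 0 ∈ S
    · have h1 : (∑' U : O0, F U) ≤ ∑' U : ({0} : Set (Fin k ⊕ Fin k → Fin d → ℤ)), F U :=
        ENNReal.tsum_mono_subtype F Set.inter_subset_right
      refine h1.trans ?_
      refine (Ssum_zero (dbl (E.indicator 1) (E.indicator 1)) g).le.trans ?_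
      by_cases hE : (0 : Fin k → Fin d → ℝ) ∈ E
      · have h2 : E.indicator (1 : (Fin k → Fin d → ℝ) → ℝ≥0∞) 0 = 1 := Set.indicator_of_mem hE _
        rw [zz, if_pos ⟨hS, hE⟩, ENNReal.ofReal_one]
        show E.indicator 1 (0 : Fin k → Fin d → ℝ) * E.indicator 1 (0 : Fin k → Fin d → ℝ) ≤ 1
        rw [h2, one_mul]
      · have h2 : E.indicator (1 : (Fin k → Fin d → ℝ) → ℝ≥0∞) 0 = 0 := Set.indicator_of_notMem hE _
        show E.indicator 1 (0 : Fin k → Fin d → ℝ) * E.indicator 1 (0 : Fin k → Fin d → ℝ) ≤ _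
        rw [h2, zero_mul]; exact zero_le
    · have h0 : O0 = ∅ := by
        ext U
        simp only [O0, Set.mem_inter_iff, Set.mem_singleton_iff, Set.mem_empty_iff_false, iff_false, not_and]
        rintro hU rfl
        exact hS (hU (Sum.inl ⟨0, hk⟩))
      rw [h0]
      simp

end PartK

section PartL

open scoped ENNReal Topology

variable {d N : ℕ}

lemma first_moment [NeZero d] {k : ℕ} (hk : 1 ≤ k) (hd : k ^ 2 + 3 ≤ d) (hN : 0 < N) (v₀ : Fin d → ℤ)
    {μ : Measure (XspaceN d N)} (hμ : Good μ) {E : Set (Fin k → Fin d → ℝ)} (hE : JordanMeasurable E) :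
    ENNReal.ofReal ((((N : ℝ) ^ d)⁻¹) ^ k * (volume E).toReal + zz (Cs N v₀) E) ≤
      ∫⁻ x, Tsum (OC (Fin k) (Cs N v₀)) (E.indicator 1) x ∂μ := by
  haveI := hμ.prob
  have hz : 0 ≤ zz (Cs N v₀) E := by unfold zz; split_ifs <;> norm_num
  have hfin : volume E ≠ ⊤ := hE.1.measure_lt_top.ne
  have hb : ∀ x : XspaceN d N, Tsum (OC (Fin k) (Cs N v₀) ∩ Ind (Fin k) d) ((interior E).indicator 1) x +
      ENNReal.ofReal (zz (Cs N v₀) E) ≤ Tsum (OC (Fin k) (Cs N v₀)) (E.indicator 1) x :=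
    fun x => Ssum_lower hk _ _ _
  refine le_trans (le_of_eq ?_) (lintegral_mono hb)
  have hm : Measurable ((interior E).indicator (1 : (Fin k → Fin d → ℝ) → ℝ≥0∞)) :=
    measurable_one.indicator isOpen_interior.measurableSet
  rw [lintegral_add_left (measurable_Tsum (Stab_inter (OC_stab _ N v₀) (Ind_stab _)) hm),
    T6 (by
      intro r hr
      rw [Fintype.card_fin] at hr ⊢
      have : r * (k - r) ≤ k * k := Nat.mul_le_mul hr (Nat.sub_le _ _)
      nlinarith) (by rw [Fintype.card_fin]; nlinarith) hN v₀ hμ _ hm,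
    lintegral_indicator_one isOpen_interior.measurableSet, jordan_interior hE.2, lintegral_const, measure_univ,
    mul_one, Fintype.card_fin, ENNReal.ofReal_add (by positivity) hz, ENNReal.ofReal_mul (by positivity),
    ENNReal.ofReal_toReal hfin]

lemma second_moment (d k : ℕ) [NeZero d] (hk : 1 ≤ k) (hd : k ^ 2 + 3 ≤ d) : ∃ C : ℝ, 0 < C ∧
    ∀ (N : ℕ), 0 < N → ∀ (v₀ : Fin d → ℤ) (E : Set (Fin k → Fin d → ℝ)) (Er : (r : ℕ) → Set (Fin r → Fin d → ℝ)),
    JordanMeasurable E → (∀ r, 1 ≤ r → r ≤ k → JordanMeasurable (Er r)) →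
    (∀ r, 1 ≤ r → r ≤ k → ∀ j : Fin r → Fin k, StrictMono j →
          ∀ v ∈ E, (fun a => v (j a)) ∈ Er r) →
    ∀ μ : Measure (XspaceN d N), Good μ → ∀ M : ℝ,
    (∀ r1 r2, r1 ≤ k → r2 ≤ k → 1 ≤ r1 + r2 → r1 + r2 ≤ 2 * k - 1 → jvol d r1 (Er r1) * jvol d r2 (Er r2) ≤ M) →
    ∫⁻ x, Tsum (OC (Fin k) (Cs N v₀)) (E.indicator 1) x ^ 2 ∂μ ≤
      ENNReal.ofReal (((((N : ℝ) ^ d)⁻¹) ^ k * (volume E).toReal) ^ 2 + zz (Cs N v₀) E + C * M) := by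
  have hcard : Fintype.card (Fin k ⊕ Fin k) = 2 * k := by simp; ring
  have har : ∀ r ≤ 2 * k, r * (2 * k - r) + 2 ≤ d := by
    intro r hr
    obtain ⟨s, hs⟩ := Nat.exists_eq_add_of_le hr
    have : 2 * k - r = s := by omega
    rw [this]
    have h4 : r * s ≤ k ^ 2 := by
      zify at hs ⊢
      nlinarith [sq_nonneg ((r : ℤ) - s)]
    omega
  have h2k : 2 * k + 2 ≤ d := by nlinarith [sq_nonneg ((k : ℤ) - 1), Nat.pos_of_ne_zero (by omega : k ≠ 0)]
  have hJc : ∀ J : Finset (Fin k ⊕ Fin k), J.card ≤ 2 * k := fun J => by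
    have := Finset.card_le_univ J
    rwa [hcard] at this
  have hT := fun J : Finset (Fin k ⊕ Fin k) => fJ_bound (d := d) J (by rw [hcard]; exact har _ (hJc J))
    (by have := hJc J; omega)
  choose C hC hCb using hT
  have hCt : (∑ J ∈ PJ k, C J) ≠ ⊤ := (ENNReal.sum_lt_top.2 fun J _ => hC J).ne
  refine ⟨(∑ J ∈ PJ k, C J).toReal + 1, by positivity, ?_⟩
  intro N hN v₀ E Er hE hEr hproj μ hμ M hM
  haveI := hμ.prob
  have hz : 0 ≤ zz (Cs N v₀) E := by unfold zz; split_ifs <;> norm_num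
  have hfin : volume E ≠ ⊤ := hE.1.measure_lt_top.ne
  have hM0 : 0 ≤ M := (mul_nonneg (jvol_nonneg _ _) (jvol_nonneg _ _)).trans
    (hM 1 0 hk (Nat.zero_le _) (by omega) (by omega))
  have hmE : Measurable ((closure E).indicator (1 : (Fin k → Fin d → ℝ) → ℝ≥0∞)) :=
    measurable_one.indicator isClosed_closure.measurableSet
  have hb : ∀ x : XspaceN d N, Tsum (OC (Fin k) (Cs N v₀)) (E.indicator 1) x ^ 2 ≤
      Tsum (OC (Fin k ⊕ Fin k) (Cs N v₀) ∩ Ind (Fin k ⊕ Fin k) d)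
        (dbl ((closure E).indicator 1) ((closure E).indicator 1)) x + ENNReal.ofReal (zz (Cs N v₀) E) +
      ∑ J ∈ PJ k, Tsum (OJ d J) (fJ Er J) x := by
    intro x
    refine (Ssum_sq (Cs N v₀) (E.indicator 1) _).le.trans ?_
    exact Ssum_upper (Cs N v₀) E Er hproj hk _
  refine (lintegral_mono hb).trans ?_
  have hm1 := measurable_Tsum (N := N) (Stab_inter (OC_stab (Fin k ⊕ Fin k) N v₀) (Ind_stab (Fin k ⊕ Fin k)))
    (measurable_dbl hmE hmE)
  rw [lintegral_add_left (hm1.add_const _), lintegral_add_left hm1,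
    T6 (by rw [hcard]; exact har) (by rw [hcard]; exact h2k) hN v₀ hμ _ (measurable_dbl hmE hmE),
    lintegral_dbl hmE hmE, lintegral_indicator_one isClosed_closure.measurableSet, jordan_closure hE.2,
    lintegral_const, measure_univ, mul_one, hcard,
    lintegral_finset_sum _ (fun J _ => measurable_Tsum (OJ_stab J) (fJ_meas Er J)),
    ENNReal.ofReal_add (by positivity) (by positivity), ENNReal.ofReal_add (by positivity) hz]
  refine add_le_add (add_le_add (le_of_eq ?_) le_rfl) ?_
  · rw [mul_pow, ← pow_mul, mul_comm k 2, ENNReal.ofReal_mul (by positivity), ENNReal.ofReal_pow (n := 2) (by positivity),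
      ENNReal.ofReal_toReal hfin, sq]
  · have h1 : ∀ J ∈ PJ k, ∫⁻ x, Tsum (OJ d J) (fJ Er J) x ∂μ ≤ C J * ENNReal.ofReal M := by
      intro J hJ
      refine (hCb J N μ hμ Er).trans ?_
      gcongr
      have hl : J.toLeft.card ≤ k := (Finset.card_le_univ _).trans (by simp)
      have hr : J.toRight.card ≤ k := (Finset.card_le_univ _).trans (by simp)
      have hs := J.card_toLeft_add_card_toRight
      rw [Acl_vol Er hEr _ hl, Acl_vol Er hEr _ hr, ← ENNReal.ofReal_mul (jvol_nonneg _ _)]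
      apply ENNReal.ofReal_le_ofReal
      have hJ1 := Finset.mem_erase.1 hJ
      have hJ2 := Finset.mem_erase.1 hJ1.2
      refine hM _ _ hl hr ?_ ?_
      · rw [hs]; exact Finset.card_pos.2 (Finset.nonempty_iff_ne_empty.2 hJ1.1)
      · rw [hs]
        have : J.card ≠ 2 * k := by
          rw [← hcard]
          exact fun h => hJ2.1 ((Finset.card_eq_iff_eq_univ J).1 h)
        have := hJc J
        omega
    refine (Finset.sum_le_sum h1).trans ?_
    rw [← Finset.sum_mul, ENNReal.ofReal_mul (by positivity)]
    gcongr
    conv_lhs => rw [← ENNReal.ofReal_toReal hCt]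
    exact ENNReal.ofReal_le_ofReal (by linarith)

theorem mainThm (d k : ℕ) (hk : 1 ≤ k) (hd : k ^ 2 + 3 ≤ d) :
    ∃ C > (0:ℝ), ∀ (N : ℕ), 0 < N → ∀ v₀ : Fin d → ℤ,
      ∀ (E : Set (Fin k → Fin d → ℝ)) (Er : (r : ℕ) → Set (Fin r → Fin d → ℝ)),
        Er k = E →
        (∀ r, 1 ≤ r → r ≤ k → JordanMeasurable (Er r)) →
        (∀ r, 1 ≤ r → r ≤ k → ∀ j : Fin r → Fin k, StrictMono j →
          ∀ v ∈ E, (fun a => v (j a)) ∈ Er r) →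
        ∀ μ : Measure (XspaceN d N), IsProbabilityMeasure μ →
          (∀ γ : SLR d, Measure.map (fun x => γ • x) μ = μ) →
          ∀ Φ : XspaceN d N → ℝ,
            (∀ g : SLR d, Φ (QuotientGroup.mk g) =
              (Nat.card {v : Fin k → (Fin d → ℤ) |
                (∀ l j, (N : ℤ) ∣ (v l j - v₀ j)) ∧
                (fun i => (g : Matrix (Fin d) (Fin d) ℝ).mulVec
                  (fun j => ((v i j : ℤ) : ℝ))) ∈ E} : ℝ)) →
            0 ≤ (∫ x, (Φ x)^2 ∂μ) - (∫ x, Φ x ∂μ)^2 ∧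
            (∫ x, (Φ x)^2 ∂μ) - (∫ x, Φ x ∂μ)^2 ≤
              C * sSup {x : ℝ | ∃ r1 r2 : ℕ, r1 ≤ k ∧ r2 ≤ k ∧ 1 ≤ r1 + r2 ∧
                r1 + r2 ≤ 2*k - 1 ∧ x = jvol d r1 (Er r1) * jvol d r2 (Er r2)} := by
  haveI : NeZero d := ⟨by omega⟩
  obtain ⟨C, hC, h2⟩ := second_moment d k hk hd
  refine ⟨C, hC, ?_⟩
  intro N hN v₀ E Er hErk hEr hproj μ hμp hinv Φ hΦ
  have hμ : Good μ := ⟨hμp, hinv⟩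
  have hE : JordanMeasurable E := hErk ▸ hEr k hk le_rfl
  set T := {x : ℝ | ∃ r1 r2 : ℕ, r1 ≤ k ∧ r2 ≤ k ∧ 1 ≤ r1 + r2 ∧
                r1 + r2 ≤ 2*k - 1 ∧ x = jvol d r1 (Er r1) * jvol d r2 (Er r2)} with hT
  have hTfin : T.Finite := by
    refine (((Set.finite_Iic k).prod (Set.finite_Iic k)).image
      (fun p : ℕ × ℕ => jvol d p.1 (Er p.1) * jvol d p.2 (Er p.2))).subset ?_
    rintro x ⟨r1, r2, h1, h2, _, _, rfl⟩
    exact ⟨(r1, r2), ⟨h1, h2⟩, rfl⟩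
  have hM : ∀ r1 r2, r1 ≤ k → r2 ≤ k → 1 ≤ r1 + r2 → r1 + r2 ≤ 2 * k - 1 →
      jvol d r1 (Er r1) * jvol d r2 (Er r2) ≤ sSup T := fun r1 r2 a b c e =>
    le_csSup hTfin.bddAbove ⟨r1, r2, a, b, c, e, rfl⟩
  have hM0 : 0 ≤ sSup T := (mul_nonneg (jvol_nonneg _ _) (jvol_nonneg _ _)).trans
    (hM 1 0 hk (Nat.zero_le _) (by omega) (by omega))
  have hΦ' : ∀ x, ∃ n : ℕ, Φ x = n ∧ Tsum (OC (Fin k) (Cs N v₀)) (E.indicator 1) x = (n : ℝ≥0∞) := by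
    intro x
    refine ⟨_, ?_, Ssum_card _ hE.1 _⟩
    have h := hΦ (Quotient.out x)
    have hx : (QuotientGroup.mk (Quotient.out x : SLR d) : XspaceN d N) = x := Quotient.out_eq' x
    rw [hx] at h
    exact h
  have hpos : ∀ x, 0 ≤ Φ x := fun x => by
    obtain ⟨n, h, _⟩ := hΦ' x; rw [h]; positivity
  have hTΦ : ∀ x, Tsum (OC (Fin k) (Cs N v₀)) (E.indicator 1) x = ENNReal.ofReal (Φ x) := fun x => by
    obtain ⟨n, h, h'⟩ := hΦ' x; rw [h, h', ENNReal.ofReal_natCast]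
  by_cases hm : AEStronglyMeasurable Φ μ
  · have hF := first_moment hk hd hN v₀ hμ hE
    have hS := h2 N hN v₀ E Er hE hEr hproj μ hμ (sSup T) hM
    simp only [hTΦ, ← ENNReal.ofReal_pow (hpos _)] at hF hS
    have hm2 : AEStronglyMeasurable (fun x => Φ x ^ 2) μ := hm.pow 2
    have hint2 : Integrable (fun x => Φ x ^ 2) μ := by
      refine ⟨hm2, ?_⟩
      rw [hasFiniteIntegral_iff_ofReal (Filter.Eventually.of_forall fun x => sq_nonneg _)]
      exact hS.trans_lt ENNReal.ofReal_lt_top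
    have hL2 : MemLp Φ 2 μ := (memLp_two_iff_integrable_sq hm).2 hint2
    have hint : Integrable Φ μ := hL2.integrable (by norm_num)
    constructor
    · have h := ProbabilityTheory.variance_eq_sub hL2
      have h' := ProbabilityTheory.variance_nonneg Φ μ
      rw [h] at h'
      exact h'
    · rw [← ofReal_integral_eq_lintegral_ofReal hint (Filter.Eventually.of_forall hpos)] at hF
      rw [← ofReal_integral_eq_lintegral_ofReal hint2 (Filter.Eventually.of_forall fun x => sq_nonneg _)] at hS
      set a := (((N : ℝ) ^ d)⁻¹) ^ k * (volume E).toReal with ha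
      have ha0 : 0 ≤ a := by positivity
      have hz : zz (Cs N v₀) E = 0 ∨ zz (Cs N v₀) E = 1 := by
        unfold zz; split_ifs
        · exact Or.inr rfl
        · exact Or.inl rfl
      have hz0 : 0 ≤ zz (Cs N v₀) E := by rcases hz with h | h <;> rw [h] <;> norm_num
      have hz2 : zz (Cs N v₀) E = zz (Cs N v₀) E ^ 2 := by rcases hz with h | h <;> rw [h] <;> norm_num
      rw [ENNReal.ofReal_le_ofReal_iff (integral_nonneg hpos)] at hF
      rw [ENNReal.ofReal_le_ofReal_iff (by positivity)] at hS
      have h5 : (a + zz (Cs N v₀) E) ^ 2 ≤ (∫ x, Φ x ∂μ) ^ 2 := by gcongr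
      nlinarith [mul_nonneg ha0 hz0]
  · have hm2 : ¬ AEStronglyMeasurable (fun x => Φ x ^ 2) μ := by
      intro h
      apply hm
      have h3 : Φ = fun x => Real.sqrt (Φ x ^ 2) := by
        funext x; rw [Real.sqrt_sq (hpos x)]
      rw [h3]
      exact Real.continuous_sqrt.comp_aestronglyMeasurable h
    rw [integral_non_aestronglyMeasurable hm, integral_non_aestronglyMeasurable hm2]
    constructor
    · norm_num
    · have := mul_nonneg hC.le hM0
      simpa using this

end PartL

/-- Proposition 5.8 (second moment bound for the rank-`k` congruence Siegel transform):
for `2n ≥ k² + 3`, `N ∈ ℕ` and `v₀ ∈ ℤ^{2n}` with `gcd(v₀,N) = 1`, and a Jordan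
measurable `E ⊆ (ℝ^{2n})^k` admitting projection bounds `(E_r)`, the variance of the
rank-`k` congruence Siegel transform of `χ_E` is at most
`C · max{vol_{r₁}(E_{r₁})·vol_{r₂}(E_{r₂}) : 1 ≤ r₁+r₂ ≤ 2k-1}` with `C = C(n,k)`. -/
theorem stmt13 (n k : ℕ) (hk : 1 ≤ k) (hn : 1 ≤ n) (hnk : k^2 + 3 ≤ 2*n) :
    ∃ C > (0:ℝ), ∀ (N : ℕ), 0 < N → ∀ v₀ : Fin (2*n) → ℤ,
      Int.gcd (Finset.univ.gcd v₀) (N : ℤ) = 1 →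
      ∀ (E : Set (Fin k → Fin (2*n) → ℝ)) (Er : (r : ℕ) → Set (Fin r → Fin (2*n) → ℝ)),
        Er k = E →
        (∀ r, 1 ≤ r → r ≤ k → JordanMeasurable (Er r)) →
        (∀ r, 1 ≤ r → r ≤ k → ∀ j : Fin r → Fin k, StrictMono j →
          ∀ v ∈ E, (fun a => v (j a)) ∈ Er r) →
        ∀ μ : Measure (XspaceN (2*n) N), IsProbabilityMeasure μ →
          (∀ γ : SLR (2*n), Measure.map (fun x => γ • x) μ = μ) →
          ∀ Φ : XspaceN (2*n) N → ℝ,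
            (∀ g : SLR (2*n), Φ (QuotientGroup.mk g) =
              (Nat.card {v : Fin k → (Fin (2*n) → ℤ) |
                (∀ l j, (N : ℤ) ∣ (v l j - v₀ j)) ∧
                (fun i => (g : Matrix (Fin (2*n)) (Fin (2*n)) ℝ).mulVec
                  (fun j => ((v i j : ℤ) : ℝ))) ∈ E} : ℝ)) →
            0 ≤ (∫ x, (Φ x)^2 ∂μ) - (∫ x, Φ x ∂μ)^2 ∧
            (∫ x, (Φ x)^2 ∂μ) - (∫ x, Φ x ∂μ)^2 ≤
              C * sSup {x : ℝ | ∃ r1 r2 : ℕ, r1 ≤ k ∧ r2 ≤ k ∧ 1 ≤ r1 + r2 ∧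
                r1 + r2 ≤ 2*k - 1 ∧ x = jvol (2*n) r1 (Er r1) * jvol (2*n) r2 (Er r2)} := by
  obtain ⟨C, hC, h⟩ := mainThm (2*n) k hk hnk
  exact ⟨C, hC, fun N hN v₀ _ => h N hN v₀⟩
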